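/- arXiv:math/0512502 — 2 statements merged into one kernel-verified Lean document; each statement's English description precedes it below -/
import Mathlib

section
/- For every ε > 0 there exists a constant c = c(ε) > 0 such that the following holds whenever 0 < κ_D < κ_O and κ_O ≥ c·κ_D: there exists p_t ∈ (0,1) such that, denoting by R_L^ord := |B_L|^{-1} ∑_{b∈B_L} 1{κ_b = κ_O} the fraction of ordered bonds, for every p ∈ [0,1] with p < p_t one has lim_{L→∞, L even} Q_L(R_L^ord ≤ ε) = 1, and for every p ∈ [0,1] with p > p_t one has lim_{L→∞, L even} Q_L(R_L^ord ≥ 1−ε) = 1. -/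
open MeasureTheory Real Filter
open scoped ENNReal

noncomputable section

abbrev Torus (L : ℕ) := ZMod L × ZMod L
abbrev Edge (L : ℕ) := Torus L × Bool
def estep (L : ℕ) (d : Bool) : Torus L := if d then (1, 0) else (0, 1)
def etarget {L : ℕ} (e : Edge L) : Torus L := e.1 + estep L e.2
def grad {L : ℕ} (φ : Torus L → ℝ) : Edge L → ℝ := fun e => φ (etarget e) - φ e.1

def nuL (L : ℕ) [NeZero L] : Measure (Edge L → ℝ) :=
  Measure.map (fun φ : Torus L → ℝ => grad φ)
    (Measure.map
      (fun ψ : {x : Torus L // x ≠ 0} → ℝ => fun x : Torus L =>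
        if h : x = 0 then (0 : ℝ) else ψ ⟨x, h⟩)
      volume)

def energy (L : ℕ) [NeZero L] (κ η : Edge L → ℝ) : ℝ :=
  (1 / 2) * ∑ b : Edge L, κ b * η b ^ 2

def ZL (L : ℕ) [NeZero L] (κ : Edge L → ℝ) : ℝ≥0∞ :=
  ∫⁻ η, ENNReal.ofReal (Real.exp (-(energy L κ η))) ∂(nuL L)

/-- Product a priori measure on the `κ`'s. -/
def rhoL (L : ℕ) [NeZero L] (ρ : Measure ℝ) : Measure (Edge L → ℝ) :=
  Measure.pi fun _ : Edge L => ρ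

/-- Partition function of the extended model. -/
def ZLV (L : ℕ) [NeZero L] (ρ : Measure ℝ) : ℝ≥0∞ :=
  ∫⁻ x : (Edge L → ℝ) × (Edge L → ℝ),
    ENNReal.ofReal (Real.exp (-(energy L x.2 x.1))) ∂((nuL L).prod (rhoL L ρ))

/-- The extended gradient Gibbs measure `Q_L` on pairs `(η, κ)`. -/
def QL (L : ℕ) [NeZero L] (ρ : Measure ℝ) : Measure ((Edge L → ℝ) × (Edge L → ℝ)) :=
  (ZLV L ρ)⁻¹ •
    (((nuL L).prod (rhoL L ρ)).withDensity fun x =>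
      ENNReal.ofReal (Real.exp (-(energy L x.2 x.1))))

/-- The `η`-marginal `P_L` of `Q_L`. -/
def PL (L : ℕ) [NeZero L] (ρ : Measure ℝ) : Measure (Edge L → ℝ) :=
  (QL L ρ).map Prod.fst

/-- Topological support of a measure on `ℝ`. -/
def measSupport (ρ : Measure ℝ) : Set ℝ := {x | ∀ U ∈ nhds x, 0 < ρ U}

instance two_mul_succ_neZero (n : ℕ) : NeZero (2 * (n + 1)) := ⟨by omega⟩

/-- The two-point a priori bond-weight measure `ρ = p δ_{κO} + (1-p) δ_{κD}`. -/
def rhoTwo (κO κD p : ℝ) : Measure ℝ :=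
  ENNReal.ofReal p • Measure.dirac κO + ENNReal.ofReal (1 - p) • Measure.dirac κD

open scoped Classical in
/-- The fraction `R_L^ord` of ordered bonds in the configuration `κ`. -/
def Rord (L : ℕ) [NeZero L] (κO : ℝ) (κ : Edge L → ℝ) : ℝ :=
  ((Finset.univ.filter fun b : Edge L => κ b = κO).card : ℝ) / (2 * (L : ℝ) ^ 2)

theorem exists_longer_run {L : ℕ} [NeZero L] {n : ℕ} (hL : L = 2 * n) {α : Type*}
    (𝓜 : Set (ZMod L → α))
    (hrefl : ∀ X ∈ 𝓜, ∀ a : ZMod L,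
      (fun i => if (i - a).val < n then X (2 * a - 1 - i) else X i) ∈ 𝓜)
    {l : ℕ} (hl : l ≤ n) (h : ∃ X ∈ 𝓜, ∃ i : ZMod L, ∃ c, ∀ j : ℕ, j < l → X (i + j) = c) :
    ∃ X ∈ 𝓜, ∃ i : ZMod L, ∃ c, ∀ j : ℕ, j < 2 * l → X (i + j) = c := by
  obtain ⟨X, hX, i, c, hc⟩ := h
  refine ⟨_, hrefl X hX (i + l), i, c, fun j hj => ?_⟩
  have hn : 0 < n := by have := NeZero.ne L; omega
  by_cases hjl : j < l
  · have h1 : i + (j : ZMod L) - (i + l) = ((L - (l - j) : ℕ) : ZMod L) := by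
      rw [Nat.cast_sub (by omega), Nat.cast_sub (by omega)]; simp
    have h2 : (i + (j : ZMod L) - (i + l)).val = L - (l - j) := by
      rw [h1, ZMod.val_natCast, Nat.mod_eq_of_lt (by omega)]
    simp only [h2]
    rw [if_neg (by omega)]
    exact hc j hjl
  · have h1 : i + (j : ZMod L) - (i + l) = ((j - l : ℕ) : ZMod L) := by
      rw [Nat.cast_sub (by omega)]; ring
    have h2 : (i + (j : ZMod L) - (i + l)).val = j - l := by
      rw [h1, ZMod.val_natCast, Nat.mod_eq_of_lt (by omega)]
    simp only [h2]
    rw [if_pos (by omega)]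
    have h3 : 2 * (i + (l : ZMod L)) - 1 - (i + j) = i + ((2 * l - 1 - j : ℕ) : ZMod L) := by
      rw [Nat.cast_sub (by omega), Nat.cast_sub (by omega)]; push_cast; ring
    rw [h3]
    exact hc _ (by omega)

theorem exists_const_of_reflect {L : ℕ} [NeZero L] {n : ℕ} (hL : L = 2 * n) {α : Type*}
    (𝓜 : Set (ZMod L → α)) (hne : 𝓜.Nonempty)
    (hrefl : ∀ X ∈ 𝓜, ∀ a : ZMod L,
      (fun i => if (i - a).val < n then X (2 * a - 1 - i) else X i) ∈ 𝓜) :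
    ∃ c, (fun _ => c) ∈ 𝓜 := by
  have key : ∀ k : ℕ, ∃ X ∈ 𝓜, ∃ i : ZMod L, ∃ c, ∀ j : ℕ, j < min (2 ^ k) n → X (i + j) = c := by
    intro k
    induction k with
    | zero =>
      obtain ⟨X, hX⟩ := hne
      refine ⟨X, hX, 0, X 0, fun j hj => ?_⟩
      have : j = 0 := by simp at hj; omega
      simp [this]
    | succ k ih =>
      obtain ⟨X, hX, i, c, hc⟩ := exists_longer_run hL 𝓜 hrefl (min_le_right _ _) ih
      refine ⟨X, hX, i, c, fun j hj => hc j ?_⟩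
      rw [pow_succ] at hj
      omega
  have hk := key n
  rw [min_eq_right (Nat.lt_two_pow_self).le] at hk
  obtain ⟨X, hX, i, c, hc⟩ := exists_longer_run hL 𝓜 hrefl le_rfl hk
  refine ⟨c, ?_⟩
  convert hX using 1
  funext m
  have := hc (m - i).val (by rw [← hL]; exact ZMod.val_lt _)
  rw [ZMod.natCast_zmod_val] at this
  rw [← this]; congr 1; ring

/-- The left or right half of the faces in direction `d`, seen from the lattice line at `a`. -/
def faceCoord {L : ℕ} (d : Bool) (x : Torus L) : ZMod L := if d then x.1 else x.2

/-- Reflection of faces in the lattice line at `a`. -/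
def faceRefl {L : ℕ} (d : Bool) (a : ZMod L) (x : Torus L) : Torus L :=
  if d then (2 * a - 1 - x.1, x.2) else (x.1, 2 * a - 1 - x.2)

/-- The face set that agrees with `S` on the half seen from `a` with parity `s`, and is symmetric. -/
def symmetrize {L : ℕ} (n : ℕ) (d s : Bool) (a : ZMod L) (S : Set (Torus L)) : Set (Torus L) :=
  {x | if ((faceCoord d x - a).val < n ↔ s = true) then x ∈ S else faceRefl d a x ∈ S}

theorem val_two_mul_sub {L : ℕ} [NeZero L] {n : ℕ} (hL : L = 2 * n) (a i : ZMod L) :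
    (2 * a - 1 - i - a).val < n ↔ ¬ (i - a).val < n := by
  have h1 : 2 * a - 1 - i - a = ((L - 1 - (i - a).val : ℕ) : ZMod L) := by
    have := ZMod.val_lt (i - a)
    rw [Nat.cast_sub (by omega), Nat.cast_sub (by omega), ZMod.natCast_zmod_val]
    simp; ring
  have := ZMod.val_lt (i - a)
  rw [h1, ZMod.val_natCast, Nat.mod_eq_of_lt (by omega)]
  omega

theorem faceRefl_invol {L : ℕ} (d : Bool) (a : ZMod L) (x : Torus L) :
    faceRefl d a (faceRefl d a x) = x := by
  cases d <;> simp [faceRefl]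

theorem faceCoord_faceRefl {L : ℕ} [NeZero L] {n : ℕ} (hL : L = 2 * n)
    (d : Bool) (a : ZMod L) (x : Torus L) :
    (faceCoord d (faceRefl d a x) - a).val < n ↔ ¬ (faceCoord d x - a).val < n := by
  cases d <;> simpa [faceCoord, faceRefl] using val_two_mul_sub hL a _

theorem symmetrize_ncard {L : ℕ} [NeZero L] {n : ℕ} (hL : L = 2 * n) (d : Bool) (a : ZMod L)
    (S : Set (Torus L)) :
    (symmetrize n d true a S).ncard + (symmetrize n d false a S).ncard = 2 * S.ncard := by
  classical
  set r : Torus L → Torus L := faceRefl d a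
  have hr : Function.Involutive r := faceRefl_invol d a
  let A : Set (Torus L) := {x | (faceCoord d x - a).val < n}
  have hAd : ∀ x, x ∈ A ↔ (faceCoord d x - a).val < n := fun x => Iff.rfl
  have hA : ∀ x, r x ∈ A ↔ x ∉ A := fun x => faceCoord_faceRefl hL d a x
  have e1 : symmetrize n d true a S = (S ∩ A) ∪ (r '' (S ∩ A)) := by
    ext x
    simp only [symmetrize, Set.mem_ofPred_eq, Set.mem_union, Set.mem_inter_iff, Set.mem_image]
    have hx := hA x
    constructor
    · intro h
      by_cases hxA : x ∈ A
      · left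
        rw [if_pos (by simpa [hAd] using hxA)] at h
        exact ⟨h, hxA⟩
      · right
        rw [if_neg (by simpa [hAd] using hxA)] at h
        exact ⟨r x, ⟨h, hx.2 hxA⟩, hr x⟩
    · rintro (⟨h1, h2⟩ | ⟨y, ⟨h1, h2⟩, rfl⟩)
      · rw [if_pos (by simpa [hAd] using h2)]; exact h1
      · have : r y ∉ A := fun h => (hA y).1 h h2
        rw [if_neg (by simpa [hAd] using this)]
        show r (r y) ∈ S
        rwa [hr y]
  have e2 : symmetrize n d false a S = (S \ A) ∪ (r '' (S \ A)) := by
    ext x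
    simp only [symmetrize, Set.mem_ofPred_eq, Set.mem_union, Set.mem_sdiff, Set.mem_image]
    have hx := hA x
    constructor
    · intro h
      by_cases hxA : x ∈ A
      · right
        rw [if_neg (by simpa [hAd] using hxA)] at h
        exact ⟨r x, ⟨h, fun h' => hx.1 h' hxA⟩, hr x⟩
      · left
        rw [if_pos (by simpa [hAd] using hxA)] at h
        exact ⟨h, hxA⟩
    · rintro (⟨h1, h2⟩ | ⟨y, ⟨h1, h2⟩, rfl⟩)
      · rw [if_pos (by simpa [hAd] using h2)]; exact h1
      · have : r y ∈ A := (hA y).2 h2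
        rw [if_neg (by simpa [hAd] using this)]
        show r (r y) ∈ S
        rwa [hr y]
  rw [e1, e2, Set.ncard_union_eq, Set.ncard_union_eq, Set.ncard_image_of_injective _ hr.injective,
    Set.ncard_image_of_injective _ hr.injective]
  · have := Set.ncard_inter_add_ncard_sdiff_eq_ncard S A
    omega
  · rw [Set.disjoint_left]
    rintro x ⟨_, h⟩ ⟨y, ⟨_, h'⟩, rfl⟩
    exact h ((hA y).2 h')
  · rw [Set.disjoint_left]
    rintro x ⟨_, h⟩ ⟨y, ⟨_, hy⟩, rfl⟩
    exact (hA y).1 h hy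

/-- Chessboard estimate. -/
theorem chessboard {L : ℕ} [NeZero L] {n : ℕ} (hL : L = 2 * n) (F : Set (Torus L) → ℝ)
    (hF0 : ∀ S, 0 ≤ F S) (hFe : F ∅ ≤ 1)
    (hRP : ∀ d a S, F S ^ 2 ≤ F (symmetrize n d true a S) * F (symmetrize n d false a S))
    {δ : ℝ} (hδ : 0 < δ) (hu : F Set.univ ≤ δ ^ (L ^ 2)) (S : Set (Torus L)) :
    F S ≤ δ ^ S.ncard := by
  let G : Set (Torus L) → ℝ := fun S => F S / δ ^ S.ncard
  have hG0 : ∀ S, 0 ≤ G S := fun S => div_nonneg (hF0 S) (by positivity)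
  obtain ⟨T, hT⟩ := Finite.exists_max G
  suffices hle : G T ≤ 1 by
    have := (hT S).trans hle
    rwa [div_le_one (by positivity)] at this
  by_contra! hgt
  have hGRP : ∀ d a S, G S ^ 2 ≤ G (symmetrize n d true a S) * G (symmetrize n d false a S) := by
    intro d a S
    simp only [G]
    rw [div_mul_div_comm, ← pow_add, symmetrize_ncard hL, div_pow, ← pow_mul, mul_comm 2 S.ncard]
    gcongr
    exact hRP d a S
  have hmax : ∀ d a S, G S = G T → G (symmetrize n d false a S) = G T := by
    intro d a S hS
    refine le_antisymm (hT _) ?_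
    have h1 := hGRP d a S
    have h2 := hT (symmetrize n d true a S)
    rw [hS] at h1
    have h3 : 0 ≤ G (symmetrize n d false a S) := hG0 _
    nlinarith
  obtain ⟨C, hC⟩ := exists_const_of_reflect hL (α := ZMod L → Prop)
    {X | G {x : Torus L | X x.1 x.2} = G T} ⟨fun i j => T (i, j), rfl⟩ (by
      intro X hX a
      rw [Set.mem_ofPred_eq] at hX ⊢
      rw [← hmax true a _ hX]
      congr 1
      ext x
      simp only [symmetrize, faceCoord, faceRefl, Set.mem_ofPred_eq]
      by_cases h : (x.1 - a).val < n <;> simp [h])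
  obtain ⟨c, hc⟩ := exists_const_of_reflect hL (α := Prop)
    {X | G {x : Torus L | X x.2} = G T} ⟨C, hC⟩ (by
      intro X hX a
      rw [Set.mem_ofPred_eq] at hX ⊢
      rw [← hmax false a _ hX]
      congr 1
      ext x
      simp only [symmetrize, faceCoord, faceRefl, Set.mem_ofPred_eq]
      by_cases h : (x.2 - a).val < n <;> simp [h])
  rw [Set.mem_ofPred_eq] at hc
  rw [← hc] at hgt
  by_cases hcc : c
  · have : {x : Torus L | c} = Set.univ := by ext; simp [hcc]
    rw [this] at hgt
    have h2 : (Set.univ : Set (Torus L)).ncard = L ^ 2 := by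
      rw [Set.ncard_univ, Nat.card_prod, Nat.card_zmod, sq]
    simp only [G, h2] at hgt
    rw [lt_div_iff₀ (by positivity)] at hgt
    linarith
  · have : {x : Torus L | c} = ∅ := by ext; simp [hcc]
    rw [this] at hgt
    simp only [G, Set.ncard_empty, pow_zero, div_one] at hgt
    linarith

/-- Neighbouring labelled cells of the `n × n` grid carry the same label. -/
def Consistent (n : ℕ) (lab : ℕ → ℕ → Option Bool) : Prop :=
  (∀ i j s t, i + 1 < n → j < n → lab i j = some s → lab (i + 1) j = some t → s = t) ∧
  (∀ i j s t, i < n → j + 1 < n → lab i j = some s → lab i (j + 1) = some t → s = t)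

/-- First index of the `I`-th block. -/
def blockLo (I : ℕ) : ℕ := 3 * I

/-- End of the `I`-th block of `[0, n)`; the last block absorbs the remainder. -/
def blockHi (n I : ℕ) : ℕ := if I + 1 < n / 3 then 3 * I + 3 else n

/-- All unlabelled cells of the block `(I, J)` are equal to `(p, q)`. -/
def UniqueBad (n : ℕ) (lab : ℕ → ℕ → Option Bool) (I J p q : ℕ) : Prop :=
  ∀ i j, blockLo I ≤ i → i < blockHi n I → blockLo J ≤ j → j < blockHi n J →
    lab i j = none → i = p ∧ j = q

open scoped Classical in
/-- The label of a block. -/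
def coarse (n : ℕ) (lab : ℕ → ℕ → Option Bool) (I J : ℕ) : Option Bool :=
  if ∃ p q, UniqueBad n lab I J p q then
    if ∃ i j, (blockLo I ≤ i ∧ i < blockHi n I ∧ blockLo J ≤ j ∧ j < blockHi n J) ∧
      lab i j = some true then some true else some false
  else none

theorem block_size {n I : ℕ} (hI : I < n / 3) :
    blockLo I + 3 ≤ blockHi n I ∧ blockHi n I ≤ blockLo I + 5 ∧ blockHi n I ≤ n := by
  unfold blockLo blockHi; split_ifs <;> omega

theorem row_const {n : ℕ} {lab : ℕ → ℕ → Option Bool} (h : Consistent n lab) {a b j : ℕ}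
    (hb : b ≤ n) (hj : j < n) (hfull : ∀ i, a ≤ i → i < b → lab i j ≠ none) :
    ∀ i, a ≤ i → i < b → lab i j = lab a j := by
  intro i hai
  induction i, hai using Nat.le_induction with
  | base => intro _; rfl
  | succ i hai ih =>
    intro hib
    rw [← ih (by omega)]
    obtain ⟨s, hs⟩ := Option.ne_none_iff_exists'.1 (hfull i hai (by omega))
    obtain ⟨t, ht⟩ := Option.ne_none_iff_exists'.1 (hfull (i + 1) (by omega) hib)
    rw [hs, ht, h.1 i j s t (by omega) hj hs ht]

theorem col_const {n : ℕ} {lab : ℕ → ℕ → Option Bool} (h : Consistent n lab) {a b i : ℕ}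
    (hb : b ≤ n) (hi : i < n) (hfull : ∀ j, a ≤ j → j < b → lab i j ≠ none) :
    ∀ j, a ≤ j → j < b → lab i j = lab i a := by
  intro j haj
  induction j, haj using Nat.le_induction with
  | base => intro _; rfl
  | succ j haj ih =>
    intro hjb
    rw [← ih (by omega)]
    obtain ⟨s, hs⟩ := Option.ne_none_iff_exists'.1 (hfull j haj (by omega))
    obtain ⟨t, ht⟩ := Option.ne_none_iff_exists'.1 (hfull (j + 1) (by omega) hjb)
    rw [hs, ht, h.2 i j s t hi (by omega) hs ht]

theorem block_labels_eq {n : ℕ} {lab : ℕ → ℕ → Option Bool} (h : Consistent n lab) {I J p q : ℕ}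
    (hI : I < n / 3) (hJ : J < n / 3) (hpq : UniqueBad n lab I J p q) :
    ∃ s : Bool, ∀ i j, blockLo I ≤ i → i < blockHi n I → blockLo J ≤ j → j < blockHi n J →
      lab i j ≠ none → lab i j = some s := by
  obtain ⟨hI1, -, hI3⟩ := block_size hI
  obtain ⟨hJ1, -, hJ3⟩ := block_size hJ
  obtain ⟨p, q, hpq, hpq'⟩ : ∃ p q, UniqueBad n lab I J p q ∧ (p < n → lab p q = none) := by
    by_cases hb : lab p q = none
    · exact ⟨p, q, hpq, fun _ => hb⟩
    · refine ⟨n, n, fun i j h1 h2 h3 h4 h5 => ?_, fun h => absurd h (lt_irrefl _)⟩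
      obtain ⟨rfl, rfl⟩ := hpq i j h1 h2 h3 h4 h5
      exact absurd h5 hb
  obtain ⟨i0, hi0, hi0', hi0p⟩ : ∃ i0, blockLo I ≤ i0 ∧ i0 < blockHi n I ∧ i0 ≠ p := by
    by_cases hp : p = blockLo I
    · exact ⟨blockLo I + 1, by omega, by omega, by omega⟩
    · exact ⟨blockLo I, by omega, by omega, by omega⟩
  obtain ⟨j0, hj0, hj0', hj0q⟩ : ∃ j0, blockLo J ≤ j0 ∧ j0 < blockHi n J ∧ j0 ≠ q := by
    by_cases hp : q = blockLo J
    · exact ⟨blockLo J + 1, by omega, by omega, by omega⟩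
    · exact ⟨blockLo J, by omega, by omega, by omega⟩
  have hcol : ∀ i, blockLo I ≤ i → i < blockHi n I → i ≠ p → ∀ j, blockLo J ≤ j →
      j < blockHi n J → lab i j = lab i (blockLo J) := fun i h1 h2 h3 =>
    col_const h hJ3 (by omega) fun j h4 h5 h6 => h3 (hpq i j h1 h2 h4 h5 h6).1
  have hrow : ∀ j, blockLo J ≤ j → j < blockHi n J → j ≠ q → ∀ i, blockLo I ≤ i →
      i < blockHi n I → lab i j = lab (blockLo I) j := fun j h1 h2 h3 =>
    row_const h hI3 (by omega) fun i h4 h5 h6 => h3 (hpq i j h4 h5 h1 h2 h6).2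
  obtain ⟨s, hs⟩ := Option.ne_none_iff_exists'.1
    (fun hn => hi0p (hpq i0 j0 hi0 hi0' hj0 hj0' hn).1 : lab i0 j0 ≠ none)
  refine ⟨s, fun i j h1 h2 h3 h4 h5 => ?_⟩
  rw [← hs]
  by_cases hip : i = p
  · by_cases hjq : j = q
    · subst hip hjq
      exact absurd (hpq' (by omega)) h5
    · rw [hrow j h3 h4 hjq i h1 h2, ← hrow j h3 h4 hjq i0 hi0 hi0', hcol i0 hi0 hi0' hi0p j h3 h4,
        ← hcol i0 hi0 hi0' hi0p j0 hj0 hj0']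
  · rw [hcol i h1 h2 hip j h3 h4, ← hcol i h1 h2 hip j0 hj0 hj0', hrow j0 hj0 hj0' hj0q i h1 h2,
        ← hrow j0 hj0 hj0' hj0q i0 hi0 hi0']

theorem coarse_eq_some {n : ℕ} {lab : ℕ → ℕ → Option Bool} (h : Consistent n lab) {I J : ℕ}
    (hI : I < n / 3) (hJ : J < n / 3) {t : Bool} (ht : coarse n lab I J = some t) :
    (∃ p q, UniqueBad n lab I J p q) ∧
    ∀ i j, blockLo I ≤ i → i < blockHi n I → blockLo J ≤ j → j < blockHi n J →
      lab i j ≠ none → lab i j = some t := by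
  unfold coarse at ht
  split_ifs at ht with h1 h2
  · refine ⟨h1, ?_⟩
    obtain ⟨p, q, hpq⟩ := h1
    obtain ⟨s, hs⟩ := block_labels_eq h hI hJ hpq
    obtain ⟨i, j, ⟨a1, a2, a3, a4⟩, hij⟩ := h2
    have := hs i j a1 a2 a3 a4 (by simp [hij])
    rw [hij] at this
    rw [← ht, this]; exact hs
  · refine ⟨h1, ?_⟩
    obtain ⟨p, q, hpq⟩ := h1
    intro i j a1 a2 a3 a4 hij
    obtain ⟨s, hs⟩ := Option.ne_none_iff_exists'.1 hij
    cases s with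
    | true => exact absurd ⟨i, j, ⟨a1, a2, a3, a4⟩, hs⟩ h2
    | false => rw [hs, ht]

theorem exists_ne_ne (a p q : ℕ) : ∃ i, a ≤ i ∧ i < a + 3 ∧ i ≠ p ∧ i ≠ q := by
  by_contra! h
  have h0 := h a le_rfl (by omega)
  have h1 := h (a + 1) (by omega) (by omega)
  have h2 := h (a + 2) (by omega) (by omega)
  omega

theorem coarse_consistent {n : ℕ} {lab : ℕ → ℕ → Option Bool} (h : Consistent n lab) :
    Consistent (n / 3) (coarse n lab) := by
  have hadj : ∀ I, I + 1 < n / 3 → blockHi n I = blockLo (I + 1) := by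
    intro I hI; unfold blockHi blockLo; rw [if_pos hI]; ring
  constructor
  · intro I J s t hI hJ hs ht
    obtain ⟨⟨p, q, hpq⟩, h1⟩ := coarse_eq_some h (by omega) hJ hs
    obtain ⟨⟨p', q', hpq'⟩, h2⟩ := coarse_eq_some h hI hJ ht
    obtain ⟨j, hj1, hj2, hj3, hj4⟩ := exists_ne_ne (blockLo J) q q'
    obtain ⟨b1, b2, b3⟩ := block_size (n := n) (I := I) (by omega)
    obtain ⟨c1, c2, c3⟩ := block_size hI
    obtain ⟨d1, d2, d3⟩ := block_size hJ
    have hI' := hadj I hI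
    have e1 : lab (blockHi n I - 1) j = some s :=
      h1 _ j (by omega) (by omega) (by omega) (by omega)
        fun hn => hj3 (hpq _ j (by omega) (by omega) (by omega) (by omega) hn).2
    have e2 : lab (blockHi n I - 1 + 1) j = some t :=
      h2 _ j (by omega) (by omega) (by omega) (by omega)
        fun hn => hj4 (hpq' _ j (by omega) (by omega) (by omega) (by omega) hn).2
    exact h.1 _ _ _ _ (by omega) (by omega) e1 e2
  · intro I J s t hI hJ hs ht
    obtain ⟨⟨p, q, hpq⟩, h1⟩ := coarse_eq_some h hI (by omega) hs
    obtain ⟨⟨p', q', hpq'⟩, h2⟩ := coarse_eq_some h hI hJ ht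
    obtain ⟨i, hj1, hj2, hj3, hj4⟩ := exists_ne_ne (blockLo I) p p'
    obtain ⟨b1, b2, b3⟩ := block_size (n := n) (I := J) (by omega)
    obtain ⟨c1, c2, c3⟩ := block_size hI
    obtain ⟨d1, d2, d3⟩ := block_size hJ
    have hJ' := hadj J hJ
    have e1 : lab i (blockHi n J - 1) = some s :=
      h1 i _ (by omega) (by omega) (by omega) (by omega)
        fun hn => hj3 (hpq i _ (by omega) (by omega) (by omega) (by omega) hn).1
    have e2 : lab i (blockHi n J - 1 + 1) = some t :=
      h2 i _ (by omega) (by omega) (by omega) (by omega)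
        fun hn => hj4 (hpq' i _ (by omega) (by omega) (by omega) (by omega) hn).1
    exact h.2 _ _ _ _ (by omega) (by omega) e1 e2

/-- The cells of the block `(I, J)`. -/
def blockCells (n : ℕ) (B : ℕ × ℕ) : Finset (ℕ × ℕ) :=
  Finset.Ico (blockLo B.1) (blockHi n B.1) ×ˢ Finset.Ico (blockLo B.2) (blockHi n B.2)

theorem coarse_eq_none {n : ℕ} {lab : ℕ → ℕ → Option Bool} {I J : ℕ}
    (ht : coarse n lab I J = none) :
    ∃ T ∈ (blockCells n (I, J)).powersetCard 2, ∀ x ∈ T, lab x.1 x.2 = none := by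
  unfold coarse at ht
  split_ifs at ht with h1
  have key : ∀ p q, ∃ i j, (i, j) ∈ blockCells n (I, J) ∧ lab i j = none ∧ (i, j) ≠ (p, q) := by
    intro p q
    have : ¬ UniqueBad n lab I J p q := fun h => h1 ⟨p, q, h⟩
    unfold UniqueBad at this
    push Not at this
    obtain ⟨i, j, a1, a2, a3, a4, h5, h6⟩ := this
    refine ⟨i, j, ?_, h5, ?_⟩
    · simp only [blockCells, Finset.mem_product, Finset.mem_Ico]; exact ⟨⟨a1, a2⟩, a3, a4⟩
    · rintro h; simp only [Prod.mk.injEq] at h; exact h6 h.1 h.2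
  obtain ⟨p, q, hp, hp', -⟩ := key 0 0
  obtain ⟨i, j, hi, hi', hne⟩ := key p q
  refine ⟨{(i, j), (p, q)}, ?_, ?_⟩
  · rw [Finset.mem_powersetCard]
    refine ⟨?_, Finset.card_pair hne⟩
    intro x hx
    simp only [Finset.mem_insert, Finset.mem_singleton] at hx
    rcases hx with rfl | rfl <;> assumption
  · intro x hx
    simp only [Finset.mem_insert, Finset.mem_singleton] at hx
    rcases hx with rfl | rfl <;> assumption

theorem card_pairs_le {n : ℕ} {B : ℕ × ℕ} (h1 : B.1 < n / 3) (h2 : B.2 < n / 3) :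
    ((blockCells n B).powersetCard 2).card ≤ 300 := by
  rw [Finset.card_powersetCard]
  have : (blockCells n B).card ≤ 25 := by
    rw [blockCells, Finset.card_product, Nat.card_Ico, Nat.card_Ico]
    have := block_size h1
    have := block_size h2
    calc _ ≤ 5 * 5 := Nat.mul_le_mul (by omega) (by omega)
      _ = 25 := rfl
  exact (Nat.choose_le_choose 2 this).trans (by decide)

theorem blockCells_disjoint {n : ℕ} {B B' : ℕ × ℕ} (h1 : B.1 < n / 3) (h2 : B.2 < n / 3)
    (h1' : B'.1 < n / 3) (h2' : B'.2 < n / 3) {x : ℕ × ℕ} (hx : x ∈ blockCells n B)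
    (hx' : x ∈ blockCells n B') : B = B' := by
  simp only [blockCells, Finset.mem_product, Finset.mem_Ico, blockLo, blockHi] at hx hx'
  ext
  · obtain ⟨⟨a, b⟩, -⟩ := hx
    obtain ⟨⟨a', b'⟩, -⟩ := hx'
    split_ifs at b b' <;> omega
  · obtain ⟨-, a, b⟩ := hx
    obtain ⟨-, a', hb⟩ := hx'
    split_ifs at b hb <;> omega

/-- The index of the block containing `i`. -/
def blockOf (n i : ℕ) : ℕ := min (i / 3) (n / 3 - 1)

theorem blockOf_spec {n i : ℕ} (hn : 3 ≤ n) (hi : i < n) :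
    blockOf n i < n / 3 ∧ blockLo (blockOf n i) ≤ i ∧ i < blockHi n (blockOf n i) := by
  unfold blockOf blockLo blockHi
  refine ⟨by omega, by omega, ?_⟩
  split_ifs <;> omega

theorem measure_coarse_bad_le {Ω : Type*} [MeasurableSpace Ω] (μ : Measure Ω) {n : ℕ}
    (lab : Ω → ℕ → ℕ → Option Bool) {δ : ℝ≥0∞}
    (hμ : ∀ T : Finset (ℕ × ℕ), (∀ x ∈ T, x.1 < n ∧ x.2 < n) →
      μ {ω | ∀ x ∈ T, lab ω x.1 x.2 = none} ≤ δ ^ T.card)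
    (S : Finset (ℕ × ℕ)) :
    (∀ B ∈ S, B.1 < n / 3 ∧ B.2 < n / 3) → ∀ T : Finset (ℕ × ℕ), (∀ x ∈ T, x.1 < n ∧ x.2 < n) →
      (∀ x ∈ T, ∀ B ∈ S, x ∉ blockCells n B) →
      μ {ω | (∀ x ∈ T, lab ω x.1 x.2 = none) ∧ ∀ B ∈ S, coarse n (lab ω) B.1 B.2 = none}
        ≤ δ ^ T.card * (300 * δ ^ 2) ^ S.card := by
  classical
  induction S using Finset.induction_on with
  | empty =>
    intro _ T hT _
    simpa using hμ T hT
  | insert B S hBS ih =>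
    intro hS T hT hdis
    have hB := hS B (Finset.mem_insert_self _ _)
    have hS' : ∀ B ∈ S, B.1 < n / 3 ∧ B.2 < n / 3 := fun B hB => hS B (Finset.mem_insert_of_mem hB)
    have hcell : ∀ x ∈ blockCells n B, x.1 < n ∧ x.2 < n := by
      intro x hx
      simp only [blockCells, Finset.mem_product, Finset.mem_Ico] at hx
      have := block_size hB.1
      have := block_size hB.2
      omega
    calc _ ≤ μ (⋃ P ∈ (blockCells n B).powersetCard 2,
          {ω | (∀ x ∈ T ∪ P, lab ω x.1 x.2 = none) ∧ ∀ B ∈ S, coarse n (lab ω) B.1 B.2 = none}) := by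
          refine measure_mono fun ω hω => ?_
          obtain ⟨h1, h2⟩ := hω
          obtain ⟨P, hP, hP'⟩ := coarse_eq_none (h2 B (Finset.mem_insert_self _ _))
          simp only [Set.mem_iUnion]
          refine ⟨P, hP, ?_, fun B hB => h2 B (Finset.mem_insert_of_mem hB)⟩
          intro x hx
          rcases Finset.mem_union.1 hx with hx | hx
          · exact h1 x hx
          · exact hP' x hx
      _ ≤ ∑ P ∈ (blockCells n B).powersetCard 2, δ ^ (T.card + 2) * (300 * δ ^ 2) ^ S.card := by
          refine (measure_biUnion_finset_le _ _).trans (Finset.sum_le_sum fun P hP => ?_)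
          rw [Finset.mem_powersetCard] at hP
          have hd : Disjoint T P := Finset.disjoint_left.2 fun x hx hx' =>
            hdis x hx B (Finset.mem_insert_self _ _) (hP.1 hx')
          have := ih hS' (T ∪ P) (by
            intro x hx
            rcases Finset.mem_union.1 hx with hx | hx
            · exact hT x hx
            · exact hcell x (hP.1 hx)) (by
            intro x hx B' hB' hx'
            rcases Finset.mem_union.1 hx with hx | hx
            · exact hdis x hx B' (Finset.mem_insert_of_mem hB') hx'
            · have := blockCells_disjoint hB.1 hB.2 (hS' B' hB').1 (hS' B' hB').2 (hP.1 hx) hx'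
              exact hBS (this ▸ hB'))
          rwa [Finset.card_union_of_disjoint hd, hP.2] at this
      _ ≤ 300 * (δ ^ (T.card + 2) * (300 * δ ^ 2) ^ S.card) := by
          rw [Finset.sum_const, nsmul_eq_mul]
          gcongr
          exact_mod_cast card_pairs_le hB.1 hB.2
      _ = _ := by
          rw [Finset.card_insert_of_notMem hBS]; ring

theorem exists_regular_set {Ω : Type*} [MeasurableSpace Ω] (μ : Measure Ω) (n : ℕ) (hn : 1 ≤ n) :
    ∀ (lab : Ω → ℕ → ℕ → Option Bool) (δ : ℝ≥0∞), 400 * δ ≤ 1 →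
    (∀ ω, Consistent n (lab ω)) →
    (∀ T : Finset (ℕ × ℕ), (∀ x ∈ T, x.1 < n ∧ x.2 < n) →
      μ {ω | ∀ x ∈ T, lab ω x.1 x.2 = none} ≤ δ ^ T.card) →
    ∃ R : Ω → Set (ℕ × ℕ),
      (∀ ω, ∃ t : Bool, ∀ x ∈ R ω, x.1 < n → x.2 < n → lab ω x.1 x.2 = some t) ∧
      ∀ x : ℕ × ℕ, x.1 < n → x.2 < n → μ {ω | x ∉ R ω} ≤ 4 * δ := by
  induction n using Nat.strong_induction_on with
  | _ n ih =>
  intro lab δ hδ hc hμ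
  by_cases hn3 : 3 ≤ n
  · have hδ2 : 300 * δ ^ 2 ≤ δ := by
      calc 300 * δ ^ 2 ≤ 400 * δ ^ 2 := by gcongr; norm_num
        _ = (400 * δ) * δ := by ring
        _ ≤ 1 * δ := by gcongr
        _ = δ := one_mul _
    obtain ⟨R, hR1, hR2⟩ := ih (n / 3) (by omega) (by omega) (fun ω => coarse n (lab ω))
      (300 * δ ^ 2) ((mul_le_mul_right hδ2 _).trans hδ) (fun ω => coarse_consistent (hc ω)) (by
        intro S hS
        have := measure_coarse_bad_le μ lab hμ S hS ∅ (by simp) (by simp)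
        simpa using this)
    refine ⟨fun ω => {x | lab ω x.1 x.2 ≠ none ∧ (blockOf n x.1, blockOf n x.2) ∈ R ω}, ?_, ?_⟩
    · intro ω
      obtain ⟨t, ht⟩ := hR1 ω
      refine ⟨t, fun x hx h1 h2 => ?_⟩
      obtain ⟨a1, a2, a3⟩ := blockOf_spec hn3 h1
      obtain ⟨b1, b2, b3⟩ := blockOf_spec hn3 h2
      exact (coarse_eq_some (hc ω) a1 b1 (ht _ hx.2 a1 b1)).2 _ _ a2 a3 b2 b3 hx.1
    · intro x h1 h2
      obtain ⟨a1, a2, a3⟩ := blockOf_spec hn3 h1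
      obtain ⟨b1, b2, b3⟩ := blockOf_spec hn3 h2
      calc _ ≤ μ ({ω | lab ω x.1 x.2 = none} ∪
              {ω | (blockOf n x.1, blockOf n x.2) ∉ R ω}) := by
            refine measure_mono fun ω hω => ?_
            by_contra hcon
            simp only [Set.mem_union, Set.mem_ofPred_eq, not_or, not_not] at hcon
            exact hω ⟨hcon.1, hcon.2⟩
        _ ≤ δ + 4 * (300 * δ ^ 2) := by
            refine (measure_union_le _ _).trans (add_le_add ?_ (hR2 _ a1 b1))
            have := hμ {x} (by simpa using ⟨h1, h2⟩)
            simpa using this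
        _ = δ + 3 * ((400 * δ) * δ) := by ring
        _ ≤ δ + 3 * (1 * δ) := by gcongr
        _ = 4 * δ := by ring
  · have hcard : (Finset.range n ×ˢ Finset.range n).card ≤ 4 := by
      rw [Finset.card_product, Finset.card_range]; nlinarith
    refine ⟨fun ω => {x | ∀ y ∈ Finset.range n ×ˢ Finset.range n, lab ω y.1 y.2 ≠ none}, ?_, ?_⟩
    · intro ω
      by_cases hg : ∀ y ∈ Finset.range n ×ˢ Finset.range n, lab ω y.1 y.2 ≠ none
      · have h0 : ∀ i j, i < n → j < n → lab ω i j ≠ none := fun i j hi hj =>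
          hg (i, j) (by simp [hi, hj])
        obtain ⟨t, ht⟩ := Option.ne_none_iff_exists'.1 (h0 0 0 (by omega) (by omega))
        refine ⟨t, fun x _ h1 h2 => ?_⟩
        rw [row_const (hc ω) (a := 0) le_rfl h2 (fun i _ hi => h0 i _ hi h2) x.1 (by omega) h1,
          col_const (hc ω) (a := 0) le_rfl (by omega) (fun j _ hj => h0 0 j (by omega) hj) x.2
            (by omega) h2, ht]
      · exact ⟨true, fun x hx => absurd hx hg⟩
    · intro x _ _
      calc _ ≤ μ (⋃ y ∈ Finset.range n ×ˢ Finset.range n, {ω | lab ω y.1 y.2 = none}) := by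
            refine measure_mono fun ω hω => ?_
            simp only [Set.mem_ofPred_eq, not_forall, not_not] at hω
            obtain ⟨y, hy, hy'⟩ := hω
            simp only [Set.mem_iUnion]
            exact ⟨y, hy, hy'⟩
        _ ≤ ∑ y ∈ Finset.range n ×ˢ Finset.range n, δ := by
            refine (measure_biUnion_finset_le _ _).trans (Finset.sum_le_sum fun y hy => ?_)
            have := hμ {y} (by simpa using hy)
            simpa using this
        _ ≤ 4 * δ := by
            rw [Finset.sum_const, nsmul_eq_mul]
            gcongr
            exact_mod_cast hcard

theorem lintegral_mul_sq_le {α : Type*} [MeasurableSpace α] (μ : Measure α) {h f g : α → ℝ≥0∞}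
    (hh : Measurable h) (hf : Measurable f) (hg : Measurable g) :
    (∫⁻ a, h a * (f a * g a) ∂μ) ^ 2 ≤
      (∫⁻ a, h a * (f a * f a) ∂μ) * (∫⁻ a, h a * (g a * g a) ∂μ) := by
  have hsplit : ∀ x : ℝ≥0∞, x ^ (1 / 2 : ℝ) * x ^ (1 / 2 : ℝ) = x := by
    intro x
    rw [← ENNReal.rpow_add_of_nonneg _ _ (by norm_num) (by norm_num)]
    norm_num
  have hsq : ∀ x : ℝ≥0∞, (x ^ (1 / 2 : ℝ)) ^ 2 = x := by
    intro x; rw [pow_two, hsplit]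
  have key := ENNReal.lintegral_mul_le_Lp_mul_Lq μ (p := 2) (q := 2)
    Real.HolderConjugate.two_two
    (f := fun a => h a ^ (1 / 2 : ℝ) * f a) (g := fun a => h a ^ (1 / 2 : ℝ) * g a)
    ((hh.pow_const _).mul hf).aemeasurable ((hh.pow_const _).mul hg).aemeasurable
  have e1 : ∀ a, ((fun a => h a ^ (1 / 2 : ℝ) * f a) * (fun a => h a ^ (1 / 2 : ℝ) * g a)) a
      = h a * (f a * g a) := by
    intro a
    calc _ = (h a ^ (1 / 2 : ℝ) * h a ^ (1 / 2 : ℝ)) * (f a * g a) := by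
          simp only [Pi.mul_apply]; ring
      _ = _ := by rw [hsplit]
  have e2 : ∀ f : α → ℝ≥0∞, ∀ a, (h a ^ (1 / 2 : ℝ) * f a) ^ (2 : ℝ) = h a * (f a * f a) := by
    intro f a
    rw [ENNReal.rpow_two, mul_pow, hsq, pow_two]
  simp only [e1, e2] at key
  calc _ ≤ _ := pow_le_pow_left' key 2
    _ = _ := by rw [mul_pow, hsq, hsq]

theorem lmarginal_mul_of_dependsOn {ι : Type*} [DecidableEq ι] {X : ι → Type*}
    [∀ i, MeasurableSpace (X i)] (μ : ∀ i, Measure (X i)) (s : Finset ι)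
    {g f : (∀ i, X i) → ℝ≥0∞} (hf : Measurable f) (hg : DependsOn g (↑s)ᶜ) :
    (∫⋯∫⁻_s, (fun x => g x * f x) ∂μ) = fun x => g x * (∫⋯∫⁻_s, f ∂μ) x := by
  funext x
  unfold lmarginal
  have hm : Measurable fun y : (∀ i : s, X i) => f (Function.updateFinset x s y) :=
    hf.comp measurable_updateFinset
  rw [← lintegral_const_mul _ hm]
  refine lintegral_congr fun y => ?_
  refine congrArg (· * f (Function.updateFinset x s y)) ?_
  refine hg fun i hi => ?_
  have hi' : i ∉ s := by simpa using hi
  simp [Function.updateFinset, hi']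

/-- Reflection positivity of a product measure on `ℝ^ι`, for an involution `θ` of `ι`
exchanging `A` with its image and fixing all remaining coordinates. -/
theorem reflection_cauchy_schwarz {ι : Type*} [Fintype ι] [DecidableEq ι]
    (μ : ι → Measure ℝ) [∀ i, SigmaFinite (μ i)] (θ : ι → ι) (hθ : Function.Involutive θ)
    (hμ : ∀ i, μ (θ i) = μ i) (A : Finset ι) (hA : ∀ i ∈ A, θ i ∉ A)
    (hfix : ∀ i, i ∉ A → i ∉ A.image θ → θ i = i)
    {h F G : (ι → ℝ) → ℝ≥0∞} (hh : Measurable h) (hF : Measurable F) (hG : Measurable G)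
    (dh : DependsOn h (↑(A ∪ A.image θ))ᶜ) (dF : DependsOn F (↑(A.image θ))ᶜ)
    (dG : DependsOn G (↑(A.image θ))ᶜ) :
    (∫⁻ x, h x * (F x * G (x ∘ θ)) ∂Measure.pi μ) ^ 2 ≤
      (∫⁻ x, h x * (F x * F (x ∘ θ)) ∂Measure.pi μ) *
        (∫⁻ x, h x * (G x * G (x ∘ θ)) ∂Measure.pi μ) := by
  set B := A.image θ with hB
  have hAB : Disjoint A B := by
    rw [Finset.disjoint_left]
    intro i hi hi'
    obtain ⟨j, hj, rfl⟩ := Finset.mem_image.1 hi'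
    exact hA j hj hi
  set P := Finset.univ \ (A ∪ B) with hP
  have hPu : P ∪ (A ∪ B) = Finset.univ := Finset.sdiff_union_of_subset (Finset.subset_univ _)
  have hPd : Disjoint P (A ∪ B) := Finset.sdiff_disjoint
  have hcomp : Measurable (fun x : ι → ℝ => x ∘ θ) :=
    measurable_pi_iff.mpr fun i => measurable_pi_apply (θ i)
  have hBθ : ∀ G : (ι → ℝ) → ℝ≥0∞, Measurable G → DependsOn G (↑B)ᶜ →
      (∫⋯∫⁻_B, (fun x => G (x ∘ θ)) ∂μ) = ∫⋯∫⁻_A, G ∂μ := by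
    intro G hG dG
    funext x
    have h1 := lmarginal_image (μ := μ) hθ.injective A hG x
    have h2 : (fun i => μ (θ i)) = μ := funext hμ
    calc (∫⋯∫⁻_B, (fun x => G (x ∘ θ)) ∂μ) x = (∫⋯∫⁻_A, G ∂(fun i => μ (θ i))) (x ∘ θ) := h1
      _ = (∫⋯∫⁻_A, G ∂μ) (x ∘ θ) := by rw [h2]
      _ = (∫⋯∫⁻_A, G ∂μ) x := by
        unfold lmarginal
        refine lintegral_congr fun y => dG fun i hi => ?_
        by_cases hi' : i ∈ A
        · simp [Function.updateFinset, hi']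
        · simp [Function.updateFinset, hi', hfix i hi' (by simpa using hi)]
  have dGθ : ∀ G : (ι → ℝ) → ℝ≥0∞, DependsOn G (↑B)ᶜ →
      DependsOn (fun x : ι → ℝ => G (x ∘ θ)) (↑A)ᶜ := by
    intro G dG x y hxy
    refine dG fun i hi => hxy (θ i) ?_
    intro h3
    apply hi
    have : θ (θ i) ∈ B := Finset.mem_image_of_mem θ h3
    rwa [hθ i] at this
  have main : ∀ F G : (ι → ℝ) → ℝ≥0∞, Measurable F → Measurable G → DependsOn F (↑B)ᶜ →
      DependsOn G (↑B)ᶜ →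
      (∫⁻ x, h x * (F x * G (x ∘ θ)) ∂Measure.pi μ) =
        (∫⋯∫⁻_P, (fun x => h x * ((∫⋯∫⁻_A, F ∂μ) x * (∫⋯∫⁻_A, G ∂μ) x)) ∂μ) 0 := by
    intro F G hF hG dF dG
    have m1 : Measurable fun x => G (x ∘ θ) := hG.comp hcomp
    have m2 : Measurable fun x => F x * G (x ∘ θ) := hF.mul m1
    have m3 : Measurable fun x => h x * (F x * G (x ∘ θ)) := hh.mul m2
    rw [lintegral_eq_lmarginal_univ (0 : ι → ℝ), ← hPu, lmarginal_union μ _ m3 hPd,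
      lmarginal_mul_of_dependsOn μ _ m2 dh, lmarginal_union μ _ m2 hAB,
      lmarginal_mul_of_dependsOn μ B m1 dF, hBθ G hG dG]
    congr 2
    funext x
    congr 1
    have : (fun x => F x * (∫⋯∫⁻_A, G ∂μ) x) = fun x => (∫⋯∫⁻_A, G ∂μ) x * F x := by
      funext x; rw [mul_comm]
    rw [this, lmarginal_mul_of_dependsOn μ A hF, mul_comm]
    intro x y hxy
    exact lmarginal_congr μ G fun i hi => hxy i (by simpa using hi)
  rw [main F G hF hG dF dG, main F F hF hF dF dF, main G G hG hG dG dG]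
  have mF : Measurable (∫⋯∫⁻_A, F ∂μ) := Measurable.lmarginal μ hF
  have mG : Measurable (∫⋯∫⁻_A, G ∂μ) := Measurable.lmarginal μ hG
  generalize (∫⋯∫⁻_A, F ∂μ) = f at mF ⊢
  generalize (∫⋯∫⁻_A, G ∂μ) = g at mG ⊢
  exact lintegral_mul_sq_le _ (hh.comp measurable_updateFinset)
    (mF.comp measurable_updateFinset) (mG.comp measurable_updateFinset)

theorem lintegral_exp_neg_sum_sq {ι : Type*} [Fintype ι] (b : ι → ℝ) (hb : ∀ i, 0 < b i) :
    ∫⁻ x : ι → ℝ, ENNReal.ofReal (Real.exp (-∑ i, b i * x i ^ 2)) =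
      ENNReal.ofReal (∏ i, √(π / b i)) := by
  have h1 : ∀ x : ι → ℝ, Real.exp (-∑ i, b i * x i ^ 2) = ∏ i, Real.exp (-b i * x i ^ 2) := by
    intro x
    rw [← Real.exp_sum, ← Finset.sum_neg_distrib]
    simp
  simp_rw [h1]
  rw [← ofReal_integral_eq_lintegral_ofReal]
  · rw [integral_fintype_prod_volume_eq_prod (fun i t => Real.exp (-b i * t ^ 2))]
    simp_rw [integral_gaussian]
  · exact Integrable.fintype_prod (f := fun i t => Real.exp (-b i * t ^ 2))
      (fun i => integrable_exp_neg_mul_sq (hb i))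
  · exact Eventually.of_forall fun x => Finset.prod_nonneg fun i _ => (Real.exp_pos _).le

theorem lintegral_comp_mulVec {ι : Type*} [Fintype ι] [DecidableEq ι] (M : Matrix ι ι ℝ)
    (hM : M.det ≠ 0) {f : (ι → ℝ) → ℝ≥0∞} (hf : Measurable f) :
    ∫⁻ x, f (M.mulVec x) = ENNReal.ofReal |(M.det)⁻¹| * ∫⁻ x, f x := by
  have h := Real.map_matrix_volume_pi_eq_smul_volume_pi hM
  have hm : Measurable (Matrix.toLin' M) :=
    (LinearMap.continuous_of_finiteDimensional (Matrix.toLin' M)).measurable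
  rw [← smul_eq_mul, ← lintegral_smul_measure, ← h, lintegral_map hf hm]
  simp [Matrix.toLin'_apply]

open scoped MatrixOrder in
theorem lintegral_gaussian_posDef {ι : Type*} [Fintype ι] [DecidableEq ι] (A : Matrix ι ι ℝ)
    (hA : A.PosDef) :
    ∫⁻ x : ι → ℝ, ENNReal.ofReal (Real.exp (-(1 / 2 * (x ⬝ᵥ A.mulVec x)))) =
      ENNReal.ofReal (√((2 * π) ^ Fintype.card ι / A.det)) := by
  obtain ⟨B, hB⟩ := CStarAlgebra.nonneg_iff_eq_star_mul_self.1
    (Matrix.nonneg_iff_posSemidef.2 hA.posSemidef)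
  rw [Matrix.star_eq_conjTranspose, Matrix.conjTranspose_eq_transpose_of_trivial] at hB
  have hdet : A.det = B.det ^ 2 := by rw [hB, Matrix.det_mul, Matrix.det_transpose, pow_two]
  have hd0 : B.det ≠ 0 := by
    intro h
    have := hA.det_pos
    rw [hdet, h] at this
    norm_num at this
  have e1 : ∀ x : ι → ℝ, 1 / 2 * (x ⬝ᵥ A.mulVec x) = ∑ i, 1 / 2 * (B.mulVec x) i ^ 2 := by
    intro x
    rw [hB, ← Matrix.mulVec_mulVec, Matrix.dotProduct_mulVec, Matrix.vecMul_transpose,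
      ← Finset.mul_sum]
    simp only [dotProduct, pow_two]
  simp_rw [e1]
  have hm : Measurable fun x : ι → ℝ => ENNReal.ofReal (Real.exp (-∑ i, 1 / 2 * x i ^ 2)) := by
    fun_prop
  rw [lintegral_comp_mulVec B hd0 hm, lintegral_exp_neg_sum_sq _ (fun _ => by norm_num),
    ← ENNReal.ofReal_mul (abs_nonneg _), hdet, Finset.prod_const, Finset.card_univ]
  congr 1
  have h1 : √((2 * π) ^ Fintype.card ι / B.det ^ 2) = √((2 * π) ^ Fintype.card ι) / |B.det| := by
    rw [Real.sqrt_div (by positivity), Real.sqrt_sq_eq_abs]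
  have h2 : √((2 * π) ^ Fintype.card ι) = √(π / (1 / 2)) ^ Fintype.card ι := by
    rw [Real.sqrt_eq_iff_eq_sq (by positivity) (by positivity), ← pow_mul, mul_comm _ 2, pow_mul,
      Real.sq_sqrt (by positivity)]
    congr 1
    ring
  rw [h1, h2, abs_inv, div_eq_inv_mul _ |B.det|]

/-- Extension by zero at the origin of a field defined off the origin. -/
def extZ {L : ℕ} (ψ : {x : Torus L // x ≠ 0} → ℝ) : Torus L → ℝ := fun x =>
  if h : x = 0 then (0 : ℝ) else ψ ⟨x, h⟩

theorem measurable_extZ {L : ℕ} : Measurable (extZ (L := L)) := by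
  refine measurable_pi_iff.mpr fun x => ?_
  unfold extZ
  split_ifs
  · exact measurable_const
  · exact measurable_pi_apply _

theorem measurable_grad {L : ℕ} : Measurable (grad (L := L)) := by
  refine measurable_pi_iff.mpr fun x => ?_
  exact (measurable_pi_apply _).sub (measurable_pi_apply _)

theorem lintegral_nuL (L : ℕ) [NeZero L] {W : (Edge L → ℝ) → ℝ≥0∞} (hW : Measurable W) :
    ∫⁻ η, W η ∂(nuL L) = ∫⁻ ψ, W (grad (extZ ψ)) := by
  unfold nuL
  rw [lintegral_map hW measurable_grad]
  exact lintegral_map (hW.comp measurable_grad) measurable_extZ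

/-- Pinning a field at one site by an arbitrary weight only multiplies gradient
integrals by the mass of that weight. -/
theorem lintegral_pinned (L : ℕ) [NeZero L] (y : Torus L) {g : ℝ → ℝ≥0∞} (hg : Measurable g)
    {W : (Edge L → ℝ) → ℝ≥0∞} (hW : Measurable W) :
    ∫⁻ φ : Torus L → ℝ, g (φ y) * W (grad φ) = (∫⁻ η, W η ∂(nuL L)) * ∫⁻ t, g t := by
  let p : Torus L → Prop := fun x => x = 0
  let e := MeasurableEquiv.piEquivPiSubtypeProd (fun _ : Torus L => ℝ) p
  have he := (volume_preserving_piEquivPiSubtypeProd (fun _ : Torus L => ℝ) p).symm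
  have hval : ∀ z, e.symm z = fun x => if h : x = 0 then z.1 ⟨x, h⟩ else z.2 ⟨x, h⟩ := by
    intro z; rfl
  have hm : Measurable fun φ : Torus L → ℝ => g (φ y) * W (grad φ) :=
    (hg.comp (measurable_pi_apply y)).mul (hW.comp measurable_grad)
  have hm' : Measurable fun z => g (e.symm z y) * W (grad (e.symm z)) := hm.comp e.symm.measurable
  let o : Subtype p := ⟨0, rfl⟩
  have hshift : ∀ (a : Subtype p → ℝ) (ψ : {x // ¬ p x} → ℝ),
      e.symm (a, ψ + fun _ => a o) = fun x => extZ ψ x + a o := by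
    intro a ψ
    rw [hval]
    funext x
    unfold extZ
    split_ifs with h
    · subst h; simp [o]
    · rfl
  have hgrad : ∀ (f : Torus L → ℝ) (t : ℝ), grad (fun x => f x + t) = grad f := by
    intro f t; funext b; simp [grad]
  have hfun := (volume_preserving_funUnique (Subtype p) ℝ)
  rw [← he.lintegral_comp hm, lintegral_nuL L hW, Measure.volume_eq_prod,
    lintegral_prod _ hm'.aemeasurable]
  have hWm : Measurable fun ψ : {x // ¬ p x} → ℝ => W (grad (extZ ψ)) :=
    hW.comp (measurable_grad.comp measurable_extZ)
  have hey : Measurable fun ψ : {x // ¬ p x} → ℝ => extZ ψ y :=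
    (measurable_pi_apply y).comp measurable_extZ
  have hK : Measurable fun z : ℝ × ({x // ¬ p x} → ℝ) =>
      g (extZ z.2 y + z.1) * W (grad (extZ z.2)) :=
    (hg.comp ((hey.comp measurable_snd).add measurable_fst)).mul (hWm.comp measurable_snd)
  have step1 : ∀ a : Subtype p → ℝ,
      (∫⁻ ψ : {x // ¬ p x} → ℝ, g (e.symm (a, ψ) y) * W (grad (e.symm (a, ψ)))) =
        ∫⁻ ψ : {x // ¬ p x} → ℝ, g (extZ ψ y + a o) * W (grad (extZ ψ)) := by
    intro a
    rw [← lintegral_add_right_eq_self _ (fun _ => a o)]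
    refine lintegral_congr fun ψ => ?_
    rw [hshift, hgrad]
  refine (lintegral_congr step1).trans ?_
  have step2 := hfun.lintegral_comp (Measurable.lintegral_prod_right' (ν := volume) hK)
  have step3 : ∫⁻ t : ℝ, ∫⁻ ψ : {x // ¬ p x} → ℝ, g (extZ ψ y + t) * W (grad (extZ ψ)) =
      (∫⁻ ψ : {x // ¬ p x} → ℝ, W (grad (extZ ψ))) * ∫⁻ t, g t := by
    rw [lintegral_lintegral_swap hK.aemeasurable, ← lintegral_mul_const _ hWm]
    refine lintegral_congr fun ψ => ?_
    have hgm : Measurable fun t => g (extZ ψ y + t) := hg.comp (measurable_const.add measurable_id)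
    rw [lintegral_mul_const _ hgm, lintegral_add_left_eq_self, mul_comm]
  refine Eq.trans ?_ (step2.trans step3)
  convert! rfl

/-- Boltzmann weight of a gradient configuration. -/
def bweight (L : ℕ) [NeZero L] (κ η : Edge L → ℝ) : ℝ≥0∞ :=
  ENNReal.ofReal (Real.exp (-(energy L κ η)))

theorem measurable_bweight {L : ℕ} [NeZero L] (κ : Edge L → ℝ) : Measurable (bweight L κ) := by
  unfold bweight energy
  fun_prop

theorem ZL_eq {L : ℕ} [NeZero L] (κ : Edge L → ℝ) :
    ZL L κ = ∫⁻ ψ, bweight L κ (grad (extZ ψ)) :=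
  lintegral_nuL L (measurable_bweight κ)

theorem lintegral_pinned_bweight {L : ℕ} [NeZero L] (κ : Edge L → ℝ) (y : Torus L) :
    ∫⁻ φ : Torus L → ℝ, (Set.Icc (0 : ℝ) 1).indicator 1 (φ y) * bweight L κ (grad φ) = ZL L κ := by
  rw [lintegral_pinned L y (measurable_one.indicator measurableSet_Icc) (measurable_bweight κ),
    lintegral_indicator_one measurableSet_Icc]
  simp [ZL, bweight]

theorem ZL_comp_equiv {L : ℕ} [NeZero L] (θV : Torus L ≃ Torus L) (θE : Edge L ≃ Edge L)
    (h : ∀ (φ : Torus L → ℝ) e, grad (φ ∘ θV) e ^ 2 = grad φ (θE e) ^ 2) (κ : Edge L → ℝ) :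
    ZL L (κ ∘ θE) = ZL L κ := by
  have hW : ∀ φ : Torus L → ℝ, bweight L (κ ∘ θE) (grad (φ ∘ θV)) = bweight L κ (grad φ) := by
    intro φ
    unfold bweight energy
    congr 4
    rw [← Equiv.sum_comp θE fun e => κ e * grad φ e ^ 2]
    simp [h]
  rw [← lintegral_pinned_bweight κ (θV 0), ← lintegral_pinned_bweight (κ ∘ θE) 0]
  have hp := (volume_measurePreserving_piCongrLeft (fun _ : Torus L => ℝ) θV).symm
  rw [← hp.lintegral_comp]
  · refine lintegral_congr fun φ => ?_
    have : (MeasurableEquiv.piCongrLeft (fun _ : Torus L => ℝ) θV).symm φ = φ ∘ θV := by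
      funext x; rfl
    rw [this, hW]; rfl
  · exact ((measurable_one.indicator measurableSet_Icc).comp (measurable_pi_apply 0)).mul
      ((measurable_bweight _).comp measurable_grad)

/-- Incidence matrix of the torus with the column of the origin removed. -/
def incid (L : ℕ) : Matrix (Edge L) {x : Torus L // x ≠ 0} ℝ :=
  fun e v => (if etarget e = v then 1 else 0) - (if e.1 = v then 1 else 0)

theorem sum_ite_eq_extZ {L : ℕ} [NeZero L] (ψ : {x : Torus L // x ≠ 0} → ℝ) (x : Torus L) :
    ∑ v : {x : Torus L // x ≠ 0}, (if x = v then 1 else 0) * ψ v = extZ ψ x := by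
  unfold extZ
  split_ifs with h
  · refine Finset.sum_eq_zero fun v _ => ?_
    rw [if_neg, zero_mul]
    rw [h]; exact fun h' => v.2 h'.symm
  · rw [Finset.sum_eq_single ⟨x, h⟩]
    · simp
    · intro v _ hv
      rw [if_neg, zero_mul]
      intro h'; apply hv; ext1; exact h'.symm
    · simp

theorem incid_mulVec {L : ℕ} [NeZero L] (ψ : {x : Torus L // x ≠ 0} → ℝ) :
    (incid L).mulVec ψ = grad (extZ ψ) := by
  funext e
  simp only [Matrix.mulVec, dotProduct, incid, sub_mul, Finset.sum_sub_distrib, sum_ite_eq_extZ,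
    grad]

theorem eq_const_of_grad_eq_zero {L : ℕ} [NeZero L] {φ : Torus L → ℝ} (h : grad φ = 0)
    (x : Torus L) : φ x = φ 0 := by
  have h1 : ∀ (a b : ZMod L), φ (a + 1, b) = φ (a, b) := by
    intro a b
    have := congrFun h ((a, b), true)
    simpa [grad, etarget, estep, sub_eq_zero] using this
  have h2 : ∀ (a b : ZMod L), φ (a, b + 1) = φ (a, b) := by
    intro a b
    have := congrFun h ((a, b), false)
    simpa [grad, etarget, estep, sub_eq_zero] using this
  have h3 : ∀ (n : ℕ) (b : ZMod L), φ ((n : ZMod L), b) = φ (0, b) := by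
    intro n b
    induction n with
    | zero => simp
    | succ k ih => rw [Nat.cast_succ, h1, ih]
  have h4 : ∀ (n : ℕ), φ (0, (n : ZMod L)) = φ (0, 0) := by
    intro n
    induction n with
    | zero => simp
    | succ k ih => rw [Nat.cast_succ, h2, ih]
  obtain ⟨a, b⟩ := x
  rw [← ZMod.natCast_zmod_val a, ← ZMod.natCast_zmod_val b, h3, h4]
  rfl

theorem incid_injective {L : ℕ} [NeZero L] : Function.Injective (incid L).mulVec := by
  intro ψ ψ' h
  have h0 : (incid L).mulVec (ψ - ψ') = 0 := by rw [Matrix.mulVec_sub, h, sub_self]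
  rw [incid_mulVec] at h0
  funext v
  have := eq_const_of_grad_eq_zero h0 v
  simp only [extZ, v.2, dite_false, dite_true, Pi.sub_apply] at this
  linarith

/-- The reduced weighted Laplacian. -/
def lapl {L : ℕ} [NeZero L] (κ : Edge L → ℝ) :
    Matrix {x : Torus L // x ≠ 0} {x : Torus L // x ≠ 0} ℝ :=
  (incid L).transpose * Matrix.diagonal κ * incid L

theorem lapl_posDef {L : ℕ} [NeZero L] {κ : Edge L → ℝ} (hκ : ∀ e, 0 < κ e) : (lapl κ).PosDef := by
  have := (Matrix.PosDef.diagonal hκ).conjTranspose_mul_mul_same (B := incid L) incid_injective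
  rwa [Matrix.conjTranspose_eq_transpose_of_trivial] at this

theorem energy_grad_extZ {L : ℕ} [NeZero L] (κ : Edge L → ℝ) (ψ : {x : Torus L // x ≠ 0} → ℝ) :
    energy L κ (grad (extZ ψ)) = 1 / 2 * (ψ ⬝ᵥ (lapl κ).mulVec ψ) := by
  unfold energy lapl
  rw [← Matrix.mulVec_mulVec, ← Matrix.mulVec_mulVec, Matrix.dotProduct_mulVec,
    Matrix.vecMul_transpose, incid_mulVec]
  congr 1
  refine Finset.sum_congr rfl fun e _ => ?_
  rw [Matrix.mulVec_diagonal]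
  ring

theorem ZL_eq_det {L : ℕ} [NeZero L] {κ : Edge L → ℝ} (hκ : ∀ e, 0 < κ e) :
    ZL L κ = ENNReal.ofReal
      (√((2 * π) ^ Fintype.card {x : Torus L // x ≠ 0} / (lapl κ).det)) := by
  rw [ZL_eq, ← lintegral_gaussian_posDef _ (lapl_posDef hκ)]
  simp_rw [bweight, energy_grad_extZ]


theorem val_sub_one_lt {L : ℕ} [NeZero L] {a : ZMod L} (ha : a ≠ 0) :
    (a - 1).val < a.val := by
  have h1 : L ≠ 1 := by
    rintro rfl
    exact ha (Subsingleton.elim _ _)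
  have h2 : (1 : ZMod L).val = 1 := ZMod.val_one'' h1
  have h3 : 0 < a.val := by
    rw [Nat.pos_iff_ne_zero, Ne, ZMod.val_eq_zero]; exact ha
  rw [ZMod.val_sub (by omega), h2]
  omega

/-- The edge entering `x` in direction `d`. -/
def inEdge {L : ℕ} (d : Bool) (x : Torus L) : Edge L := (x - estep L d, d)

theorem etarget_inEdge {L : ℕ} (d : Bool) (x : Torus L) : etarget (inEdge d x) = x := by
  simp [inEdge, etarget]

theorem det_parent_eq_one {L : ℕ} [NeZero L] (d : {x : Torus L // x ≠ 0} → Bool)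
    (hd : ∀ x, faceCoord (d x) x.1 ≠ 0) :
    (Matrix.of fun x v : {x : Torus L // x ≠ 0} => incid L (inEdge (d x) x.1) v).det = 1 := by
  set T := Matrix.of fun x v : {x : Torus L // x ≠ 0} => incid L (inEdge (d x) x.1) v with hT
  let b : {x : Torus L // x ≠ 0} → ℕᵒᵈ := fun x => OrderDual.toDual (x.1.1.val + x.1.2.val)
  have hpar : ∀ x v : {x : Torus L // x ≠ 0}, (inEdge (d x) x.1).1 = v.1 → b x < b v := by
    intro x v h
    change v.1.1.val + v.1.2.val < x.1.1.val + x.1.2.val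
    rw [← h]
    have := hd x
    cases hdx : d x
    · simp only [hdx, faceCoord, Bool.false_eq_true, if_false] at this
      have := val_sub_one_lt this
      simpa [inEdge, estep] using this
    · simp only [hdx, faceCoord, if_true] at this
      have := val_sub_one_lt this
      simpa [inEdge, estep] using this
  have hval : ∀ x v, T x v = (if x = v then 1 else 0) -
      (if (inEdge (d x) x.1).1 = v.1 then 1 else 0) := by
    intro x v
    simp only [hT, Matrix.of_apply, incid, etarget_inEdge, Subtype.ext_iff]
  have htri : T.BlockTriangular b := by
    intro x v h
    rw [hval, if_neg, if_neg, sub_zero]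
    · intro h'; exact absurd (hpar x v h') (not_lt.2 h.le)
    · rintro rfl; exact lt_irrefl _ h
  rw [htri.det]
  refine Finset.prod_eq_one fun a _ => ?_
  have : T.toSquareBlock b a = 1 := by
    ext x v
    rw [Matrix.toSquareBlock_def, Matrix.of_apply, hval, Matrix.one_apply]
    rw [if_neg (fun h' => absurd (hpar _ _ h') (by rw [x.2, v.2]; exact lt_irrefl _)), sub_zero]
    simp only [Subtype.ext_iff]
  rw [this, Matrix.det_one]

/-- Spanning-tree upper bound on the Gaussian partition function. -/
theorem ZL_le_prod {L : ℕ} [NeZero L] {κ : Edge L → ℝ} (hκ : ∀ e, 0 < κ e)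
    (d : {x : Torus L // x ≠ 0} → Bool) (hd : ∀ x, faceCoord (d x) x.1 ≠ 0) :
    ZL L κ ≤ ENNReal.ofReal (∏ x, √(2 * π / κ (inEdge (d x) x.1))) := by
  set T := Matrix.of fun x v : {x : Torus L // x ≠ 0} => incid L (inEdge (d x) x.1) v with hT
  have hdet : T.det = 1 := det_parent_eq_one d hd
  have hinj : Function.Injective fun x : {x : Torus L // x ≠ 0} => inEdge (d x) x.1 := by
    intro x y h
    have := congrArg etarget h
    simp only [etarget_inEdge] at this
    exact Subtype.ext this
  have hTv : ∀ ψ x, T.mulVec ψ x = grad (extZ ψ) (inEdge (d x) x.1) := by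
    intro ψ x
    rw [← incid_mulVec]; rfl
  have hm : Measurable fun y : {x : Torus L // x ≠ 0} → ℝ => ENNReal.ofReal
      (Real.exp (-∑ x, κ (inEdge (d x) x.1) / 2 * y x ^ 2)) := by fun_prop
  have h1 := lintegral_comp_mulVec T (by rw [hdet]; norm_num) hm
  rw [lintegral_exp_neg_sum_sq _ (fun x => half_pos (hκ _)), hdet] at h1
  simp only [inv_one, abs_one, ENNReal.ofReal_one, one_mul] at h1
  have h2 : ∀ x : {x : Torus L // x ≠ 0}, 2 * π / κ (inEdge (d x) x.1) =
      π / (κ (inEdge (d x) x.1) / 2) := by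
    intro x
    field_simp
  simp_rw [h2]
  rw [← h1, ZL_eq]
  refine lintegral_mono fun ψ => ?_
  unfold bweight energy
  refine ENNReal.ofReal_le_ofReal (Real.exp_le_exp.2 (neg_le_neg ?_))
  simp_rw [hTv]
  rw [Finset.mul_sum, ← Finset.sum_image (s := Finset.univ)
    (g := fun x : {x : Torus L // x ≠ 0} => inEdge (d x) x.1)
    (f := fun e => κ e / 2 * grad (extZ ψ) e ^ 2) (fun x _ y _ h => hinj h)]
  refine (Finset.sum_le_univ_sum_of_nonneg fun e => ?_).trans (le_of_eq ?_)
  · have := hκ e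
    positivity
  · refine Finset.sum_congr rfl fun e _ => ?_
    ring

theorem le_ZL {L : ℕ} [NeZero L] {κ : Edge L → ℝ} {k : ℝ} (hk : 0 < k) (hκ : ∀ e, κ e ≤ k) :
    ENNReal.ofReal (∏ _x : {x : Torus L // x ≠ 0}, √(π / (4 * k))) ≤ ZL L κ := by
  rw [← lintegral_exp_neg_sum_sq (fun _ => 4 * k) (fun _ => by positivity), ZL_eq]
  refine lintegral_mono fun ψ => ?_
  unfold bweight energy
  refine ENNReal.ofReal_le_ofReal (Real.exp_le_exp.2 (neg_le_neg ?_))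
  set φ := extZ ψ with hφ
  have h1 : ∀ e : Edge L, κ e * grad φ e ^ 2 ≤ 2 * k * φ (etarget e) ^ 2 + 2 * k * φ e.1 ^ 2 := by
    intro e
    unfold grad
    nlinarith [mul_le_mul_of_nonneg_right (hκ e) (sq_nonneg (φ (etarget e) - φ e.1)),
      mul_nonneg hk.le (sq_nonneg (φ (etarget e) + φ e.1))]
  have h2 : ∑ e : Edge L, φ e.1 ^ 2 = 2 * ∑ x, φ x ^ 2 := by
    rw [Fintype.sum_prod_type, Finset.mul_sum]
    simp
  have h3 : ∑ e : Edge L, φ (etarget e) ^ 2 = 2 * ∑ x, φ x ^ 2 := by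
    rw [Fintype.sum_prod_type_right]
    have : ∀ d : Bool, ∑ x : Torus L, φ (etarget (x, d)) ^ 2 = ∑ x, φ x ^ 2 := fun d =>
      Equiv.sum_comp (Equiv.addRight (estep L d)) fun x => φ x ^ 2
    simp only [this, Fintype.sum_bool]
    ring
  have h4 : ∑ x, φ x ^ 2 = ∑ x, ψ x ^ 2 := by
    symm
    refine Fintype.sum_of_injective Subtype.val Subtype.val_injective _ _ ?_ ?_
    · intro x hx
      have : x = 0 := by
        by_contra h
        exact hx ⟨⟨x, h⟩, rfl⟩
      simp [hφ, extZ, this]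
    · intro x
      simp [hφ, extZ, x.2]
  calc 1 / 2 * ∑ e, κ e * grad φ e ^ 2
      ≤ 1 / 2 * ∑ e : Edge L, (2 * k * φ (etarget e) ^ 2 + 2 * k * φ e.1 ^ 2) := by
        gcongr with e; exact h1 e
    _ = ∑ x, 4 * k * ψ x ^ 2 := by
        rw [Finset.sum_add_distrib, ← Finset.mul_sum, ← Finset.mul_sum, ← Finset.mul_sum, h2, h3, h4]
        ring

theorem det_transpose_mul_diagonal_mul {ι E : Type*} [Fintype ι] [DecidableEq ι] [Fintype E]
    [DecidableEq E] (h : Fintype.card ι = Fintype.card E) (X Y : Matrix E ι ℝ) (κ : E → ℝ) :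
    (X.transpose * Matrix.diagonal κ * Y).det = (∏ e, κ e) * (X.transpose * Y).det := by
  let g : ι ≃ E := Fintype.equivOfCardEq h
  have e1 : ∀ Z : Matrix E ι ℝ, X.transpose * Z = (X.submatrix g id).transpose * Z.submatrix g id := by
    intro Z
    rw [Matrix.transpose_submatrix, Matrix.submatrix_mul_equiv, Matrix.submatrix_id_id]
  have e2 : (Matrix.diagonal κ * Y).submatrix g id =
      Matrix.diagonal (κ ∘ g) * Y.submatrix g id := by
    ext i j
    simp
  rw [Matrix.mul_assoc, e1, e2, e1 Y, Matrix.det_mul, Matrix.det_mul, Matrix.det_mul,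
    Matrix.det_diagonal, ← Equiv.prod_comp g]
  simp only [Function.comp]
  ring

/-- Fischer's inequality for a positive semidefinite matrix whose second diagonal block is a
diagonal `2 × 2` matrix. -/
theorem det_fromBlocks_le {ι : Type*} [Fintype ι] [DecidableEq ι] {P : Matrix ι ι ℝ}
    (hP : P.PosDef) (Q : Matrix ι Bool ℝ) (R : Bool → ℝ)
    (h : (Matrix.fromBlocks P Q Q.transpose (Matrix.diagonal R)).PosSemidef) :
    (Matrix.fromBlocks P Q Q.transpose (Matrix.diagonal R)).det ≤ P.det * (R true * R false) := by
  have : Invertible P := hP.isUnit.invertible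
  rw [← Matrix.conjTranspose_eq_transpose_of_trivial, Matrix.PosDef.fromBlocks₁₁ _ _ hP] at h
  rw [Matrix.det_fromBlocks₁₁, Matrix.invOf_eq_nonsing_inv]
  refine mul_le_mul_of_nonneg_left ?_ hP.det_pos.le
  rw [Matrix.conjTranspose_eq_transpose_of_trivial] at h
  have hS : (Q.transpose * P⁻¹ * Q).PosSemidef := by
    have := hP.inv.posSemidef.conjTranspose_mul_mul_same Q
    rwa [Matrix.conjTranspose_eq_transpose_of_trivial] at this
  set S := Q.transpose * P⁻¹ * Q
  have hsym : S true false = S false true := by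
    have := hS.isHermitian.apply false true
    simpa using this
  have a1 := hS.diag_nonneg (i := true)
  have a2 := hS.diag_nonneg (i := false)
  have b1 := h.diag_nonneg (i := true)
  have b2 := h.diag_nonneg (i := false)
  have hdet : (Matrix.diagonal R - S).det =
      (R true - S true true) * (R false - S false false) - S true false ^ 2 := by
    rw [← Matrix.det_reindex_self finTwoEquiv.symm, Matrix.det_fin_two]
    simp [finTwoEquiv, hsym]
    ring
  simp only [Matrix.sub_apply, Matrix.diagonal_apply_eq] at b1 b2
  rw [hdet]
  nlinarith [sq_nonneg (S true false), mul_nonneg a1 b2, mul_nonneg b1 a2, mul_nonneg a1 a2]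

/-- The bijection `e ↦ σ e` sending an edge to the (translated) dual edge. -/
def dualEdge (L : ℕ) : Edge L ≃ Edge L where
  toFun e := (e.1 - estep L (!e.2), !e.2)
  invFun e := (e.1 + estep L e.2, !e.2)
  left_inv e := by simp
  right_inv e := by simp

def dualSign (d : Bool) : ℝ := if d then 1 else -1

theorem sum_grad_mul_grad_dual {L : ℕ} [NeZero L] (φ φ' : Torus L → ℝ) :
    ∑ e : Edge L, grad φ e * (dualSign e.2 * grad φ' (dualEdge L e)) = 0 := by
  have hs : ∀ (f : Torus L → ℝ) (t : Torus L), ∑ x, f (x + t) = ∑ x, f x := fun f t =>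
    Equiv.sum_comp (Equiv.addRight t) f
  rw [Fintype.sum_prod_type_right]
  simp only [Fintype.sum_bool, grad, dualSign, dualEdge, etarget, Equiv.coe_fn_mk, Bool.not_true,
    Bool.not_false, if_true, Bool.false_eq_true, if_false, sub_add_cancel]
  set a := estep L true
  set b := estep L false
  rw [← Finset.sum_add_distrib]
  set g1 : Torus L → ℝ := fun x => φ x * φ' (x - a) with hg1
  set g2 : Torus L → ℝ := fun x => φ x * φ' (x - b) with hg2
  set g3 : Torus L → ℝ := fun x => φ x * φ' (x - a - b) with hg3
  calc _ = ∑ x, ((g1 (x + a) - g1 x) - (g2 (x + b) - g2 x) - (g3 (x + a) - g3 (x + b))) := by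
        refine Finset.sum_congr rfl fun x _ => ?_
        have e1 : x + b - a - b = x - a := by abel
        simp only [hg1, hg2, hg3, add_sub_cancel_right, e1]
        ring
    _ = 0 := by
        simp only [Finset.sum_sub_distrib, hs]
        ring

theorem sum_dir_grad {L : ℕ} [NeZero L] (φ : Torus L → ℝ) (d : Bool) :
    ∑ x : Torus L, grad φ (x, d) = 0 := by
  have : ∑ x : Torus L, φ (x + estep L d) = ∑ x, φ x :=
    Equiv.sum_comp (Equiv.addRight (estep L d)) φ
  simp [grad, etarget, Finset.sum_sub_distrib, this]


theorem card_ne_zero_torus (L : ℕ) [NeZero L] :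
    Fintype.card {x : Torus L // x ≠ 0} = L ^ 2 - 1 := by
  rw [Fintype.card_subtype_compl, Fintype.card_subtype_eq, Fintype.card_prod, ZMod.card, pow_two]

theorem card_edge (L : ℕ) [NeZero L] : Fintype.card (Edge L) = 2 * L ^ 2 := by
  rw [Fintype.card_prod, Fintype.card_prod, ZMod.card, Fintype.card_bool]
  ring

theorem transpose_mul_diagonal_mul_apply {E ι ι' : Type*} [Fintype E] [DecidableEq E]
    (X : Matrix E ι ℝ) (Y : Matrix E ι' ℝ) (κ : E → ℝ) (i : ι) (j : ι') :
    (X.transpose * Matrix.diagonal κ * Y) i j = ∑ e, X e i * κ e * Y e j := by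
  rw [Matrix.mul_apply]
  simp only [Matrix.mul_diagonal, Matrix.transpose_apply]

/-- Dual incidence matrix. -/
def dualIncid (L : ℕ) : Matrix (Edge L) {x : Torus L // x ≠ 0} ℝ :=
  fun e v => dualSign e.2 * incid L (dualEdge L e) v

/-- Indicators of the two edge directions. -/
def dirMat (L : ℕ) : Matrix (Edge L) Bool ℝ := fun e d => if e.2 = d then 1 else 0

theorem incid_eq_grad {L : ℕ} (e : Edge L) (v : {x : Torus L // x ≠ 0}) :
    incid L e v = grad (fun x => if x = v then (1 : ℝ) else 0) e := rfl

theorem incid_transpose_mul_dual (L : ℕ) [NeZero L] :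
    (incid L).transpose * dualIncid L = 0 := by
  ext v w
  simp only [Matrix.mul_apply, Matrix.transpose_apply, dualIncid, incid_eq_grad, Matrix.zero_apply]
  exact sum_grad_mul_grad_dual _ _

theorem incid_transpose_mul_dir (L : ℕ) [NeZero L] :
    (incid L).transpose * dirMat L = 0 := by
  ext v d
  simp only [Matrix.mul_apply, Matrix.transpose_apply, dirMat, incid_eq_grad, Matrix.zero_apply]
  rw [Fintype.sum_prod_type_right, Fintype.sum_eq_single d]
  · simp only [if_true, mul_one]
    exact sum_dir_grad _ d
  · intro d' h
    simp [h]

theorem dual_transpose_mul_dir (L : ℕ) [NeZero L] :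
    (dualIncid L).transpose * dirMat L = 0 := by
  ext v d
  simp only [Matrix.mul_apply, Matrix.transpose_apply, dualIncid, dirMat, incid_eq_grad,
    Matrix.zero_apply]
  rw [Fintype.sum_prod_type_right, Fintype.sum_eq_single d]
  · simp only [if_true, mul_one, ← Finset.mul_sum]
    have := Equiv.sum_comp (Equiv.subRight (estep L (!d)))
      fun x => grad (fun x => if x = v.1 then (1 : ℝ) else 0) (x, !d)
    simp only [Equiv.subRight_apply] at this
    simp only [dualEdge, Equiv.coe_fn_mk, this, sum_dir_grad, mul_zero]
  · intro d' h
    simp [h]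

theorem dual_mul_diagonal_mul_dual {L : ℕ} [NeZero L] (κ : Edge L → ℝ) :
    (dualIncid L).transpose * Matrix.diagonal κ * dualIncid L =
      lapl (κ ∘ (dualEdge L).symm) := by
  ext v w
  rw [lapl, transpose_mul_diagonal_mul_apply, transpose_mul_diagonal_mul_apply]
  simp only [dualIncid]
  rw [← Equiv.sum_comp (dualEdge L)
    fun e => incid L e v * (κ ∘ (dualEdge L).symm) e * incid L e w]
  refine Finset.sum_congr rfl fun e _ => ?_
  have : dualSign e.2 * dualSign e.2 = 1 := by cases e.2 <;> simp [dualSign]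
  simp only [Function.comp, Equiv.symm_apply_apply]
  linear_combination (incid L (dualEdge L e) v * κ e * incid L (dualEdge L e) w) * this

theorem dir_mul_diagonal_mul_dir {L : ℕ} [NeZero L] (κ : Edge L → ℝ) :
    (dirMat L).transpose * Matrix.diagonal κ * dirMat L =
      Matrix.diagonal fun d => ∑ x, κ (x, d) := by
  ext d d'
  rw [transpose_mul_diagonal_mul_apply]
  simp only [dirMat]
  rw [Fintype.sum_prod_type_right, Fintype.sum_eq_single d]
  · by_cases h : d = d'
    · subst h; simp
    · simp [h]
  · intro da h
    simp [h]

/-- Duality of the reduced weighted Laplacian determinants on the torus. -/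
theorem det_lapl_le {L : ℕ} [NeZero L] {κ : Edge L → ℝ} {k : ℝ} (hk : 0 < k) (hκ : ∀ e, k ≤ κ e) :
    (lapl κ).det ≤ (∏ e, κ e) * (lapl (κ⁻¹ ∘ (dualEdge L).symm)).det / k ^ 2 := by
  have hκ0 : ∀ e, 0 < κ e := fun e => hk.trans_le (hκ e)
  have hκi : ∀ e, 0 < κ⁻¹ e := fun e => inv_pos.2 (hκ0 e)
  set C := Matrix.fromCols (dualIncid L) (dirMat L) with hC
  set K := Matrix.diagonal κ with hK
  set K' := Matrix.diagonal κ⁻¹ with hK'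
  have hKK : K * K' = 1 := by
    rw [hK, hK', Matrix.diagonal_mul_diagonal, ← Matrix.diagonal_one]
    congr 1; funext e
    exact mul_inv_cancel₀ (hκ0 e).ne'
  have hcard : Fintype.card ({x : Torus L // x ≠ 0} ⊕ ({x : Torus L // x ≠ 0} ⊕ Bool)) =
      Fintype.card (Edge L) := by
    rw [Fintype.card_sum, Fintype.card_sum, card_ne_zero_torus, card_edge, Fintype.card_bool]
    have : 0 < L ^ 2 := pow_pos (NeZero.pos L) 2
    omega
  have hAC : (incid L).transpose * C = 0 := by
    rw [hC, Matrix.mul_fromCols, incid_transpose_mul_dual, incid_transpose_mul_dir]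
    ext i (j | j) <;> rfl
  have hCA : C.transpose * incid L = 0 := by
    rw [← Matrix.transpose_inj, Matrix.transpose_mul, Matrix.transpose_transpose, hAC,
      Matrix.transpose_zero]
  have key := det_transpose_mul_diagonal_mul hcard (Matrix.fromCols (incid L) C)
    (Matrix.fromCols (incid L) (K' * C)) κ
  have hCC : ∀ κ' : Edge L → ℝ, C.transpose * Matrix.diagonal κ' * C =
      Matrix.fromBlocks (lapl (κ' ∘ (dualEdge L).symm))
        ((dualIncid L).transpose * Matrix.diagonal κ' * dirMat L)
        ((dualIncid L).transpose * Matrix.diagonal κ' * dirMat L).transpose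
        (Matrix.diagonal fun d => ∑ x, κ' (x, d)) := by
    intro κ'
    rw [hC, Matrix.transpose_fromCols, Matrix.fromRows_mul, Matrix.fromRows_mul_fromCols,
      dual_mul_diagonal_mul_dual, dir_mul_diagonal_mul_dir]
    congr 1
    simp only [Matrix.transpose_mul, Matrix.transpose_transpose, Matrix.diagonal_transpose,
      Matrix.mul_assoc]
  have hCC1 : C.transpose * C = Matrix.fromBlocks (lapl 1) 0 0
      (Matrix.diagonal fun _ : Bool => (L ^ 2 : ℝ)) := by
    have := hCC 1
    rw [show Matrix.diagonal (1 : Edge L → ℝ) = 1 from Matrix.diagonal_one, Matrix.mul_one,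
      Matrix.mul_one, dual_transpose_mul_dir, Matrix.transpose_zero] at this
    rw [this]
    congr 2
    funext d
    simp [pow_two]
  have hAA : (incid L).transpose * incid L = lapl 1 := by
    rw [lapl, show Matrix.diagonal (1 : Edge L → ℝ) = 1 from Matrix.diagonal_one, Matrix.mul_one]
  have e1 : ((Matrix.fromCols (incid L) C).transpose * K * Matrix.fromCols (incid L) (K' * C)).det =
      (lapl κ).det * ((lapl (L := L) 1).det * (L ^ 2) ^ 2) := by
    rw [Matrix.transpose_fromCols, Matrix.fromRows_mul, Matrix.fromRows_mul_fromCols,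
      show (incid L).transpose * K * (K' * C) = 0 by
        rw [Matrix.mul_assoc, ← Matrix.mul_assoc K, hKK, Matrix.one_mul, hAC],
      Matrix.det_fromBlocks_zero₁₂,
      show C.transpose * K * (K' * C) = C.transpose * C by
        rw [Matrix.mul_assoc, ← Matrix.mul_assoc K, hKK, Matrix.one_mul],
      hCC1, Matrix.det_fromBlocks_zero₁₂, Matrix.det_diagonal]
    simp only [Finset.prod_const, Finset.card_univ, Fintype.card_bool]
    rfl
  have e2 : ((Matrix.fromCols (incid L) C).transpose * Matrix.fromCols (incid L) (K' * C)).det =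
      (lapl (L := L) 1).det * (C.transpose * K' * C).det := by
    rw [Matrix.transpose_fromCols, Matrix.fromRows_mul_fromCols, hCA,
      Matrix.det_fromBlocks_zero₂₁, hAA, Matrix.mul_assoc]
  have h1 : 0 < (lapl (L := L) 1).det := (lapl_posDef fun _ => one_pos).det_pos
  have hL : (0 : ℝ) < L := by exact_mod_cast NeZero.pos L
  have hfis : (C.transpose * K' * C).det ≤
      (lapl (κ⁻¹ ∘ (dualEdge L).symm)).det * ((L ^ 2 / k) * (L ^ 2 / k)) := by
    have hpos : (C.transpose * K' * C).PosSemidef := by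
      have := (Matrix.PosSemidef.diagonal (fun e => (hκi e).le)).conjTranspose_mul_mul_same C
      rwa [Matrix.conjTranspose_eq_transpose_of_trivial] at this
    have hd : (lapl (κ⁻¹ ∘ (dualEdge L).symm)).PosDef := lapl_posDef fun e => hκi _
    have hb : ∀ d, ∑ x : Torus L, κ⁻¹ (x, d) ≤ L ^ 2 / k := by
      intro d
      refine (Finset.sum_le_card_nsmul _ _ k⁻¹ fun x _ => ?_).trans (le_of_eq ?_)
      · exact inv_anti₀ hk (hκ _)
      · simp [pow_two, div_eq_mul_inv]
    rw [hK', hCC] at hpos ⊢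
    refine (det_fromBlocks_le hd _ _ hpos).trans (mul_le_mul_of_nonneg_left ?_ hd.det_pos.le)
    have := Finset.sum_nonneg fun (x : Torus L) (_ : x ∈ Finset.univ) => (hκi (x, false)).le
    exact mul_le_mul (hb _) (hb _) this (by positivity)
  rw [e1, e2] at key
  have h2 : (lapl κ).det * (L ^ 2) ^ 2 = (∏ e, κ e) * (C.transpose * K' * C).det := by
    apply mul_left_cancel₀ h1.ne'
    linear_combination key
  have hprod : 0 < ∏ e, κ e := Finset.prod_pos fun e _ => hκ0 e
  have h3 := mul_le_mul_of_nonneg_left hfis hprod.le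
  rw [← h2] at h3
  rw [le_div_iff₀ (by positivity)]
  have h4 : (0 : ℝ) < (L ^ 2) ^ 2 := by positivity
  refine le_of_mul_le_mul_right ?_ h4
  calc (lapl κ).det * k ^ 2 * (L ^ 2) ^ 2 = (lapl κ).det * (L ^ 2) ^ 2 * k ^ 2 := by ring
    _ ≤ ((∏ e, κ e) * ((lapl (κ⁻¹ ∘ (dualEdge L).symm)).det * ((L ^ 2 / k) * (L ^ 2 / k)))) * k ^ 2 :=
      mul_le_mul_of_nonneg_right h3 (by positivity)
    _ = _ := by field_simp

/-- Two-valued conductances. -/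
def conduct {L : ℕ} (κO κD : ℝ) (ω : Edge L → Bool) : Edge L → ℝ := fun e => if ω e then κO else κD

/-- Number of ordered bonds. -/
def ones {L : ℕ} [NeZero L] (ω : Edge L → Bool) : ℕ := (Finset.univ.filter fun e => ω e = true).card

/-- Number of disordered bonds. -/
def zeros {L : ℕ} [NeZero L] (ω : Edge L → Bool) : ℕ :=
  (Finset.univ.filter fun e => ω e = false).card

theorem ones_add_zeros {L : ℕ} [NeZero L] (ω : Edge L → Bool) : ones ω + zeros ω = 2 * L ^ 2 := by
  unfold ones zeros
  rw [← card_edge, ← Finset.card_univ,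
    ← Finset.card_filter_add_card_filter_not (s := Finset.univ) (fun e => ω e = true)]
  simp

theorem prod_ite_eq_pow {L : ℕ} [NeZero L] {M : Type*} [CommMonoid M] (a b : M) (ω : Edge L → Bool) :
    (∏ e, if ω e then a else b) = a ^ ones ω * b ^ zeros ω := by
  rw [Finset.prod_ite, Finset.prod_const, Finset.prod_const]
  simp [ones, zeros]

/-- Real-valued partition function of a two-valued configuration. -/
def zr {L : ℕ} [NeZero L] (κO κD : ℝ) (ω : Edge L → Bool) : ℝ := (ZL L (conduct κO κD ω)).toReal

theorem conduct_pos {L : ℕ} {κO κD : ℝ} (hO : 0 < κO) (hD : 0 < κD) (ω : Edge L → Bool) (e : Edge L) :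
    0 < conduct κO κD ω e := by
  unfold conduct; split_ifs <;> assumption

theorem zr_eq {L : ℕ} [NeZero L] {κO κD : ℝ} (hO : 0 < κO) (hD : 0 < κD) (ω : Edge L → Bool) :
    zr κO κD ω = √((2 * π) ^ (L ^ 2 - 1) / (lapl (conduct κO κD ω)).det) := by
  rw [zr, ZL_eq_det (conduct_pos hO hD ω), ENNReal.toReal_ofReal (Real.sqrt_nonneg _),
    card_ne_zero_torus]

theorem zr_pos {L : ℕ} [NeZero L] {κO κD : ℝ} (hO : 0 < κO) (hD : 0 < κD) (ω : Edge L → Bool) :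
    0 < zr κO κD ω := by
  rw [zr_eq hO hD]
  have := (lapl_posDef (conduct_pos hO hD ω)).det_pos
  positivity

theorem ofReal_zr {L : ℕ} [NeZero L] {κO κD : ℝ} (hO : 0 < κO) (hD : 0 < κD) (ω : Edge L → Bool) :
    ENNReal.ofReal (zr κO κD ω) = ZL L (conduct κO κD ω) := by
  rw [zr, ENNReal.ofReal_toReal]
  rw [ZL_eq_det (conduct_pos hO hD ω)]
  exact ENNReal.ofReal_ne_top

/-- The dual configuration. -/
def dualCfg {L : ℕ} (ω : Edge L → Bool) : Edge L → Bool := fun e => !ω ((dualEdge L).symm e)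

theorem dualCfg_bijective {L : ℕ} : Function.Bijective (dualCfg (L := L)) := by
  refine ⟨fun ω ω' h => ?_, fun ω => ⟨fun e => !ω (dualEdge L e), ?_⟩⟩
  · funext e
    have := congrFun h (dualEdge L e)
    simpa [dualCfg] using this
  · funext e
    simp [dualCfg]

theorem ones_dualCfg {L : ℕ} [NeZero L] (ω : Edge L → Bool) : ones (dualCfg ω) = zeros ω := by
  unfold ones zeros dualCfg
  rw [← Finset.card_map (s := Finset.univ.filter fun e => ω e = false) (dualEdge L).toEmbedding]
  congr 1
  ext e
  simp only [Finset.mem_filter, Finset.mem_univ, true_and, Finset.mem_map_equiv, Bool.not_eq_true']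

theorem lapl_smul {L : ℕ} [NeZero L] (c : ℝ) (κ : Edge L → ℝ) : lapl (c • κ) = c • lapl κ := by
  unfold lapl
  rw [Matrix.diagonal_smul, Matrix.mul_smul, Matrix.smul_mul]

theorem weight_dualCfg_le {L : ℕ} [NeZero L] {κD u : ℝ} (hD : 0 < κD) (hu : 1 ≤ u)
    (ω : Edge L → Bool) :
    u ^ ones (dualCfg ω) * zr (u ^ 4 * κD) κD (dualCfg ω) ≤
      u ^ 2 * (u ^ ones ω * zr (u ^ 4 * κD) κD ω) := by
  have hu0 : 0 < u := by linarith
  set κO := u ^ 4 * κD with hκO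
  have hO : 0 < κO := by positivity
  have hle : ∀ e, κD ≤ conduct κO κD ω e := by
    intro e
    unfold conduct
    split_ifs
    · have := one_le_pow₀ hu (n := 4)
      nlinarith
    · exact le_rfl
  have h1 := det_lapl_le hD hle
  have hdual : (conduct κO κD ω)⁻¹ ∘ (dualEdge L).symm = (κO * κD)⁻¹ • conduct κO κD (dualCfg ω) := by
    funext e
    simp only [Function.comp, Pi.inv_apply, conduct, dualCfg, Pi.smul_apply, smul_eq_mul]
    rcases Bool.eq_false_or_eq_true (ω ((dualEdge L).symm e)) with h | h <;> simp only [h] <;> simp <;>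
      field_simp
  have hprod : ∏ e, conduct κO κD ω e = κO ^ ones ω * κD ^ zeros ω := prod_ite_eq_pow _ _ _
  rw [hdual, lapl_smul, Matrix.det_smul, hprod, card_ne_zero_torus] at h1
  have hon := ones_add_zeros ω
  rw [ones_dualCfg]
  have d1 := (lapl_posDef (conduct_pos hO hD ω)).det_pos
  have d2 := (lapl_posDef (conduct_pos hO hD (dualCfg ω))).det_pos
  have hLp : 0 < L ^ 2 := pow_pos (NeZero.pos L) 2
  obtain ⟨m, hm⟩ : ∃ m, L ^ 2 = m + 1 := ⟨L ^ 2 - 1, by omega⟩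
  rw [zr_eq hO hD, zr_eq hO hD]
  rw [hm] at hon h1 ⊢
  simp only [Nat.add_sub_cancel] at h1 ⊢
  set D1 := (lapl (conduct κO κD ω)).det
  set D2 := (lapl (conduct κO κD (dualCfg ω))).det
  set o := ones ω
  set z := zeros ω
  have h2 : D1 * u ^ (4 * m) ≤ u ^ (4 * o) * D2 := by
    have e1 : κO ^ o * κD ^ z = u ^ (4 * o) * κD ^ (2 * m + 2) := by
      rw [show 2 * m + 2 = o + z by omega, hκO, mul_pow, ← pow_mul, pow_add]; ring
    have e2 : (κO * κD)⁻¹ ^ m = (u ^ (4 * m))⁻¹ * (κD ^ (2 * m))⁻¹ := by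
      rw [hκO, inv_pow, ← mul_inv]
      congr 1
      rw [pow_mul u, pow_mul κD, ← mul_pow]; ring
    rw [e1, e2] at h1
    calc D1 * u ^ (4 * m) ≤ _ := mul_le_mul_of_nonneg_right h1 (by positivity)
      _ = _ := by field_simp; ring
  refine (sq_le_sq₀ (by positivity) (by positivity)).1 ?_
  have q1 : √((2 * π) ^ m / D1) ^ 2 = (2 * π) ^ m / D1 := Real.sq_sqrt (by positivity)
  have q2 : √((2 * π) ^ m / D2) ^ 2 = (2 * π) ^ m / D2 := Real.sq_sqrt (by positivity)
  rw [mul_pow (u ^ z), mul_pow (u ^ 2), mul_pow (u ^ o), q1, q2]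
  have h3 : u ^ (2 * z) / D2 ≤ u ^ (4 + 2 * o) / D1 := by
    rw [div_le_div_iff₀ d2 d1]
    have h4 : u ^ (4 * m) * (u ^ (2 * z) * D1) ≤ u ^ (4 * m) * (u ^ (4 + 2 * o) * D2) := by
      have e1 : u ^ (4 * m) * (u ^ (4 + 2 * o) * D2) = u ^ (2 * z) * (u ^ (4 * o) * D2) := by
        rw [← mul_assoc, ← mul_assoc, ← pow_add, ← pow_add]
        congr 2; omega
      rw [e1]
      calc _ = u ^ (2 * z) * (D1 * u ^ (4 * m)) := by ring
        _ ≤ _ := by gcongr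
    exact le_of_mul_le_mul_left h4 (by positivity)
  calc (u ^ z) ^ 2 * ((2 * π) ^ m / D2) = (2 * π) ^ m * (u ^ (2 * z) / D2) := by
        rw [← pow_mul, mul_comm z]; ring
    _ ≤ (2 * π) ^ m * (u ^ (4 + 2 * o) / D1) := by gcongr
    _ = _ := by rw [pow_add, ← pow_mul u o, mul_comm o]; ring

/-- Reflection of vertices in the lattice line at `a`. -/
def vertRefl {L : ℕ} (d : Bool) (a : ZMod L) (x : Torus L) : Torus L := faceRefl d a x + estep L d

/-- Reflection of edges in the lattice line at `a`. -/
def edgeRefl {L : ℕ} (d : Bool) (a : ZMod L) (e : Edge L) : Edge L :=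
  (if e.2 = d then faceRefl d a e.1 else vertRefl d a e.1, e.2)

/-- Reflection of vertices and edges in the lattice line at `a`. -/
def idxRefl {L : ℕ} (d : Bool) (a : ZMod L) : Torus L ⊕ Edge L → Torus L ⊕ Edge L :=
  Sum.map (vertRefl d a) (edgeRefl d a)

/-- The four edges around a face. -/
def faceEdge {L : ℕ} (x : Torus L) (j : Bool × Bool) : Edge L :=
  (if j.2 then x + estep L (!j.1) else x, j.1)

theorem vertRefl_invol {L : ℕ} (d : Bool) (a : ZMod L) (x : Torus L) :
    vertRefl d a (vertRefl d a x) = x := by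
  cases d <;> ext <;> simp [vertRefl, faceRefl, estep] <;> ring

theorem edgeRefl_invol {L : ℕ} (d : Bool) (a : ZMod L) (e : Edge L) :
    edgeRefl d a (edgeRefl d a e) = e := by
  obtain ⟨x, b⟩ := e
  by_cases h : b = d <;> simp [edgeRefl, h, vertRefl_invol, faceRefl_invol]

theorem idxRefl_invol {L : ℕ} (d : Bool) (a : ZMod L) : Function.Involutive (idxRefl (L := L) d a) := by
  rintro (x | e) <;> simp [idxRefl, vertRefl_invol, edgeRefl_invol]

theorem etarget_edgeRefl {L : ℕ} (d : Bool) (a : ZMod L) (e : Edge L) :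
    etarget (edgeRefl d a e) = if e.2 = d then vertRefl d a e.1 else vertRefl d a (etarget e) := by
  obtain ⟨x, b⟩ := e
  cases d <;> cases b <;> simp [edgeRefl, vertRefl, faceRefl, estep, etarget]

theorem vertRefl_etarget {L : ℕ} (d : Bool) (a : ZMod L) (e : Edge L) (h : e.2 = d) :
    vertRefl d a (etarget e) = (edgeRefl d a e).1 := by
  obtain ⟨x, b⟩ := e
  subst h
  cases b <;> simp [edgeRefl, vertRefl, faceRefl, estep, etarget] <;> ring

theorem sq_grad_refl {L : ℕ} (d : Bool) (a : ZMod L) (φ : Torus L → ℝ) (e : Edge L) :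
    grad (φ ∘ vertRefl d a) e ^ 2 = grad φ (edgeRefl d a e) ^ 2 := by
  unfold grad
  rw [etarget_edgeRefl]
  by_cases h : e.2 = d
  · rw [if_pos h, Function.comp, Function.comp, vertRefl_etarget d a e h]; ring
  · rw [if_neg h]; simp [edgeRefl, h]

theorem edgeRefl_faceEdge {L : ℕ} (d : Bool) (a : ZMod L) (x : Torus L) (j : Bool × Bool) :
    edgeRefl d a (faceEdge x j) =
      faceEdge (faceRefl d a x) (j.1, if j.1 = d then j.2 else !j.2) := by
  obtain ⟨b, c⟩ := j
  cases d <;> cases b <;> cases c <;>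
    simp [edgeRefl, vertRefl, faceRefl, estep, faceEdge] <;> ring

theorem val_neg_one_sub {L : ℕ} [NeZero L] (w : ZMod L) : (-1 - w).val = L - 1 - w.val := by
  have := ZMod.val_lt w
  have h1 : -1 - w = ((L - 1 - w.val : ℕ) : ZMod L) := by
    rw [Nat.cast_sub (by omega), Nat.cast_sub (by omega), ZMod.natCast_zmod_val]
    simp
  rw [h1, ZMod.val_natCast, Nat.mod_eq_of_lt (by omega)]

theorem val_add_one_of_lt {L : ℕ} [NeZero L] {w : ZMod L} (h : w.val + 1 < L) :
    (w + 1).val = w.val + 1 := by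
  have h1 : w + 1 = ((w.val + 1 : ℕ) : ZMod L) := by
    push_cast; rw [ZMod.natCast_zmod_val]
  rw [h1, ZMod.val_natCast, Nat.mod_eq_of_lt h]

/-- Position of a vertex or face relative to the line at `a`. -/
def posn {L : ℕ} (d : Bool) (a : ZMod L) (x : Torus L) : ℕ := (faceCoord d x - a).val

theorem posn_lt {L : ℕ} [NeZero L] (d : Bool) (a : ZMod L) (x : Torus L) : posn d a x < L :=
  ZMod.val_lt _

theorem posn_faceRefl {L : ℕ} [NeZero L] (d : Bool) (a : ZMod L) (x : Torus L) :
    posn d a (faceRefl d a x) = L - 1 - posn d a x := by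
  unfold posn
  rw [← val_neg_one_sub]
  congr 1
  cases d <;> simp [faceCoord, faceRefl] <;> ring

theorem posn_vertRefl {L : ℕ} [NeZero L] (d : Bool) (a : ZMod L) (x : Torus L) :
    posn d a (vertRefl d a x) = if posn d a x = 0 then 0 else L - posn d a x := by
  have : faceCoord d (vertRefl d a x) - a = -(faceCoord d x - a) := by
    cases d <;> simp [faceCoord, vertRefl, faceRefl, estep] <;> ring
  unfold posn
  rw [this, ZMod.neg_val]
  simp [ZMod.val_eq_zero]

theorem posn_add_estep {L : ℕ} [NeZero L] (d b : Bool) (a : ZMod L) (x : Torus L)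
    (h : posn d a x + 1 < L) :
    posn d a (x + estep L b) = if b = d then posn d a x + 1 else posn d a x := by
  unfold posn at *
  rw [← val_add_one_of_lt h]
  cases d <;> cases b <;> simp [faceCoord, estep] <;> congr 1 <;> ring

theorem vertRefl_eq_self {L : ℕ} [NeZero L] {n : ℕ} (hL : L = 2 * n) {d : Bool} {a : ZMod L}
    {x : Torus L} (h : posn d a x = 0 ∨ posn d a x = n) : vertRefl d a x = x := by
  have h2 : 2 * (faceCoord d x - a) = 0 := by
    rw [← ZMod.natCast_zmod_val (faceCoord d x - a)]
    change 2 * ((posn d a x : ℕ) : ZMod L) = 0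
    rcases h with h | h <;> rw [h]
    · simp
    · rw [show (2 : ZMod L) * (n : ZMod L) = ((2 * n : ℕ) : ZMod L) by push_cast; rfl, ← hL]; simp
  have h3 : 2 * a - faceCoord d x = faceCoord d x := by linear_combination -h2
  cases d <;> ext <;> simp [faceCoord, vertRefl, faceRefl, estep] at h3 ⊢ <;> linear_combination h3

/-- The indices strictly on the right of the line at `a`. -/
def RightSide {L : ℕ} (n : ℕ) (d : Bool) (a : ZMod L) : Torus L ⊕ Edge L → Prop
  | .inl x => 0 < posn d a x ∧ posn d a x < n
  | .inr e => (e.2 = d ∨ 0 < posn d a e.1) ∧ posn d a e.1 < n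

theorem not_rightSide_refl {L : ℕ} [NeZero L] {n : ℕ} (hL : L = 2 * n) {d : Bool} {a : ZMod L}
    {i : Torus L ⊕ Edge L} (h : RightSide n d a i) : ¬ RightSide n d a (idxRefl d a i) := by
  rcases i with x | e
  · have := posn_lt d a x
    simp only [RightSide, idxRefl, Sum.map_inl, posn_vertRefl] at h ⊢
    split_ifs <;> omega
  · have := posn_lt d a e.1
    simp only [RightSide, idxRefl, Sum.map_inr, edgeRefl] at h ⊢
    by_cases hd : e.2 = d
    · simp only [hd, if_true, posn_faceRefl]; omega
    · simp only [hd, if_false, posn_vertRefl, false_or] at h ⊢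
      split_ifs <;> omega

theorem idxRefl_eq_self {L : ℕ} [NeZero L] {n : ℕ} (hL : L = 2 * n) {d : Bool} {a : ZMod L}
    {i : Torus L ⊕ Edge L} (h : ¬ RightSide n d a i) (h' : ¬ RightSide n d a (idxRefl d a i)) :
    idxRefl d a i = i := by
  rcases i with x | e
  · have := posn_lt d a x
    simp only [RightSide, idxRefl, Sum.map_inl, posn_vertRefl] at h h' ⊢
    rw [vertRefl_eq_self hL]
    split_ifs at h' <;> omega
  · have := posn_lt d a e.1
    simp only [RightSide, idxRefl, Sum.map_inr, edgeRefl] at h h' ⊢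
    by_cases hd : e.2 = d
    · simp only [hd, if_true, posn_faceRefl, true_or, true_and] at h h'; omega
    · simp only [hd, if_false, posn_vertRefl, false_or] at h h' ⊢
      rw [vertRefl_eq_self hL]
      split_ifs at h' <;>
        omega

theorem prod_eq_mid_mul_right {α M : Type*} [Fintype α] [CommMonoid M] {θ : α → α}
    (hθ : Function.Involutive θ) (R : α → Prop) [DecidablePred R] (hR : ∀ x, R x → ¬ R (θ x))
    (g : α → M) :
    ∏ x, g x = (∏ x with ¬ R x ∧ ¬ R (θ x), g x) * ((∏ x with R x, g x) * ∏ x with R x, g (θ x)) := by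
  have h1 : ∏ x with R x, g (θ x) = ∏ x with R (θ x), g x := by
    refine Finset.prod_nbij' θ θ ?_ ?_ (fun x _ => hθ x) (fun x _ => hθ x) (fun _ _ => rfl)
    · intro x hx; simpa [hθ x] using hx
    · intro x hx; simpa using hx
  rw [h1, ← Finset.prod_filter_mul_prod_filter_not Finset.univ R,
    ← Finset.prod_filter_mul_prod_filter_not (Finset.univ.filter fun x => ¬ R x) (fun x => R (θ x)),
    Finset.filter_filter, Finset.filter_filter]
  have h2 : (Finset.univ.filter fun x => ¬ R x ∧ R (θ x)) = Finset.univ.filter fun x => R (θ x) := by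
    ext x
    simp only [Finset.mem_filter, Finset.mem_univ, true_and, and_iff_right_iff_imp]
    intro h h'; exact hR x h' h
  rw [h2, ← mul_assoc, mul_comm]

/-- Gaussian factor of an edge, as a function of heights and conductances. -/
def edgeFactor {L : ℕ} (e : Edge L) (x : Torus L ⊕ Edge L → ℝ) : ℝ≥0∞ :=
  ENNReal.ofReal (Real.exp (-(1 / 2 * (x (.inr e) * grad (fun v => x (.inl v)) e ^ 2))))

/-- The four conductances around a face are not all equal. -/
def MixedFace {L : ℕ} {α : Type*} (κ : Edge L → α) (f : Torus L) : Prop :=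
  ¬ ∀ j j', κ (faceEdge f j) = κ (faceEdge f j')

open scoped Classical in
/-- Indicator of a mixed face. -/
def mixedInd {L : ℕ} {α : Type*} (f : Torus L) (κ : Edge L → α) : ℝ≥0∞ :=
  if MixedFace κ f then 1 else 0

/-- Indicator that the height at `y` lies in the unit interval. -/
def pinInd {L : ℕ} (y : Torus L) (x : Torus L ⊕ Edge L → ℝ) : ℝ≥0∞ :=
  (Set.Icc (0 : ℝ) 1).indicator 1 (x (.inl y))

theorem measurable_edgeFactor {L : ℕ} (e : Edge L) : Measurable (edgeFactor e) := by
  unfold edgeFactor grad; fun_prop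

theorem measurableSet_mixedFace {L : ℕ} (f : Torus L) :
    MeasurableSet {κ : Edge L → ℝ | MixedFace κ f} := by
  have : {κ : Edge L → ℝ | MixedFace κ f} =
      (⋂ j, ⋂ j', {κ | κ (faceEdge f j) = κ (faceEdge f j')})ᶜ := by
    ext κ
    simp only [MixedFace, Set.mem_compl_iff, Set.mem_iInter, Set.mem_ofPred_eq]
  rw [this]
  refine (MeasurableSet.iInter fun j => MeasurableSet.iInter fun j' => ?_).compl
  exact measurableSet_eq_fun (measurable_pi_apply _) (measurable_pi_apply _)

theorem measurable_mixedInd {L : ℕ} (f : Torus L) : Measurable (mixedInd (α := ℝ) f) := by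
  classical
  unfold mixedInd
  exact Measurable.ite (measurableSet_mixedFace f) measurable_const measurable_const

theorem measurable_mixedInd_inr {L : ℕ} (f : Torus L) :
    Measurable fun x : Torus L ⊕ Edge L → ℝ => mixedInd f fun e => x (.inr e) :=
  (measurable_mixedInd f).comp (measurable_pi_lambda _ fun _ => measurable_pi_apply _)

theorem measurable_pinInd {L : ℕ} (y : Torus L) : Measurable (pinInd y) :=
  (measurable_one.indicator measurableSet_Icc).comp (measurable_pi_apply _)

theorem edgeFactor_refl {L : ℕ} (d : Bool) (a : ZMod L) (e : Edge L) (x : Torus L ⊕ Edge L → ℝ) :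
    edgeFactor e (x ∘ idxRefl d a) = edgeFactor (edgeRefl d a e) x := by
  unfold edgeFactor
  rw [← sq_grad_refl]
  rfl

theorem mixedFace_refl {L : ℕ} {α : Type*} (d : Bool) (a : ZMod L) (f : Torus L) (κ : Edge L → α) :
    MixedFace (κ ∘ edgeRefl d a) f ↔ MixedFace κ (faceRefl d a f) := by
  unfold MixedFace
  simp only [Function.comp, edgeRefl_faceEdge]
  rw [not_iff_not]
  let t : Bool × Bool → Bool × Bool := fun j => (j.1, if j.1 = d then j.2 else !j.2)
  have ht : ∀ j, t (t j) = j := by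
    rintro ⟨b, c⟩; cases d <;> cases b <;> simp [t]
  refine ⟨fun h j j' => ?_, fun h j j' => h (t j) (t j')⟩
  have := h (t j) (t j')
  change κ (faceEdge _ (t (t j))) = κ (faceEdge _ (t (t j'))) at this
  rwa [ht, ht] at this

theorem mixedInd_refl {L : ℕ} {α : Type*} (d : Bool) (a : ZMod L) (f : Torus L) (κ : Edge L → α) :
    mixedInd f (κ ∘ edgeRefl d a) = mixedInd (faceRefl d a f) κ := by
  unfold mixedInd; rw [mixedFace_refl]

open scoped Classical in
/-- The factors living on the right half. -/
def rightFactor {L : ℕ} [NeZero L] (n : ℕ) (d : Bool) (a : ZMod L) (S : Set (Torus L))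
    (x : Torus L ⊕ Edge L → ℝ) : ℝ≥0∞ :=
  (∏ e : Edge L with RightSide n d a (.inr e), edgeFactor e x) *
    ∏ f : Torus L with posn d a f < n, if f ∈ S then mixedInd f (fun e => x (.inr e)) else 1

open scoped Classical in
/-- The factors living on the reflecting lines. -/
def midFactor {L : ℕ} [NeZero L] (n : ℕ) (d : Bool) (a : ZMod L)
    (x : Torus L ⊕ Edge L → ℝ) : ℝ≥0∞ :=
  pinInd (a, a) x *
    ∏ e : Edge L with ¬ RightSide n d a (.inr e) ∧ ¬ RightSide n d a (.inr (edgeRefl d a e)),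
      edgeFactor e x

open scoped Classical in
/-- The full integrand with the faces of `S` mixed. -/
def fullFactor {L : ℕ} [NeZero L] (y : Torus L) (S : Set (Torus L))
    (x : Torus L ⊕ Edge L → ℝ) : ℝ≥0∞ :=
  pinInd y x * ((∏ e : Edge L, edgeFactor e x) *
    ∏ f : Torus L, if f ∈ S then mixedInd f (fun e => x (.inr e)) else 1)

theorem fullFactor_eq {L : ℕ} [NeZero L] {n : ℕ} (hL : L = 2 * n) (d : Bool) (a : ZMod L)
    (S : Set (Torus L)) (x : Torus L ⊕ Edge L → ℝ) :
    fullFactor (a, a) S x = midFactor n d a x *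
      (rightFactor n d a S x * rightFactor n d a (faceRefl d a ⁻¹' S) (x ∘ idxRefl d a)) := by
  classical
  unfold fullFactor midFactor rightFactor
  have h1 := prod_eq_mid_mul_right (θ := edgeRefl (L := L) d a) (edgeRefl_invol d a)
    (fun e => RightSide n d a (.inr e)) (fun e h => not_rightSide_refl hL h) (fun e => edgeFactor e x)
  have h2 := prod_eq_mid_mul_right (θ := faceRefl (L := L) d a) (faceRefl_invol d a)
    (fun f => posn d a f < n) (fun f h => by
      rw [posn_faceRefl]; have := posn_lt d a f; omega)
    (fun f => if f ∈ S then mixedInd f (fun e => x (.inr e)) else 1)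
  rw [h1, h2]
  rw [Finset.prod_eq_one (s := Finset.univ.filter fun f : Torus L =>
    ¬ posn d a f < n ∧ ¬ posn d a (faceRefl d a f) < n)]
  · have h3 : ∀ f, mixedInd f (fun e => (x ∘ idxRefl d a) (.inr e)) =
        mixedInd (faceRefl d a f) (fun e => x (.inr e)) := fun f =>
      mixedInd_refl d a f fun e => x (.inr e)
    simp only [edgeFactor_refl, h3, Set.mem_preimage]
    ring
  · intro f hf
    simp only [Finset.mem_filter, Finset.mem_univ, true_and, posn_faceRefl] at hf
    have := posn_lt d a f
    omega

theorem rightFactor_congr {L : ℕ} [NeZero L] {n : ℕ} {d : Bool} {a : ZMod L}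
    {S T : Set (Torus L)} (h : ∀ f, posn d a f < n → (f ∈ S ↔ f ∈ T)) :
    rightFactor n d a S = rightFactor n d a T := by
  classical
  funext x
  unfold rightFactor
  congr 1
  refine Finset.prod_congr rfl fun f hf => ?_
  simp only [Finset.mem_filter, Finset.mem_univ, true_and] at hf
  simp only [h f hf]

theorem measurable_rightFactor {L : ℕ} [NeZero L] (n : ℕ) (d : Bool) (a : ZMod L)
    (S : Set (Torus L)) : Measurable (rightFactor n d a S) := by
  classical
  unfold rightFactor
  refine (Finset.measurable_prod _ fun e _ => measurable_edgeFactor e).mul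
    (Finset.measurable_prod _ fun f _ => ?_)
  split_ifs
  · exact measurable_mixedInd_inr f
  · exact measurable_const

theorem measurable_midFactor {L : ℕ} [NeZero L] (n : ℕ) (d : Bool) (a : ZMod L) :
    Measurable (midFactor n d a) := by
  classical
  unfold midFactor
  exact (measurable_pinInd _).mul (Finset.measurable_prod _ fun e _ => measurable_edgeFactor e)

theorem edgeFactor_congr {L : ℕ} {e : Edge L} {x y : Torus L ⊕ Edge L → ℝ}
    (h1 : x (.inr e) = y (.inr e)) (h2 : x (.inl e.1) = y (.inl e.1))
    (h3 : x (.inl (etarget e)) = y (.inl (etarget e))) : edgeFactor e x = edgeFactor e y := by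
  simp only [edgeFactor, grad, h1, h2, h3]

theorem mixedInd_congr {L : ℕ} {α : Type*} {f : Torus L} {κ κ' : Edge L → α}
    (h : ∀ j, κ (faceEdge f j) = κ' (faceEdge f j)) : mixedInd f κ = mixedInd f κ' := by
  have : MixedFace κ f ↔ MixedFace κ' f := by
    unfold MixedFace; simp only [h]
  unfold mixedInd
  by_cases hk : MixedFace κ f
  · rw [if_pos hk, if_pos (this.1 hk)]
  · rw [if_neg hk, if_neg fun h' => hk (this.2 h')]

theorem rightFactor_dependsOn {L : ℕ} [NeZero L] {n : ℕ} (hL : L = 2 * n) (d : Bool) (a : ZMod L)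
    (S : Set (Torus L)) :
    DependsOn (rightFactor n d a S) {i | ¬ RightSide n d a (idxRefl d a i)} := by
  classical
  have hLp := NeZero.pos L
  intro x y hxy
  have hv : ∀ v : Torus L, posn d a v ≤ n → x (.inl v) = y (.inl v) := by
    intro v hv
    refine hxy _ fun h => ?_
    have := posn_lt d a v
    simp only [RightSide, idxRefl, Sum.map_inl, posn_vertRefl] at h
    split_ifs at h <;> omega
  have he : ∀ e : Edge L, posn d a e.1 ≤ n → (e.2 = d → posn d a e.1 < n) →
      x (.inr e) = y (.inr e) := by
    intro e h1 h2
    refine hxy _ fun h => ?_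
    have := posn_lt d a e.1
    simp only [RightSide, idxRefl, Sum.map_inr, edgeRefl] at h
    by_cases hd : e.2 = d
    · have := h2 hd
      simp only [hd, if_true, posn_faceRefl, true_or, true_and] at h; omega
    · simp only [hd, if_false, posn_vertRefl, false_or] at h
      split_ifs at h <;> omega
  unfold rightFactor
  congr 1
  · refine Finset.prod_congr rfl fun e hm => ?_
    replace hm := (Finset.mem_filter.1 hm).2
    simp only [RightSide] at hm
    refine edgeFactor_congr (he e hm.2.le fun _ => hm.2) (hv _ hm.2.le) (hv _ ?_)
    rw [etarget, posn_add_estep d e.2 a e.1 (by omega)]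
    split_ifs <;> omega
  · refine Finset.prod_congr rfl fun f hm => ?_
    simp only [Finset.mem_filter, Finset.mem_univ, true_and] at hm
    split_ifs
    · refine mixedInd_congr fun j => ?_
      obtain ⟨b, c⟩ := j
      unfold faceEdge
      cases c
      · exact he _ (by simpa using hm.le) (by simpa using fun _ => hm)
      · have hp := posn_add_estep d (!b) a f (by omega)
        refine he _ ?_ ?_
        · change posn d a (f + estep L !b) ≤ n
          rw [hp]; split_ifs <;> omega
        · intro hb
          change posn d a (f + estep L !b) < n
          rw [hp, if_neg]
          · exact hm
          · rintro rfl; simp at hb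
    · rfl

theorem midFactor_dependsOn {L : ℕ} [NeZero L] {n : ℕ} (hL : L = 2 * n) (d : Bool) (a : ZMod L) :
    DependsOn (midFactor n d a)
      {i | ¬ RightSide n d a i ∧ ¬ RightSide n d a (idxRefl d a i)} := by
  classical
  have hLp := NeZero.pos L
  intro x y hxy
  have hv : ∀ v : Torus L, (posn d a v = 0 ∨ posn d a v = n) → x (.inl v) = y (.inl v) := by
    intro v hv
    refine hxy _ ⟨fun h => ?_, fun h => ?_⟩
    · simp only [RightSide] at h; omega
    · simp only [RightSide, idxRefl, Sum.map_inl, posn_vertRefl] at h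
      split_ifs at h <;> omega
  unfold midFactor
  congr 1
  · unfold pinInd
    rw [hv]
    left
    cases d <;> simp [posn, faceCoord]
  · refine Finset.prod_congr rfl fun e hm => ?_
    simp only [Finset.mem_filter, Finset.mem_univ, true_and] at hm
    have hp : e.2 ≠ d ∧ (posn d a e.1 = 0 ∨ posn d a e.1 = n) := by
      have := posn_lt d a e.1
      simp only [RightSide, edgeRefl] at hm
      by_cases hd : e.2 = d
      · simp only [hd, if_true, posn_faceRefl, true_or, true_and] at hm; omega
      · simp only [hd, if_false, posn_vertRefl, false_or] at hm
        refine ⟨hd, ?_⟩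
        split_ifs at hm <;> omega
    refine edgeFactor_congr (hxy _ hm) (hv _ hp.2) (hv _ ?_)
    by_cases h1 : posn d a e.1 + 1 < L
    · rw [etarget, posn_add_estep d e.2 a e.1 h1, if_neg hp.1]; exact hp.2
    · obtain ⟨⟨v, b⟩, hb⟩ : ∃ e' : Edge L, e' = e := ⟨e, rfl⟩
      subst hb
      have : posn d a (etarget (v, b)) = posn d a v := by
        have := hp.1
        cases d <;> cases b <;> simp [etarget, posn, faceCoord, estep] at this ⊢
      rw [this]; exact hp.2

/-- Reference measure on heights and conductances. -/
def idxMeasure {L : ℕ} (ρ : Measure ℝ) : Torus L ⊕ Edge L → Measure ℝ :=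
  Sum.elim (fun _ => volume) fun _ => ρ

instance {L : ℕ} (ρ : Measure ℝ) [IsFiniteMeasure ρ] (i : Torus L ⊕ Edge L) :
    SigmaFinite (idxMeasure ρ i) := by
  rcases i with i | i
  · exact inferInstanceAs (SigmaFinite (volume : Measure ℝ))
  · exact inferInstanceAs (SigmaFinite ρ)

open scoped Classical in
/-- Total weight of conductances for which every face of `S` is mixed. -/
def mixedWeight (L : ℕ) [NeZero L] (ρ : Measure ℝ) (S : Set (Torus L)) : ℝ≥0∞ :=
  ∫⁻ κ, (∏ f : Torus L, if f ∈ S then mixedInd f κ else 1) * ZL L κ ∂rhoL L ρ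

theorem bweight_eq_prod {L : ℕ} [NeZero L] (κ η : Edge L → ℝ) :
    bweight L κ η = ∏ e, ENNReal.ofReal (Real.exp (-(1 / 2 * (κ e * η e ^ 2)))) := by
  unfold bweight energy
  rw [← ENNReal.ofReal_prod_of_nonneg fun _ _ => (Real.exp_pos _).le, ← Real.exp_sum,
    Finset.sum_neg_distrib, Finset.mul_sum]

theorem measurable_fullFactor {L : ℕ} [NeZero L] (y : Torus L) (S : Set (Torus L)) :
    Measurable (fullFactor y S) := by
  classical
  unfold fullFactor
  refine (measurable_pinInd y).mul ((Finset.measurable_prod _ fun e _ => measurable_edgeFactor e).mul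
    (Finset.measurable_prod _ fun f _ => ?_))
  split_ifs
  · exact measurable_mixedInd_inr f
  · exact measurable_const

theorem lintegral_fullFactor {L : ℕ} [NeZero L] (ρ : Measure ℝ) [IsFiniteMeasure ρ] (y : Torus L)
    (S : Set (Torus L)) :
    ∫⁻ x, fullFactor y S x ∂Measure.pi (idxMeasure ρ) = mixedWeight L ρ S := by
  classical
  have hp := measurePreserving_sumPiEquivProdPi_symm (X := fun _ : Torus L ⊕ Edge L => ℝ) (idxMeasure ρ)
  rw [← hp.lintegral_comp (measurable_fullFactor y S), lintegral_prod_symm]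
  · unfold mixedWeight rhoL
    refine lintegral_congr fun κ => ?_
    rw [← lintegral_pinned_bweight κ y, ← lintegral_const_mul]
    · refine lintegral_congr fun φ => ?_
      rw [bweight_eq_prod]
      change pinInd y (Sum.elim φ κ) * ((∏ e, edgeFactor e (Sum.elim φ κ)) * _) = _
      rw [mul_comm (∏ e, edgeFactor e (Sum.elim φ κ)), ← mul_assoc, mul_comm (pinInd _ _), mul_assoc]
      rfl
    · exact ((measurable_one.indicator measurableSet_Icc).comp (measurable_pi_apply y)).mul
        ((measurable_bweight _).comp measurable_grad)
  · exact ((measurable_fullFactor y S).comp (MeasurableEquiv.measurable _)).aemeasurable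

theorem mixedWeight_sq_le {L : ℕ} [NeZero L] {n : ℕ} (hL : L = 2 * n) (ρ : Measure ℝ)
    [IsFiniteMeasure ρ] (d : Bool) (a : ZMod L) (S : Set (Torus L)) :
    mixedWeight L ρ S ^ 2 ≤
      mixedWeight L ρ (symmetrize n d true a S) * mixedWeight L ρ (symmetrize n d false a S) := by
  classical
  have hLp := NeZero.pos L
  let A : Finset (Torus L ⊕ Edge L) := Finset.univ.filter fun i => RightSide n d a i
  have hA : ∀ i, i ∈ A ↔ RightSide n d a i := fun i => by simp [A]
  have hA' : ∀ i, i ∈ A.image (idxRefl d a) ↔ RightSide n d a (idxRefl d a i) := by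
    intro i
    rw [Finset.mem_image]
    constructor
    · rintro ⟨j, hj, rfl⟩; rw [idxRefl_invol d a]; exact (hA j).1 hj
    · intro h; exact ⟨_, (hA _).2 h, idxRefl_invol d a i⟩
  have key := reflection_cauchy_schwarz (idxMeasure ρ) (idxRefl d a) (idxRefl_invol d a)
    (by rintro (i | i) <;> rfl) A
    (fun i hi h => not_rightSide_refl hL ((hA i).1 hi) ((hA _).1 h))
    (fun i h h' => idxRefl_eq_self hL (fun h1 => h ((hA i).2 h1)) (fun h1 => h' ((hA' i).2 h1)))
    (measurable_midFactor n d a) (measurable_rightFactor n d a S)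
    (measurable_rightFactor n d a (faceRefl d a ⁻¹' S))
    (by
      convert midFactor_dependsOn hL d a using 1
      ext i
      simp only [Set.mem_compl_iff, Finset.mem_coe, Finset.mem_union, hA, hA', not_or]
      rfl)
    (by
      convert rightFactor_dependsOn hL d a S using 1
      ext i
      simp only [Set.mem_compl_iff, Finset.mem_coe, hA']
      rfl)
    (by
      convert rightFactor_dependsOn hL d a _ using 1
      ext i
      simp only [Set.mem_compl_iff, Finset.mem_coe, hA']
      rfl)
  have hface : ∀ f : Torus L, posn d a f < n → ¬ posn d a (faceRefl d a f) < n := by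
    intro f h
    have := posn_lt d a f
    rw [posn_faceRefl]; omega
  have r1 : rightFactor n d a (symmetrize n d true a S) = rightFactor n d a S :=
    rightFactor_congr fun f hf => by
      change (if (posn d a f < n ↔ true = true) then _ else _) ↔ _
      simp [hf]
  have r2 : rightFactor n d a (faceRefl d a ⁻¹' symmetrize n d true a S) = rightFactor n d a S :=
    rightFactor_congr fun f hf => by
      change (if (posn d a (faceRefl d a f) < n ↔ true = true) then _ else _) ↔ _
      simp [hface f hf, faceRefl_invol]
  have r3 : rightFactor n d a (symmetrize n d false a S) = rightFactor n d a (faceRefl d a ⁻¹' S) :=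
    rightFactor_congr fun f hf => by
      change (if (posn d a f < n ↔ false = true) then _ else _) ↔ _
      simp [hf]
  have r4 : rightFactor n d a (faceRefl d a ⁻¹' symmetrize n d false a S) =
      rightFactor n d a (faceRefl d a ⁻¹' S) :=
    rightFactor_congr fun f hf => by
      change (if (posn d a (faceRefl d a f) < n ↔ false = true) then _ else _) ↔ _
      simp [hface f hf]
  simp only [← lintegral_fullFactor ρ (a, a), fullFactor_eq hL d a, r1, r2, r3, r4]
  exact key

theorem pi_add_smul_dirac {ι : Type*} [Fintype ι] [DecidableEq ι] (a b : ℝ≥0∞) (ha : a ≠ ∞)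
    (hb : b ≠ ∞) (x y : ℝ) :
    Measure.pi (fun _ : ι => a • Measure.dirac x + b • Measure.dirac y) =
      ∑ ω : ι → Bool, (∏ i, if ω i then a else b) •
        Measure.dirac fun i => if ω i then x else y := by
  classical
  have : IsFiniteMeasure (a • Measure.dirac x + b • Measure.dirac y) := by
    constructor
    simp only [Measure.add_apply, Measure.smul_apply, measure_univ, smul_eq_mul, mul_one]
    exact ENNReal.add_lt_top.2 ⟨ha.lt_top, hb.lt_top⟩
  refine (Measure.pi_eq fun s hs => ?_)
  have h1 : ∀ i, (a • Measure.dirac x + b • Measure.dirac y) (s i) =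
      ∑ c : Bool, (if c then a else b) * (s i).indicator 1 (if c then x else y) := by
    intro i
    simp [Measure.dirac_apply' _ (hs i)]
  simp only [h1]
  rw [Finset.prod_univ_sum, Measure.finsetSum_apply]
  simp only [Fintype.piFinset_univ]
  refine Finset.sum_congr rfl fun ω _ => ?_
  rw [Finset.prod_mul_distrib, Measure.smul_apply,
    Measure.dirac_apply' _ (MeasurableSet.univ_pi hs), smul_eq_mul]
  congr 1
  by_cases h : ∀ i, (if ω i then x else y) ∈ s i
  · rw [Set.indicator_of_mem (by simpa using h), Finset.prod_eq_one]
    · rfl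
    · intro i _; rw [Set.indicator_of_mem (h i)]; rfl
  · rw [Set.indicator_of_notMem (by simpa using h)]
    push Not at h
    obtain ⟨i, hi⟩ := h
    exact (Finset.prod_eq_zero (Finset.mem_univ i) (Set.indicator_of_notMem hi _)).symm

/-- A priori weight of a bond configuration. -/
def bondWeight {L : ℕ} [NeZero L] (p : ℝ) (ω : Edge L → Bool) : ℝ := p ^ ones ω * (1 - p) ^ zeros ω

theorem bondWeight_nonneg {L : ℕ} [NeZero L] {p : ℝ} (hp : p ∈ Set.Icc (0 : ℝ) 1)
    (ω : Edge L → Bool) : 0 ≤ bondWeight p ω :=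
  mul_nonneg (pow_nonneg hp.1 _) (pow_nonneg (by linarith [hp.2]) _)

instance isFiniteMeasure_rhoTwo (κO κD p : ℝ) : IsFiniteMeasure (rhoTwo κO κD p) := by
  constructor
  simp only [rhoTwo, Measure.add_apply, Measure.smul_apply, measure_univ, smul_eq_mul, mul_one]
  exact ENNReal.add_lt_top.2 ⟨ENNReal.ofReal_lt_top, ENNReal.ofReal_lt_top⟩

theorem lintegral_rhoL_rhoTwo {L : ℕ} [NeZero L] {κO κD p : ℝ} (hp : p ∈ Set.Icc (0 : ℝ) 1)
    (g : (Edge L → ℝ) → ℝ≥0∞) :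
    ∫⁻ κ, g κ ∂rhoL L (rhoTwo κO κD p) =
      ∑ ω : Edge L → Bool, ENNReal.ofReal (bondWeight p ω) * g (conduct κO κD ω) := by
  unfold rhoL rhoTwo
  rw [pi_add_smul_dirac _ _ ENNReal.ofReal_ne_top ENNReal.ofReal_ne_top, lintegral_finsetSum_measure]
  refine Finset.sum_congr rfl fun ω _ => ?_
  rw [lintegral_smul_measure, lintegral_dirac, smul_eq_mul, prod_ite_eq_pow, bondWeight,
    ENNReal.ofReal_mul (pow_nonneg hp.1 _), ENNReal.ofReal_pow hp.1,
    ENNReal.ofReal_pow (by linarith [hp.2])]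
  rfl

/-- Weight of a bond configuration. -/
def gw {L : ℕ} [NeZero L] (κO κD p : ℝ) (ω : Edge L → Bool) : ℝ := bondWeight p ω * zr κO κD ω

theorem gw_nonneg {L : ℕ} [NeZero L] {κO κD p : ℝ} (hp : p ∈ Set.Icc (0 : ℝ) 1)
    (ω : Edge L → Bool) : 0 ≤ gw κO κD p ω :=
  mul_nonneg (bondWeight_nonneg hp ω) ENNReal.toReal_nonneg

theorem gw_sum_pos {L : ℕ} [NeZero L] {κO κD p : ℝ} (hO : 0 < κO) (hD : 0 < κD)
    (hp : p ∈ Set.Icc (0 : ℝ) 1) : 0 < ∑ ω : Edge L → Bool, gw κO κD p ω := by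
  refine Finset.sum_pos' (fun ω _ => gw_nonneg hp ω) ?_
  rcases hp.1.eq_or_lt with h | h
  · refine ⟨fun _ => false, Finset.mem_univ _, mul_pos ?_ (zr_pos hO hD _)⟩
    simp [bondWeight, ← h, ones]
  · refine ⟨fun _ => true, Finset.mem_univ _, mul_pos ?_ (zr_pos hO hD _)⟩
    simp only [bondWeight, zeros]
    simp [h]

instance {L : ℕ} [NeZero L] : SFinite (nuL L) := by
  unfold nuL; infer_instance

theorem QL_apply {L : ℕ} [NeZero L] {κO κD p : ℝ} (hO : 0 < κO) (hD : 0 < κD)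
    (hp : p ∈ Set.Icc (0 : ℝ) 1) {A : Set (Edge L → ℝ)} (hA : MeasurableSet A)
    (P : (Edge L → Bool) → Prop) [DecidablePred P] (hP : ∀ ω, conduct κO κD ω ∈ A ↔ P ω) :
    QL L (rhoTwo κO κD p) {x | x.2 ∈ A} =
      ENNReal.ofReal ((∑ ω : Edge L → Bool with P ω, gw κO κD p ω) / ∑ ω : Edge L → Bool, gw κO κD p ω) := by
  have hm : Measurable fun x : (Edge L → ℝ) × (Edge L → ℝ) =>
      ENNReal.ofReal (Real.exp (-(energy L x.2 x.1))) := by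
    unfold energy; fun_prop
  have : SFinite (rhoL L (rhoTwo κO κD p)) := by unfold rhoL; infer_instance
  have hAm : MeasurableSet {x : (Edge L → ℝ) × (Edge L → ℝ) | x.2 ∈ A} := measurable_snd hA
  have hZ : ZLV L (rhoTwo κO κD p) = ENNReal.ofReal (∑ ω : Edge L → Bool, gw κO κD p ω) := by
    unfold ZLV
    rw [lintegral_prod_symm' _ hm, lintegral_rhoL_rhoTwo hp,
      ENNReal.ofReal_sum_of_nonneg fun ω _ => gw_nonneg hp ω]
    refine Finset.sum_congr rfl fun ω _ => ?_
    rw [gw, ENNReal.ofReal_mul (bondWeight_nonneg hp ω), ofReal_zr hO hD]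
    rfl
  unfold QL
  rw [Measure.smul_apply, withDensity_apply _ hAm, ← lintegral_indicator hAm,
    lintegral_prod_symm' _ (hm.indicator hAm), lintegral_rhoL_rhoTwo hp, hZ, smul_eq_mul,
    ENNReal.ofReal_div_of_pos (gw_sum_pos hO hD hp), mul_comm, div_eq_mul_inv,
    Finset.sum_filter, ENNReal.ofReal_sum_of_nonneg (s := Finset.univ) (f := fun ω => if P ω then gw κO κD p ω else 0)
      fun ω _ => by split_ifs; exacts [gw_nonneg hp ω, le_rfl]]
  refine congrArg (· * _) (Finset.sum_congr rfl fun ω _ => ?_)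
  split_ifs with h
  · rw [gw, ENNReal.ofReal_mul (bondWeight_nonneg hp ω), ofReal_zr hO hD]
    congr 1
    refine lintegral_congr fun η => ?_
    rw [Set.indicator_of_mem]
    exact (hP ω).2 h
  · rw [ENNReal.ofReal_zero]
    convert mul_zero _
    rw [← lintegral_zero (μ := nuL L)]
    refine lintegral_congr fun η => ?_
    rw [Set.indicator_of_notMem]
    exact fun h' => h ((hP ω).1 h')

theorem measurable_Rord (L : ℕ) [NeZero L] (κO : ℝ) : Measurable (Rord L κO) := by
  classical
  have : Rord L κO = fun κ => (∑ b : Edge L, if κ b = κO then (1 : ℝ) else 0) / (2 * (L : ℝ) ^ 2) := by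
    funext κ
    unfold Rord
    rw [Finset.sum_boole]
  rw [this]
  refine Measurable.div_const (Finset.measurable_sum _ fun b _ => Measurable.ite ?_ measurable_const
    measurable_const) _
  exact measurableSet_eq_fun (measurable_pi_apply b) measurable_const

theorem Rord_conduct {L : ℕ} [NeZero L] {κO κD : ℝ} (h : κD ≠ κO) (ω : Edge L → Bool) :
    Rord L κO (conduct κO κD ω) = ones ω / (2 * (L : ℝ) ^ 2) := by
  unfold Rord ones conduct
  congr 3
  ext b
  cases hb : ω b <;> simp [hb, h]

theorem mixedFace_conduct {L : ℕ} {κO κD : ℝ} (h : κD ≠ κO) (ω : Edge L → Bool) (f : Torus L) :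
    MixedFace (conduct κO κD ω) f ↔ MixedFace ω f := by
  unfold MixedFace conduct
  have : ∀ a b : Bool, ((if a then κO else κD) = if b then κO else κD) ↔ a = b := by
    intro a b; cases a <;> cases b <;> simp [h, h.symm]
  simp only [this]

open scoped Classical in
theorem mixedWeight_rhoTwo {L : ℕ} [NeZero L] {κO κD p : ℝ} (hO : 0 < κO) (hD : 0 < κD)
    (hne : κD ≠ κO) (hp : p ∈ Set.Icc (0 : ℝ) 1) (S : Set (Torus L)) :
    mixedWeight L (rhoTwo κO κD p) S =
      ENNReal.ofReal (∑ ω : Edge L → Bool with ∀ f ∈ S, MixedFace ω f, gw κO κD p ω) := by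
  unfold mixedWeight
  rw [lintegral_rhoL_rhoTwo hp, ENNReal.ofReal_sum_of_nonneg fun ω _ => gw_nonneg hp ω,
    Finset.sum_filter]
  refine Finset.sum_congr rfl fun ω _ => ?_
  split_ifs with h
  · rw [gw, ENNReal.ofReal_mul (bondWeight_nonneg hp ω), ofReal_zr hO hD, Finset.prod_eq_one,
      one_mul]
    intro f _
    split_ifs with hf
    · exact if_pos ((mixedFace_conduct hne ω f).2 (h f hf))
    · rfl
  · push Not at h
    obtain ⟨f, hf, hm⟩ := h
    rw [Finset.prod_eq_zero (Finset.mem_univ f), zero_mul, mul_zero]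
    rw [if_pos hf]
    exact if_neg fun hc => hm ((mixedFace_conduct hne ω f).1 hc)

/-- Weight of a bond configuration at the transition point, up to normalization. -/
def tw {L : ℕ} [NeZero L] (κD u : ℝ) (ω : Edge L → Bool) : ℝ := u ^ ones ω * zr (u ^ 4 * κD) κD ω

theorem tw_pos {L : ℕ} [NeZero L] {κD u : ℝ} (hD : 0 < κD) (hu : 0 < u) (ω : Edge L → Bool) :
    0 < tw κD u ω :=
  mul_pos (pow_pos hu _) (zr_pos (by positivity) hD ω)

/-- The two edges at `x` selected by the corner type `s`. -/
def cornerEdge {L : ℕ} (s : Bool → Bool) (x : Torus L) (d : Bool) : Edge L :=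
  if s d then inEdge d x else (x, d)

/-- Number of vertices at which the corner of type `s` is mixed. -/
def mixedCorners {L : ℕ} [NeZero L] (s : Bool → Bool) (ω : Edge L → Bool) : ℕ :=
  (Finset.univ.filter fun x => ω (cornerEdge s x true) ≠ ω (cornerEdge s x false)).card

theorem ones_eq_sum {L : ℕ} [NeZero L] (ω : Edge L → Bool) :
    ones ω = ∑ x : Torus L, ((ω (inEdge true x)).toNat + (ω (inEdge false x)).toNat) := by
  have h : ∀ b : Bool, b.toNat = if b = true then 1 else 0 := by decide
  unfold ones
  rw [Finset.card_filter, Fintype.sum_prod_type, Finset.sum_add_distrib]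
  simp only [Fintype.sum_bool, ← h]
  rw [Finset.sum_add_distrib]
  congr 1
  · exact (Equiv.sum_comp (Equiv.subRight (estep L true)) fun x => (ω (x, true)).toNat).symm
  · exact (Equiv.sum_comp (Equiv.subRight (estep L false)) fun x => (ω (x, false)).toNat).symm

theorem tw_mul_pow_le {L : ℕ} [NeZero L] {κD u : ℝ} (hD : 0 < κD) (hu : 1 ≤ u)
    (ω : Edge L → Bool) :
    tw κD u ω * u ^ mixedCorners (fun _ => true) ω ≤ √(2 * π / κD) ^ (L ^ 2 - 1) * u ^ (6 * L) := by
  have hu0 : 0 < u := by linarith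
  set κO := u ^ 4 * κD with hκO
  have hO : 0 < κO := by positivity
  let dd : Torus L → Bool := fun x =>
    if x.1 = 0 then false else if x.2 = 0 then true else ω (inEdge true x)
  have hdd : ∀ x : {x : Torus L // x ≠ 0}, faceCoord (dd x.1) x.1 ≠ 0 := by
    rintro ⟨⟨a, b⟩, hx⟩
    by_cases ha : a = 0 <;> by_cases hb : b = 0
    · exact absurd (by rw [ha, hb]; rfl) hx
    · simpa [dd, faceCoord, ha] using hb
    · simp [dd, faceCoord, ha, hb]
    · rcases Bool.eq_false_or_eq_true (ω (inEdge true (a, b))) with h | h <;>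
        simp [dd, faceCoord, ha, hb, h]
  let j : ℕ := ∑ x : {x : Torus L // x ≠ 0}, (ω (inEdge (dd x.1) x.1)).toNat
  have h1 := ZL_le_prod (conduct_pos hO hD ω) (fun x => dd x.1) hdd
  have hprod : ∏ x : {x : Torus L // x ≠ 0}, √(2 * π / conduct κO κD ω (inEdge (dd x.1) x.1)) =
      √(2 * π / κD) ^ (L ^ 2 - 1) * ((u ^ 2)⁻¹) ^ j := by
    have : ∀ e, √(2 * π / conduct κO κD ω e) = √(2 * π / κD) * (u ^ 2)⁻¹ ^ (ω e).toNat := by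
      intro e
      unfold conduct
      rcases Bool.eq_false_or_eq_true (ω e) with h | h
      · simp only [h, if_true, Bool.toNat_true, pow_one]
        rw [hκO, show 2 * π / (u ^ 4 * κD) = 2 * π / κD / (u ^ 2) ^ 2 by field_simp,
          Real.sqrt_div' _ (by positivity), Real.sqrt_sq (by positivity), div_eq_mul_inv]
      · simp [h]
    simp only [this]
    rw [Finset.prod_mul_distrib, Finset.prod_const, Finset.card_univ, card_ne_zero_torus,
      Finset.prod_pow_eq_pow_sum]
  rw [hprod, ← ofReal_zr hO hD, ENNReal.ofReal_le_ofReal_iff (by positivity)] at h1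
  have hcount : ones ω + mixedCorners (fun _ => true) ω ≤ 2 * j + 6 * L := by
    have hj : j = ∑ x : Torus L, if x ≠ 0 then (ω (inEdge (dd x) x)).toNat else 0 := by
      rw [← Finset.sum_filter, Finset.sum_subtype (p := fun x => x ≠ 0)]
      simp
    have hf : ∑ x : Torus L, (if x.1 = 0 then 1 else 0) = L := by
      rw [Fintype.sum_prod_type, Finset.sum_comm]; simp
    have hs : ∑ x : Torus L, (if x.2 = 0 then 1 else 0) = L := by
      rw [Fintype.sum_prod_type]; simp
    have hR : 2 * j + 6 * L = ∑ x : Torus L, (2 * (if x ≠ 0 then (ω (inEdge (dd x) x)).toNat else 0) +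
        3 * (if x.1 = 0 then 1 else 0) + 3 * (if x.2 = 0 then 1 else 0)) := by
      rw [Finset.sum_add_distrib, Finset.sum_add_distrib, ← Finset.mul_sum, ← Finset.mul_sum,
        ← Finset.mul_sum, hf, hs, ← hj]
      ring
    rw [hR, ones_eq_sum, mixedCorners, Finset.card_filter, ← Finset.sum_add_distrib]
    refine Finset.sum_le_sum fun x _ => ?_
    obtain ⟨a, b⟩ := x
    simp only [cornerEdge, if_true]
    by_cases ha : a = 0
    · cases ω (inEdge true (a, b)) <;> cases ω (inEdge false (a, b)) <;> simp [ha] <;> omega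
    · by_cases hb : b = 0
      · cases ω (inEdge true (a, b)) <;> cases ω (inEdge false (a, b)) <;> simp [hb]
      · have hx : (a, b) ≠ (0 : Torus L) := fun h => ha (congrArg Prod.fst h)
        rcases Bool.eq_false_or_eq_true (ω (inEdge true (a, b))) with h | h <;>
        rcases Bool.eq_false_or_eq_true (ω (inEdge false (a, b))) with h' | h' <;>
        simp [dd, ha, hb, hx, h, h']
  unfold tw
  calc u ^ ones ω * zr κO κD ω * u ^ mixedCorners (fun _ => true) ω
      = u ^ (ones ω + mixedCorners (fun _ => true) ω) * zr κO κD ω := by rw [pow_add]; ring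
    _ ≤ u ^ (2 * j + 6 * L) * (√(2 * π / κD) ^ (L ^ 2 - 1) * (u ^ 2)⁻¹ ^ j) := by
        refine mul_le_mul (pow_le_pow_right₀ hu hcount) h1 (zr_pos hO hD ω).le (by positivity)
    _ = _ := by
        rw [pow_add, inv_pow, ← pow_mul]; field_simp

theorem ones_comp_edgeRefl {L : ℕ} [NeZero L] (d : Bool) (a : ZMod L) (ω : Edge L → Bool) :
    ones (ω ∘ edgeRefl d a) = ones ω := by
  unfold ones
  refine Finset.card_nbij' (edgeRefl d a) (edgeRefl d a) ?_ ?_ (fun _ _ => edgeRefl_invol d a _)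
    fun _ _ => edgeRefl_invol d a _
  · intro e he; simpa using he
  · intro e he; simpa [edgeRefl_invol] using he

theorem tw_comp_edgeRefl {L : ℕ} [NeZero L] (κD u : ℝ) (d : Bool) (a : ZMod L)
    (ω : Edge L → Bool) : tw κD u (ω ∘ edgeRefl d a) = tw κD u ω := by
  unfold tw zr
  rw [ones_comp_edgeRefl]
  congr 2
  exact ZL_comp_equiv (Function.Involutive.toPerm _ (vertRefl_invol d a))
    (Function.Involutive.toPerm _ (edgeRefl_invol d a)) (sq_grad_refl d a) (conduct _ κD ω)

theorem edgeRefl_cornerEdge {L : ℕ} (d' : Bool) (a : ZMod L) (s : Bool → Bool) (x : Torus L)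
    (d : Bool) :
    edgeRefl d' a (cornerEdge s x d) =
      cornerEdge (Function.update s d' (!s d')) (vertRefl d' a x) d := by
  cases d <;> cases d' <;> cases h : s true <;> cases h' : s false <;> ext <;>
    simp [edgeRefl, cornerEdge, inEdge, vertRefl, faceRefl, estep, Function.update, h, h'] <;> ring

theorem mixedCorners_comp_edgeRefl {L : ℕ} [NeZero L] (d : Bool) (a : ZMod L) (s : Bool → Bool)
    (ω : Edge L → Bool) :
    mixedCorners s (ω ∘ edgeRefl d a) = mixedCorners (Function.update s d (!s d)) ω := by
  unfold mixedCorners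
  refine Finset.card_nbij' (vertRefl d a) (vertRefl d a) ?_ ?_ (fun _ _ => vertRefl_invol d a _)
    fun _ _ => vertRefl_invol d a _
  · intro x hx
    simpa [edgeRefl_cornerEdge] using hx
  · intro x hx
    simpa [edgeRefl_cornerEdge, vertRefl_invol] using hx

theorem exists_tw_eq {L : ℕ} [NeZero L] (κD u : ℝ) (s : Bool → Bool) (ω : Edge L → Bool) :
    ∃ ω' : Edge L → Bool, tw κD u ω' = tw κD u ω ∧
      mixedCorners (fun _ => true) ω' = mixedCorners s ω := by
  have step : ∀ (d : Bool) (ω : Edge L → Bool), ∃ ω' : Edge L → Bool, tw κD u ω' = tw κD u ω ∧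
      ∀ t : Bool → Bool, mixedCorners t ω' =
        mixedCorners (fun b => if b = d then (t b == s b) else t b) ω := by
    intro d ω
    cases hs : s d
    · refine ⟨ω ∘ edgeRefl d 0, tw_comp_edgeRefl _ _ _ _ _, fun t => ?_⟩
      rw [mixedCorners_comp_edgeRefl]
      congr 1
      funext b
      by_cases hb : b = d
      · subst hb; simp [hs]
      · simp [hb]
    · refine ⟨ω, rfl, fun t => ?_⟩
      congr 1
      funext b
      by_cases hb : b = d
      · subst hb; simp [hs]
      · simp [hb]
  obtain ⟨ω₁, h1, h1'⟩ := step true ω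
  obtain ⟨ω₂, h2, h2'⟩ := step false ω₁
  refine ⟨ω₂, h2.trans h1, ?_⟩
  rw [h2', h1']
  congr 1
  funext b
  cases b <;> simp

theorem exists_mixedCorners_ge {L : ℕ} [NeZero L] {ω : Edge L → Bool} (h : ∀ f, MixedFace ω f) :
    ∃ s, L ^ 2 ≤ 4 * mixedCorners s ω := by
  have hsum : L ^ 2 ≤ ∑ s : Bool → Bool, mixedCorners s ω := by
    have hc : Fintype.card (Torus L) = L ^ 2 := by simp [sq]
    have hsh : ∀ s, mixedCorners s ω = ∑ f : Torus L,
        if ω (cornerEdge s (f + ((if s true then estep L true else 0) +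
          (if s false then estep L false else 0))) true) ≠
          ω (cornerEdge s (f + ((if s true then estep L true else 0) +
          (if s false then estep L false else 0))) false) then 1 else 0 := by
      intro s
      unfold mixedCorners
      rw [Finset.card_filter]
      exact (Equiv.sum_comp (Equiv.addRight ((if s true then estep L true else 0) +
          (if s false then estep L false else 0))) fun x =>
        if ω (cornerEdge s x true) ≠ ω (cornerEdge s x false) then 1 else 0).symm
    simp only [hsh]
    rw [Finset.sum_comm, ← hc, ← Finset.card_univ, Finset.card_eq_sum_ones]
    refine Finset.sum_le_sum fun f _ => ?_
    by_contra hlt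
    rw [not_le, Nat.lt_one_iff, Finset.sum_eq_zero_iff] at hlt
    have hall : ∀ a b, ω (faceEdge f (true, b)) = ω (faceEdge f (false, a)) := by
      intro a b
      have := hlt (fun d => if d then a else b) (Finset.mem_univ _)
      simp only [ne_eq, ite_not, ite_eq_left_iff, one_ne_zero, imp_false, not_not] at this
      have h0 : f + estep L true + estep L false - estep L true = f + estep L false := by abel
      cases a <;> cases b <;>
        simpa [h0, cornerEdge, inEdge, faceEdge, ← add_assoc, add_sub_cancel_right] using this
    apply h f
    rintro ⟨b, c⟩ ⟨b', c'⟩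
    cases b <;> cases b'
    · rw [← hall c true, ← hall c' true]
    · rw [hall]
    · rw [hall]
    · rw [hall true c, hall true c']
  by_contra hcon
  push Not at hcon
  have : ∑ s : Bool → Bool, 4 * mixedCorners s ω < ∑ s : Bool → Bool, L ^ 2 :=
    Finset.sum_lt_sum_of_nonempty Finset.univ_nonempty fun s _ => hcon s
  rw [← Finset.mul_sum, Finset.sum_const, Finset.card_univ] at this
  simp at this
  omega

open scoped Classical in
/-- Probability of an event at the transition point. -/
def tprob {L : ℕ} [NeZero L] (κD u : ℝ) (P : (Edge L → Bool) → Prop) : ℝ :=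
  (∑ ω : Edge L → Bool with P ω, tw κD u ω) / ∑ ω : Edge L → Bool, tw κD u ω

theorem tprob_eq {L : ℕ} [NeZero L] (κD u : ℝ) (P : (Edge L → Bool) → Prop) [DecidablePred P] :
    tprob κD u P = (∑ ω : Edge L → Bool with P ω, tw κD u ω) / ∑ ω : Edge L → Bool, tw κD u ω := by
  unfold tprob
  congr!

theorem sum_tw_pos {L : ℕ} [NeZero L] {κD u : ℝ} (hD : 0 < κD) (hu : 0 < u) :
    0 < ∑ ω : Edge L → Bool, tw κD u ω :=
  Finset.sum_pos (fun ω _ => tw_pos hD hu ω) Finset.univ_nonempty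

theorem tprob_nonneg {L : ℕ} [NeZero L] {κD u : ℝ} (hD : 0 < κD) (hu : 0 < u)
    (P : (Edge L → Bool) → Prop) : 0 ≤ tprob κD u P :=
  div_nonneg (Finset.sum_nonneg fun ω _ => (tw_pos hD hu ω).le) (sum_tw_pos hD hu).le

theorem le_sum_tw {L : ℕ} [NeZero L] {κD u : ℝ} (hD : 0 < κD) (hu : 1 ≤ u) :
    √(π / (4 * κD)) ^ (L ^ 2 - 1) ≤ ∑ ω : Edge L → Bool, tw κD u ω := by
  have hu0 : 0 < u := by linarith
  have hO : 0 < u ^ 4 * κD := by positivity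
  have h1 : tw κD u (fun _ : Edge L => true) ≤ ∑ ω : Edge L → Bool, tw κD u ω :=
    Finset.single_le_sum (fun ω _ => (tw_pos hD hu0 ω).le) (Finset.mem_univ _)
  refine le_trans ?_ h1
  have h2 := le_ZL (L := L) hO (κ := conduct (u ^ 4 * κD) κD fun _ => true) (fun e => by simp [conduct])
  rw [← ofReal_zr hO hD, ENNReal.ofReal_le_ofReal_iff (zr_pos hO hD _).le, Finset.prod_const,
    Finset.card_univ, card_ne_zero_torus] at h2
  have hones : ones (fun _ : Edge L => true) = 2 * L ^ 2 := by
    unfold ones; simp [← card_edge]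
  have hs : √(π / (4 * κD)) = u ^ 2 * √(π / (4 * (u ^ 4 * κD))) := by
    rw [show π / (4 * κD) = (u ^ 2) ^ 2 * (π / (4 * (u ^ 4 * κD))) by field_simp,
      Real.sqrt_mul (by positivity), Real.sqrt_sq (by positivity)]
  unfold tw
  rw [hones, hs, mul_pow, ← pow_mul]
  exact mul_le_mul (pow_le_pow_right₀ hu (by omega)) h2 (by positivity) (by positivity)

theorem tprob_all_mixed_le {L : ℕ} [NeZero L] {κD v : ℝ} (hD : 0 < κD) (hv : 1 ≤ v)
    (hL : 48 ≤ L) :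
    tprob κD (v ^ 8) (fun ω : Edge L → Bool => ∀ f, MixedFace ω f) ≤ (12 / v) ^ (L ^ 2) := by
  classical
  have hv0 : 0 < v := by linarith
  have hu : 1 ≤ v ^ 8 := one_le_pow₀ hv
  have hterm : ∀ ω : Edge L → Bool, (∀ f, MixedFace ω f) →
      tw κD (v ^ 8) ω * v ^ (L ^ 2) ≤ √(2 * π / κD) ^ (L ^ 2 - 1) := by
    intro ω hω
    obtain ⟨s, hs⟩ := exists_mixedCorners_ge hω
    obtain ⟨ω', h1, h2⟩ := exists_tw_eq κD (v ^ 8) s ω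
    have h3 := tw_mul_pow_le hD hu ω'
    rw [h1, h2, ← pow_mul, ← pow_mul] at h3
    have htw := tw_pos hD (by positivity : 0 < v ^ 8) ω
    have h4 : tw κD (v ^ 8) ω * v ^ (L ^ 2) * v ^ (L ^ 2) ≤
        √(2 * π / κD) ^ (L ^ 2 - 1) * v ^ (L ^ 2) := by
      calc _ = tw κD (v ^ 8) ω * v ^ (2 * L ^ 2) := by rw [two_mul, pow_add]; ring
        _ ≤ tw κD (v ^ 8) ω * v ^ (8 * mixedCorners s ω) := by
          exact mul_le_mul_of_nonneg_left (pow_le_pow_right₀ hv (by omega)) htw.le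
        _ ≤ _ := h3
        _ ≤ _ :=
          mul_le_mul_of_nonneg_left (pow_le_pow_right₀ hv (by nlinarith)) (by positivity)
    exact le_of_mul_le_mul_right h4 (by positivity)
  rw [tprob_eq, div_le_iff₀ (sum_tw_pos hD (by positivity))]
  have hsum := le_sum_tw (L := L) hD hu
  set T := ∑ ω : Edge L → Bool, tw κD (v ^ 8) ω with hT
  have hcard : Fintype.card (Edge L → Bool) = 4 ^ (L ^ 2) := by
    rw [Fintype.card_fun, card_edge, pow_mul]; rfl
  have hA : √(2 * π / κD) ≤ 3 * √(π / (4 * κD)) := by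
    rw [show 2 * π / κD = 8 * (π / (4 * κD)) by field_simp; norm_num, Real.sqrt_mul (by norm_num)]
    gcongr
    rw [Real.sqrt_le_left (by norm_num)]; norm_num
  have hB : √(2 * π / κD) ^ (L ^ 2 - 1) ≤ 3 ^ (L ^ 2) * T := by
    calc _ ≤ (3 * √(π / (4 * κD))) ^ (L ^ 2 - 1) := by gcongr
      _ = 3 ^ (L ^ 2 - 1) * √(π / (4 * κD)) ^ (L ^ 2 - 1) := mul_pow _ _ _
      _ ≤ _ := by
        gcongr
        · norm_num
        · omega
  have hfin : (∑ ω : Edge L → Bool with ∀ f, MixedFace ω f, tw κD (v ^ 8) ω) * v ^ (L ^ 2) ≤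
      12 ^ (L ^ 2) * T := by
    rw [Finset.sum_mul]
    calc _ ≤ ∑ ω : Edge L → Bool with ∀ f, MixedFace ω f, √(2 * π / κD) ^ (L ^ 2 - 1) :=
          Finset.sum_le_sum fun ω hω => hterm ω (Finset.mem_filter.1 hω).2
      _ ≤ ∑ ω : Edge L → Bool, √(2 * π / κD) ^ (L ^ 2 - 1) :=
          Finset.sum_le_sum_of_subset_of_nonneg (Finset.filter_subset _ _) fun _ _ _ => by positivity
      _ = 4 ^ (L ^ 2) * √(2 * π / κD) ^ (L ^ 2 - 1) := by
          rw [Finset.sum_const, Finset.card_univ, hcard, nsmul_eq_mul]; push_cast; rfl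
      _ ≤ 4 ^ (L ^ 2) * (3 ^ (L ^ 2) * T) := by gcongr
      _ = _ := by rw [← mul_assoc, ← mul_pow]; norm_num
  rw [div_pow, div_mul_eq_mul_div, le_div_iff₀ (by positivity)]
  exact hfin

theorem gw_eq_tw {L : ℕ} [NeZero L] {κD u : ℝ} (hu : 0 < u) (ω : Edge L → Bool) :
    gw (u ^ 4 * κD) κD (u / (1 + u)) ω = (1 / (1 + u)) ^ (2 * L ^ 2) * tw κD u ω := by
  have h : 1 - u / (1 + u) = 1 / (1 + u) := by field_simp; ring
  unfold gw tw bondWeight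
  rw [h, ← ones_add_zeros ω, pow_add, div_pow u, div_pow 1, one_pow]
  ring

theorem tprob_mixed_sq_le {L : ℕ} [NeZero L] {n : ℕ} (hL : L = 2 * n) {κD u : ℝ} (hD : 0 < κD)
    (hu : 1 < u) (d : Bool) (a : ZMod L) (S : Set (Torus L)) :
    tprob κD u (fun ω : Edge L → Bool => ∀ f ∈ S, MixedFace ω f) ^ 2 ≤
      tprob κD u (fun ω : Edge L → Bool => ∀ f ∈ symmetrize n d true a S, MixedFace ω f) *
      tprob κD u (fun ω : Edge L → Bool => ∀ f ∈ symmetrize n d false a S, MixedFace ω f) := by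
  classical
  have hu0 : 0 < u := by linarith
  have hO : 0 < u ^ 4 * κD := by positivity
  have hne : κD ≠ u ^ 4 * κD := by
    have : 1 < u ^ 4 := one_lt_pow₀ hu (by norm_num)
    nlinarith
  have hp : u / (1 + u) ∈ Set.Icc (0 : ℝ) 1 :=
    ⟨by positivity, by rw [div_le_one (by positivity)]; linarith⟩
  have key := mixedWeight_sq_le hL (rhoTwo (u ^ 4 * κD) κD (u / (1 + u))) d a S
  have hn : ∀ T : Set (Torus L), 0 ≤ ∑ ω : Edge L → Bool with ∀ f ∈ T, MixedFace ω f,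
      gw (u ^ 4 * κD) κD (u / (1 + u)) ω := fun T => Finset.sum_nonneg fun ω _ => gw_nonneg hp ω
  simp only [mixedWeight_rhoTwo hO hD hne hp] at key
  rw [← ENNReal.ofReal_pow (hn _), ← ENNReal.ofReal_mul (hn _),
    ENNReal.ofReal_le_ofReal_iff (mul_nonneg (hn _) (hn _))] at key
  simp only [gw_eq_tw hu0, ← Finset.mul_sum] at key
  have hc : (0 : ℝ) < ((1 / (1 + u)) ^ (2 * L ^ 2)) ^ 2 := by positivity
  have key2 : (∑ ω : Edge L → Bool with ∀ f ∈ S, MixedFace ω f, tw κD u ω) ^ 2 ≤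
      (∑ ω : Edge L → Bool with ∀ f ∈ symmetrize n d true a S, MixedFace ω f, tw κD u ω) *
      (∑ ω : Edge L → Bool with ∀ f ∈ symmetrize n d false a S, MixedFace ω f, tw κD u ω) := by
    refine le_of_mul_le_mul_left ?_ hc
    linarith
  rw [tprob_eq, tprob_eq, tprob_eq, div_pow, div_mul_div_comm, ← sq]
  exact div_le_div_of_nonneg_right key2 (sq_nonneg (∑ ω : Edge L → Bool, tw κD u ω))

theorem tprob_mixed_le {L : ℕ} [NeZero L] {n : ℕ} (hL : L = 2 * n) (hL' : 48 ≤ L) {κD v : ℝ}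
    (hD : 0 < κD) (hv : 1 < v) (S : Set (Torus L)) :
    tprob κD (v ^ 8) (fun ω : Edge L → Bool => ∀ f ∈ S, MixedFace ω f) ≤ (12 / v) ^ S.ncard := by
  classical
  have hv0 : 0 < v := by linarith
  refine chessboard hL (fun S => tprob κD (v ^ 8) fun ω : Edge L → Bool => ∀ f ∈ S, MixedFace ω f)
    (fun S => tprob_nonneg hD (by positivity) _) ?_
    (fun d a S => tprob_mixed_sq_le hL hD (one_lt_pow₀ hv (by norm_num)) d a S) (by positivity) ?_ S
  · simp only [tprob, Set.mem_empty_iff_false, IsEmpty.forall_iff, implies_true, Finset.filter_true]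
    exact div_self_le_one _
  · simpa using tprob_all_mixed_le hD hv.le hL'

open scoped Classical in
/-- Phase label of the face with lower corner `(i, j)`. -/
def faceLabel {L : ℕ} (ω : Edge L → Bool) (i j : ℕ) : Option Bool :=
  if MixedFace ω ((i : ZMod L), (j : ZMod L)) then none
  else some (ω (((i : ZMod L), (j : ZMod L)), true))

theorem faceLabel_eq_none {L : ℕ} {ω : Edge L → Bool} {i j : ℕ} :
    faceLabel ω i j = none ↔ MixedFace ω ((i : ZMod L), (j : ZMod L)) := by
  unfold faceLabel; split_ifs with h <;> simp [h]

theorem faceLabel_eq_some {L : ℕ} {ω : Edge L → Bool} {i j : ℕ} {s : Bool}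
    (h : faceLabel ω i j = some s) (k : Bool × Bool) :
    ω (faceEdge ((i : ZMod L), (j : ZMod L)) k) = s := by
  unfold faceLabel at h
  split_ifs at h with h'
  have h2 : ω (((i : ZMod L), (j : ZMod L)), true) = s := by simpa using h
  rw [← h2]
  exact (not_not.1 h') k (true, false)

theorem faceLabel_consistent {L : ℕ} (ω : Edge L → Bool) : Consistent L (faceLabel ω) := by
  constructor
  · intro i j s t _ _ hs ht
    rw [← faceLabel_eq_some hs (false, true), ← faceLabel_eq_some ht (false, false)]
    congr 1
    simp [faceEdge, estep]
  · intro i j s t _ _ hs ht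
    rw [← faceLabel_eq_some hs (true, true), ← faceLabel_eq_some ht (true, false)]
    congr 1
    simp [faceEdge, estep]

/-- The law of the bond configuration at the transition point. -/
def transitionLaw {L : ℕ} [NeZero L] (κD u : ℝ) : Measure (Edge L → Bool) :=
  ∑ ω : Edge L → Bool,
    ENNReal.ofReal (tw κD u ω / ∑ ω : Edge L → Bool, tw κD u ω) • Measure.dirac ω

theorem transitionLaw_apply {L : ℕ} [NeZero L] {κD u : ℝ} (hD : 0 < κD) (hu : 0 < u)
    (P : (Edge L → Bool) → Prop) :
    transitionLaw κD u {ω | P ω} = ENNReal.ofReal (tprob κD u P) := by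
  classical
  rw [tprob_eq, Finset.sum_div, Finset.sum_filter, ENNReal.ofReal_sum_of_nonneg]
  · unfold transitionLaw
    rw [Measure.finsetSum_apply]
    refine Finset.sum_congr rfl fun ω _ => ?_
    rw [Measure.smul_apply, Measure.dirac_apply' _ (MeasurableSet.of_discrete)]
    by_cases h : P ω <;> simp [h]
  · intro ω _
    split_ifs
    · exact div_nonneg (tw_pos hD hu ω).le (sum_tw_pos hD hu).le
    · exact le_rfl

theorem natCast_zmod_inj {L : ℕ} {i j : ℕ} (hi : i < L) (hj : j < L)
    (h : (i : ZMod L) = (j : ZMod L)) : i = j := by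
  rw [ZMod.natCast_eq_natCast_iff'] at h
  rwa [Nat.mod_eq_of_lt hi, Nat.mod_eq_of_lt hj] at h

/-- The faces as pairs of representatives. -/
def grid (L : ℕ) : Finset (ℕ × ℕ) := Finset.range L ×ˢ Finset.range L

theorem mem_grid {L : ℕ} {x : ℕ × ℕ} : x ∈ grid L ↔ x.1 < L ∧ x.2 < L := by simp [grid]

theorem card_grid (L : ℕ) : (grid L).card = L ^ 2 := by simp [grid, sq]

theorem tprob_mixed_grid_le {L : ℕ} [NeZero L] {n : ℕ} (hL : L = 2 * n) (hL' : 48 ≤ L) {κD v : ℝ}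
    (hD : 0 < κD) (hv : 1 < v) (T : Finset (ℕ × ℕ)) (hT : ∀ x ∈ T, x.1 < L ∧ x.2 < L) :
    tprob κD (v ^ 8) (fun ω : Edge L → Bool => ∀ x ∈ T, faceLabel ω x.1 x.2 = none) ≤
      (12 / v) ^ T.card := by
  let c : ℕ × ℕ → Torus L := fun x => ((x.1 : ZMod L), (x.2 : ZMod L))
  have hinj : Set.InjOn c (T : Set (ℕ × ℕ)) := by
    intro x hx y hy h
    have h1 := hT x hx
    have h2 := hT y hy
    rw [Prod.mk.injEq] at h
    exact Prod.ext (natCast_zmod_inj h1.1 h2.1 h.1) (natCast_zmod_inj h1.2 h2.2 h.2)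
  have := tprob_mixed_le hL hL' hD hv (c '' (T : Set (ℕ × ℕ)))
  rw [hinj.ncard_image, Set.ncard_coe_finset] at this
  convert this using 3 with ω
  simp only [faceLabel_eq_none, Set.forall_mem_image, Finset.mem_coe, c]

theorem card_mul_two_le_count {L : ℕ} [NeZero L] {ω : Edge L → Bool} {t : Bool}
    {R : Finset (ℕ × ℕ)} (hR : ∀ x ∈ R, (x.1 < L ∧ x.2 < L) ∧ faceLabel ω x.1 x.2 = some t) :
    2 * R.card ≤ (Finset.univ.filter fun e => ω e = t).card := by
  have : 2 * R.card = (R ×ˢ (Finset.univ : Finset Bool)).card := by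
    rw [Finset.card_product]; simp [mul_comm]
  rw [this]
  refine Finset.card_le_card_of_injOn
    (fun y => ((((y.1.1 : ℕ) : ZMod L), ((y.1.2 : ℕ) : ZMod L)), y.2)) ?_ ?_
  · rintro ⟨x, b⟩ hx
    have hx' : x ∈ R := by simpa using hx
    have := faceLabel_eq_some (hR x hx').2 (b, false)
    simpa [faceEdge] using this
  · rintro ⟨x, b⟩ hx ⟨y, b'⟩ hy h
    have hx' : x ∈ R := by simpa using hx
    have hy' : y ∈ R := by simpa using hy
    have h1 := (hR x hx').1
    have h2 := (hR y hy').1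
    simp only [Prod.mk.injEq] at h
    exact Prod.ext (Prod.ext (natCast_zmod_inj h1.1 h2.1 h.1.1)
      (natCast_zmod_inj h1.2 h2.2 h.1.2)) h.2

theorem half_le_tprob_add {L : ℕ} [NeZero L] {n : ℕ} (hL : L = 2 * n) (hL' : 48 ≤ L) {κD v ε : ℝ}
    (hD : 0 < κD) (hv : 1 < v) (hv' : 400 * (12 / v) ≤ 1) (hε : 8 * (12 / v) ≤ ε) :
    1 / 2 ≤ tprob κD (v ^ 8) (fun ω : Edge L → Bool => (1 - ε) * (2 * (L : ℝ) ^ 2) ≤ ones ω) +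
      tprob κD (v ^ 8) (fun ω : Edge L → Bool => (1 - ε) * (2 * (L : ℝ) ^ 2) ≤ zeros ω) := by
  classical
  have hv0 : 0 < v := by linarith
  have hu0 : 0 < v ^ 8 := by positivity
  have hδ : 0 < 12 / v := by positivity
  have hε0 : 0 < ε := by linarith
  have hV : 0 < (L : ℝ) ^ 2 := by
    have : (0 : ℝ) < L := by exact_mod_cast (by omega : 0 < L)
    positivity
  obtain ⟨R, hR1, hR2⟩ := exists_regular_set (transitionLaw (L := L) κD (v ^ 8)) L (by omega)
    faceLabel (ENNReal.ofReal (12 / v))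
    (by
      rw [show (400 : ℝ≥0∞) = ENNReal.ofReal 400 by norm_num, ← ENNReal.ofReal_mul (by norm_num)]
      exact ENNReal.ofReal_le_one.2 hv')
    faceLabel_consistent
    (by
      intro T hT
      rw [transitionLaw_apply hD hu0, ← ENNReal.ofReal_pow hδ.le]
      exact ENNReal.ofReal_le_ofReal (tprob_mixed_grid_le hL hL' hD hv T hT))
  have hR3 : ∀ x ∈ grid L, tprob κD (v ^ 8) (fun ω : Edge L → Bool => x ∉ R ω) ≤ 4 * (12 / v) := by
    intro x hx
    have h := hR2 x (mem_grid.1 hx).1 (mem_grid.1 hx).2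
    rwa [transitionLaw_apply hD hu0, show (4 : ℝ≥0∞) = ENNReal.ofReal 4 by norm_num,
      ← ENNReal.ofReal_mul (by norm_num), ENNReal.ofReal_le_ofReal_iff (by positivity)] at h
  set T := ∑ ω : Edge L → Bool, tw κD (v ^ 8) ω with hT
  have hTpos : 0 < T := sum_tw_pos hD hu0
  let irr : (Edge L → Bool) → ℝ := fun ω => (((grid L).filter fun x => x ∉ R ω).card : ℝ)
  have hirr : ∑ ω : Edge L → Bool, tw κD (v ^ 8) ω * irr ω ≤ 4 * (12 / v) * (L : ℝ) ^ 2 * T := by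
    have h1 : ∀ ω, irr ω = ∑ x ∈ grid L, if x ∉ R ω then (1 : ℝ) else 0 := by
      intro ω; simp [irr, Finset.sum_ite]
    simp only [h1, Finset.mul_sum]
    rw [Finset.sum_comm]
    calc _ ≤ ∑ x ∈ grid L, 4 * (12 / v) * T := by
          refine Finset.sum_le_sum fun x hx => ?_
          have := hR3 x hx
          rw [tprob_eq, div_le_iff₀ hTpos, Finset.sum_filter] at this
          simpa using this
      _ = _ := by rw [Finset.sum_const, card_grid, nsmul_eq_mul]; push_cast; ring
  have hdich : ∀ ω : Edge L → Bool, irr ω ≤ ε * (L : ℝ) ^ 2 →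
      (1 - ε) * (2 * (L : ℝ) ^ 2) ≤ ones ω ∨ (1 - ε) * (2 * (L : ℝ) ^ 2) ≤ zeros ω := by
    intro ω hω
    obtain ⟨t, ht⟩ := hR1 ω
    have hc : 2 * ((grid L).filter fun x => x ∈ R ω).card ≤
        (Finset.univ.filter fun e => ω e = t).card := card_mul_two_le_count fun x hx => by
      have hx' := Finset.mem_filter.1 hx
      have hg := mem_grid.1 hx'.1
      exact ⟨hg, ht x hx'.2 hg.1 hg.2⟩
    have hsum := Finset.card_filter_add_card_filter_not (s := grid L) (fun x => x ∈ R ω)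
    rw [card_grid] at hsum
    have hsum' : (((grid L).filter fun x => x ∈ R ω).card : ℝ) + irr ω = (L : ℝ) ^ 2 := by
      simp only [irr]
      exact_mod_cast hsum
    have hc' : (2 : ℝ) * ((grid L).filter fun x => x ∈ R ω).card ≤
        ((Finset.univ.filter fun e => ω e = t).card : ℝ) := by exact_mod_cast hc
    have hfin : (1 - ε) * (2 * (L : ℝ) ^ 2) ≤ ((Finset.univ.filter fun e => ω e = t).card : ℝ) := by
      linarith
    cases t
    · right; exact hfin
    · left; exact hfin
  rw [tprob_eq, tprob_eq, ← add_div, le_div_iff₀ hTpos, Finset.sum_filter, Finset.sum_filter,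
    ← Finset.sum_add_distrib]
  have hpt : ∀ ω : Edge L → Bool, tw κD (v ^ 8) ω - tw κD (v ^ 8) ω * irr ω / (ε * (L : ℝ) ^ 2) ≤
      (if (1 - ε) * (2 * (L : ℝ) ^ 2) ≤ ones ω then tw κD (v ^ 8) ω else 0) +
      (if (1 - ε) * (2 * (L : ℝ) ^ 2) ≤ zeros ω then tw κD (v ^ 8) ω else 0) := by
    intro ω
    have hw := tw_pos hD hu0 ω
    have hi : 0 ≤ irr ω := Nat.cast_nonneg _
    have hεV : 0 < ε * (L : ℝ) ^ 2 := by positivity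
    by_cases h : irr ω ≤ ε * (L : ℝ) ^ 2
    · have h0 : 0 ≤ tw κD (v ^ 8) ω * irr ω / (ε * (L : ℝ) ^ 2) := by positivity
      rcases hdich ω h with h1 | h1 <;> rw [if_pos h1] <;> split_ifs <;> linarith
    · have h0 : tw κD (v ^ 8) ω ≤ tw κD (v ^ 8) ω * irr ω / (ε * (L : ℝ) ^ 2) := by
        rw [le_div_iff₀ hεV]
        exact mul_le_mul_of_nonneg_left (not_le.1 h).le hw.le
      split_ifs <;> linarith
  refine le_trans ?_ (Finset.sum_le_sum fun ω _ => hpt ω)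
  rw [Finset.sum_sub_distrib, ← Finset.sum_div, ← hT]
  have : (∑ ω : Edge L → Bool, tw κD (v ^ 8) ω * irr ω) / (ε * (L : ℝ) ^ 2) ≤ 1 / 2 * T := by
    rw [div_le_iff₀ (by positivity)]
    refine hirr.trans ?_
    have : 4 * (12 / v) ≤ ε / 2 := by linarith
    nlinarith [mul_pos hV hTpos]
  linarith

theorem tprob_ones_le {L : ℕ} [NeZero L] {κD u : ℝ} (hD : 0 < κD) (hu : 1 ≤ u) (Q : ℕ → Prop) :
    tprob κD u (fun ω : Edge L → Bool => Q (ones ω)) ≤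
      u ^ 2 * tprob κD u (fun ω : Edge L → Bool => Q (zeros ω)) := by
  classical
  rw [tprob_eq, tprob_eq, ← mul_div_assoc]
  refine div_le_div_of_nonneg_right ?_ (sum_tw_pos hD (by linarith)).le
  rw [Finset.sum_filter, Finset.sum_filter, Finset.mul_sum,
    ← (Equiv.ofBijective _ (dualCfg_bijective (L := L))).sum_comp]
  refine Finset.sum_le_sum fun ω _ => ?_
  simp only [Equiv.ofBijective_apply, ones_dualCfg]
  split_ifs
  · exact weight_dualCfg_le hD hu ω
  · simp

theorem dualCfg_symm_ones {L : ℕ} [NeZero L] (ω : Edge L → Bool) : zeros (dualCfg ω) = ones ω := by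
  have h1 := ones_add_zeros ω
  have h2 := ones_add_zeros (dualCfg ω)
  have h3 := ones_dualCfg ω
  omega

theorem tprob_zeros_le {L : ℕ} [NeZero L] {κD u : ℝ} (hD : 0 < κD) (hu : 1 ≤ u) (Q : ℕ → Prop) :
    tprob κD u (fun ω : Edge L → Bool => Q (zeros ω)) ≤
      u ^ 2 * tprob κD u (fun ω : Edge L → Bool => Q (ones ω)) := by
  classical
  rw [tprob_eq, tprob_eq, ← mul_div_assoc]
  refine div_le_div_of_nonneg_right ?_ (sum_tw_pos hD (by linarith)).le
  rw [Finset.sum_filter, Finset.sum_filter, Finset.mul_sum,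
    ← (Equiv.ofBijective _ (dualCfg_bijective (L := L))).sum_comp]
  refine Finset.sum_le_sum fun ω _ => ?_
  simp only [Equiv.ofBijective_apply, dualCfg_symm_ones]
  split_ifs
  · exact weight_dualCfg_le hD hu ω
  · simp

theorem sum_tail_le {Ω : Type*} [Fintype Ω] {w : Ω → ℝ} (hw : ∀ ω, 0 ≤ w ω) (X : Ω → ℕ) {r C : ℝ}
    (hr : 0 ≤ r) (hr1 : r ≤ 1) (hC : 0 ≤ C) {m k : ℕ} (hmk : m ≤ k)
    (h : ∑ ω, w ω ≤ C * ∑ ω with X ω ≤ m, w ω) :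
    ∑ ω with k ≤ X ω, r ^ X ω * w ω ≤ C * r ^ (k - m) * ∑ ω, r ^ X ω * w ω := by
  calc ∑ ω with k ≤ X ω, r ^ X ω * w ω ≤ ∑ ω with k ≤ X ω, r ^ k * w ω :=
        Finset.sum_le_sum fun ω hω => mul_le_mul_of_nonneg_right
          (pow_le_pow_of_le_one hr hr1 (Finset.mem_filter.1 hω).2) (hw ω)
    _ ≤ ∑ ω, r ^ k * w ω := Finset.sum_le_sum_of_subset_of_nonneg (Finset.filter_subset _ _)
        fun ω _ _ => mul_nonneg (pow_nonneg hr _) (hw ω)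
    _ = r ^ k * ∑ ω, w ω := by rw [Finset.mul_sum]
    _ ≤ r ^ k * (C * ∑ ω with X ω ≤ m, w ω) := mul_le_mul_of_nonneg_left h (pow_nonneg hr _)
    _ = C * r ^ (k - m) * ∑ ω with X ω ≤ m, r ^ m * w ω := by
        rw [← Finset.mul_sum, ← Nat.sub_add_cancel hmk, pow_add, Nat.add_sub_cancel]; ring
    _ ≤ C * r ^ (k - m) * ∑ ω with X ω ≤ m, r ^ X ω * w ω := by
        refine mul_le_mul_of_nonneg_left (Finset.sum_le_sum fun ω hω => ?_)
          (mul_nonneg hC (pow_nonneg hr _))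
        exact mul_le_mul_of_nonneg_right
          (pow_le_pow_of_le_one hr hr1 (Finset.mem_filter.1 hω).2) (hw ω)
    _ ≤ _ := by
        refine mul_le_mul_of_nonneg_left ?_ (mul_nonneg hC (pow_nonneg hr _))
        exact Finset.sum_le_sum_of_subset_of_nonneg (Finset.filter_subset _ _)
          fun ω _ _ => mul_nonneg (pow_nonneg hr _) (hw ω)

theorem QL_tail_bounds {L : ℕ} [NeZero L] {κD u p ε M r C : ℝ} (hD : 0 < κD) (hu : 0 < u)
    (hε : 0 ≤ ε) (hp : p ∈ Set.Icc (0 : ℝ) 1) (X : (Edge L → Bool) → ℕ) (hr : 0 ≤ r) (hr1 : r ≤ 1)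
    (hC : 0 ≤ C) (hM : 0 ≤ M)
    (hgw : ∀ ω, gw (u ^ 4 * κD) κD p ω = M * (r ^ X ω * tw κD u ω))
    (hgood : 1 ≤ C * tprob κD u fun ω => (X ω : ℝ) ≤ ε / 2 * (2 * (L : ℝ) ^ 2))
    {A : Set (Edge L → ℝ)} (hA : MeasurableSet A)
    (hAX : ∀ ω, conduct (u ^ 4 * κD) κD ω ∈ A ↔ (X ω : ℝ) ≤ ε * (2 * (L : ℝ) ^ 2)) :
    ENNReal.ofReal (1 - C * r ^ (⌊ε * (2 * (L : ℝ) ^ 2)⌋₊ - ⌊ε / 2 * (2 * (L : ℝ) ^ 2)⌋₊)) ≤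
        QL L (rhoTwo (u ^ 4 * κD) κD p) {x | x.2 ∈ A} ∧
      QL L (rhoTwo (u ^ 4 * κD) κD p) {x | x.2 ∈ A} ≤ 1 := by
  classical
  have hO : 0 < u ^ 4 * κD := by positivity
  rw [QL_apply hO hD hp hA _ hAX]
  have hS := gw_sum_pos (L := L) hO hD hp
  have hsplit := Finset.sum_filter_add_sum_filter_not Finset.univ
    (fun ω : Edge L → Bool => (X ω : ℝ) ≤ ε * (2 * (L : ℝ) ^ 2)) (gw (u ^ 4 * κD) κD p)
  have hbad0 : 0 ≤ ∑ ω : Edge L → Bool with ¬ (X ω : ℝ) ≤ ε * (2 * (L : ℝ) ^ 2),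
      gw (u ^ 4 * κD) κD p ω := Finset.sum_nonneg fun ω _ => gw_nonneg hp ω
  constructor
  · refine ENNReal.ofReal_le_ofReal ?_
    rw [le_div_iff₀ hS, sub_mul, one_mul]
    have hfloor : ⌊ε / 2 * (2 * (L : ℝ) ^ 2)⌋₊ ≤ ⌊ε * (2 * (L : ℝ) ^ 2)⌋₊ :=
      Nat.floor_le_floor (by gcongr; linarith)
    have hg : ∑ ω : Edge L → Bool, tw κD u ω ≤
        C * ∑ ω : Edge L → Bool with X ω ≤ ⌊ε / 2 * (2 * (L : ℝ) ^ 2)⌋₊, tw κD u ω := by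
      rw [tprob_eq, ← mul_div_assoc, le_div_iff₀ (sum_tw_pos hD hu), one_mul] at hgood
      simpa only [Nat.le_floor_iff (by positivity : 0 ≤ ε / 2 * (2 * (L : ℝ) ^ 2))] using hgood
    have key := mul_le_mul_of_nonneg_left
      (sum_tail_le (fun ω => (tw_pos hD hu ω).le) X hr hr1 hC hfloor hg) hM
    rw [Finset.mul_sum, mul_left_comm M, Finset.mul_sum (a := M)] at key
    simp only [← hgw] at key
    have hsub : ∑ ω : Edge L → Bool with ¬ (X ω : ℝ) ≤ ε * (2 * (L : ℝ) ^ 2),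
        gw (u ^ 4 * κD) κD p ω ≤
        ∑ ω : Edge L → Bool with ⌊ε * (2 * (L : ℝ) ^ 2)⌋₊ ≤ X ω, gw (u ^ 4 * κD) κD p ω := by
      refine Finset.sum_le_sum_of_subset_of_nonneg ?_ fun ω _ _ => gw_nonneg hp ω
      intro ω hω
      simp only [Finset.mem_filter, Finset.mem_univ, true_and, not_le] at hω ⊢
      exact Nat.floor_le_of_le hω.le
    linarith
  · refine ENNReal.ofReal_le_one.2 ?_
    rw [div_le_one hS]
    linarith

theorem one_le_tprob_zeros {L : ℕ} [NeZero L] {n : ℕ} (hL : L = 2 * n) (hL' : 48 ≤ L) {κD v ε : ℝ}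
    (hD : 0 < κD) (hv : 1 < v) (hv' : 400 * (12 / v) ≤ 1) (hε : 8 * (12 / v) ≤ ε) :
    1 ≤ 2 * (1 + (v ^ 8) ^ 2) *
      tprob κD (v ^ 8) fun ω : Edge L → Bool => (zeros ω : ℝ) ≤ ε * (2 * (L : ℝ) ^ 2) := by
  have h1 := half_le_tprob_add hL hL' hD hv hv' hε
  have h2 := tprob_zeros_le (L := L) hD (one_le_pow₀ hv.le : 1 ≤ v ^ 8)
    (fun k => (1 - ε) * (2 * (L : ℝ) ^ 2) ≤ k)
  have h3 : (fun ω : Edge L → Bool => (zeros ω : ℝ) ≤ ε * (2 * (L : ℝ) ^ 2)) =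
      fun ω : Edge L → Bool => (1 - ε) * (2 * (L : ℝ) ^ 2) ≤ ones ω := by
    ext ω
    have : (ones ω : ℝ) + zeros ω = 2 * (L : ℝ) ^ 2 := by exact_mod_cast ones_add_zeros ω
    constructor <;> intro h <;> linarith
  rw [h3]
  linarith

theorem one_le_tprob_ones {L : ℕ} [NeZero L] {n : ℕ} (hL : L = 2 * n) (hL' : 48 ≤ L) {κD v ε : ℝ}
    (hD : 0 < κD) (hv : 1 < v) (hv' : 400 * (12 / v) ≤ 1) (hε : 8 * (12 / v) ≤ ε) :
    1 ≤ 2 * (1 + (v ^ 8) ^ 2) *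
      tprob κD (v ^ 8) fun ω : Edge L → Bool => (ones ω : ℝ) ≤ ε * (2 * (L : ℝ) ^ 2) := by
  have h1 := half_le_tprob_add hL hL' hD hv hv' hε
  have h2 := tprob_ones_le (L := L) hD (one_le_pow₀ hv.le : 1 ≤ v ^ 8)
    (fun k => (1 - ε) * (2 * (L : ℝ) ^ 2) ≤ k)
  have h3 : (fun ω : Edge L → Bool => (ones ω : ℝ) ≤ ε * (2 * (L : ℝ) ^ 2)) =
      fun ω : Edge L → Bool => (1 - ε) * (2 * (L : ℝ) ^ 2) ≤ zeros ω := by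
    ext ω
    have : (ones ω : ℝ) + zeros ω = 2 * (L : ℝ) ^ 2 := by exact_mod_cast ones_add_zeros ω
    constructor <;> intro h <;> linarith
  rw [h3]
  linarith

theorem tendsto_tail_bound {ε r C : ℝ} (hε : 0 < ε) (hr : 0 ≤ r) (hr1 : r < 1) :
    Tendsto (fun n : ℕ => ENNReal.ofReal (1 - C * r ^ (⌊ε * (2 * ((2 * (n + 1) : ℕ) : ℝ) ^ 2)⌋₊ -
      ⌊ε / 2 * (2 * ((2 * (n + 1) : ℕ) : ℝ) ^ 2)⌋₊))) atTop (nhds 1) := by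
  have hexp : Tendsto (fun n : ℕ => ⌊ε * (2 * ((2 * (n + 1) : ℕ) : ℝ) ^ 2)⌋₊ -
      ⌊ε / 2 * (2 * ((2 * (n + 1) : ℕ) : ℝ) ^ 2)⌋₊) atTop atTop := by
    rw [← tendsto_natCast_atTop_iff (R := ℝ)]
    have hlin : Tendsto (fun n : ℕ => ε * (n : ℝ) - 1) atTop atTop :=
      tendsto_atTop_add_const_right _ _ ((tendsto_natCast_atTop_atTop).const_mul_atTop hε)
    refine tendsto_atTop_mono (fun n => ?_) hlin
    set N : ℝ := 2 * ((2 * (n + 1) : ℕ) : ℝ) ^ 2 with hN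
    have hNn : (2 : ℝ) * n ≤ N := by
      rw [hN]; push_cast; nlinarith [(Nat.cast_nonneg n : (0 : ℝ) ≤ n)]
    have hN0 : 0 ≤ N := by positivity
    have h1 := Nat.lt_floor_add_one (ε * N)
    have h2 := Nat.floor_le (by positivity : 0 ≤ ε / 2 * N)
    have h3 : (⌊ε * N⌋₊ : ℝ) ≤ ((⌊ε * N⌋₊ - ⌊ε / 2 * N⌋₊ : ℕ) : ℝ) + ⌊ε / 2 * N⌋₊ := by
      exact_mod_cast (by omega : ⌊ε * N⌋₊ ≤ (⌊ε * N⌋₊ - ⌊ε / 2 * N⌋₊) + ⌊ε / 2 * N⌋₊)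
    nlinarith [mul_le_mul_of_nonneg_left hNn hε.le]
  have hpow := (tendsto_pow_atTop_nhds_zero_of_lt_one hr hr1).comp hexp
  have := ENNReal.tendsto_ofReal ((hpow.const_mul C).const_sub 1)
  simpa using this

theorem tendsto_QL_ones {κD v ε p : ℝ} (hε : 0 < ε) (hD : 0 < κD) (hv : 1 < v)
    (hv' : 400 * (12 / v) ≤ 1) (hvε : 8 * (12 / v) ≤ ε / 2) (hp : p ∈ Set.Icc (0 : ℝ) 1)
    (hpt : p < v ^ 8 / (1 + v ^ 8)) :
    Tendsto (fun n : ℕ => QL (2 * (n + 1)) (rhoTwo ((v ^ 8) ^ 4 * κD) κD p)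
      {x | Rord (2 * (n + 1)) ((v ^ 8) ^ 4 * κD) x.2 ≤ ε}) atTop (nhds 1) := by
  have hu : 1 < v ^ 8 := one_lt_pow₀ hv (by norm_num)
  set u := v ^ 8 with hu'
  have hu0 : 0 < u := by linarith
  have hne : κD ≠ u ^ 4 * κD := by
    have : 1 < u ^ 4 := one_lt_pow₀ hu (by norm_num)
    nlinarith
  rw [lt_div_iff₀ (by linarith)] at hpt
  have hq : 0 < 1 - p := by
    by_contra! h
    nlinarith
  set r := p / u / (1 - p) with hrdef
  have hr : 0 ≤ r := div_nonneg (div_nonneg hp.1 hu0.le) hq.le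
  have hr1 : r < 1 := by
    rw [hrdef, div_lt_one hq, div_lt_iff₀ hu0]; linarith
  have hb : ∀ᶠ n : ℕ in atTop, _ := (eventually_ge_atTop 24).mono fun n hn =>
    QL_tail_bounds (L := 2 * (n + 1)) (ε := ε) (M := (1 - p) ^ (2 * (2 * (n + 1)) ^ 2)) hD hu0 hε.le
      hp ones hr hr1.le (by positivity : 0 ≤ 2 * (1 + u ^ 2)) (by positivity)
      (fun ω => by
        rw [← ones_add_zeros ω, pow_add, hrdef, div_pow, div_pow]
        unfold gw tw bondWeight
        field_simp)
      (one_le_tprob_ones rfl (by omega) hD hv hv' hvε)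
      (A := {κ | Rord (2 * (n + 1)) (u ^ 4 * κD) κ ≤ ε})
      (measurableSet_le (measurable_Rord _ _) measurable_const)
      (fun ω => by
        rw [Set.mem_ofPred_eq, Rord_conduct hne, div_le_iff₀ (by positivity)])
  exact tendsto_of_tendsto_of_tendsto_of_le_of_le' (tendsto_tail_bound hε hr hr1)
    tendsto_const_nhds (hb.mono fun n h => h.1) (hb.mono fun n h => h.2)

theorem tendsto_QL_zeros {κD v ε p : ℝ} (hε : 0 < ε) (hD : 0 < κD) (hv : 1 < v)
    (hv' : 400 * (12 / v) ≤ 1) (hvε : 8 * (12 / v) ≤ ε / 2) (hp : p ∈ Set.Icc (0 : ℝ) 1)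
    (hpt : v ^ 8 / (1 + v ^ 8) < p) :
    Tendsto (fun n : ℕ => QL (2 * (n + 1)) (rhoTwo ((v ^ 8) ^ 4 * κD) κD p)
      {x | 1 - ε ≤ Rord (2 * (n + 1)) ((v ^ 8) ^ 4 * κD) x.2}) atTop (nhds 1) := by
  have hu : 1 < v ^ 8 := one_lt_pow₀ hv (by norm_num)
  set u := v ^ 8 with hu'
  have hu0 : 0 < u := by linarith
  have hne : κD ≠ u ^ 4 * κD := by
    have : 1 < u ^ 4 := one_lt_pow₀ hu (by norm_num)
    nlinarith
  have hp0 : 0 < p := lt_trans (by positivity) hpt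
  rw [div_lt_iff₀ (by linarith)] at hpt
  set r := (1 - p) / (p / u) with hrdef
  have hr : 0 ≤ r := div_nonneg (by linarith [hp.2]) (by positivity)
  have hr1 : r < 1 := by
    rw [hrdef, div_lt_one (by positivity), lt_div_iff₀ hu0]; linarith
  have hb : ∀ᶠ n : ℕ in atTop, _ := (eventually_ge_atTop 24).mono fun n hn =>
    QL_tail_bounds (L := 2 * (n + 1)) (ε := ε) (M := (p / u) ^ (2 * (2 * (n + 1)) ^ 2)) hD hu0 hε.le
      hp zeros hr hr1.le (by positivity : 0 ≤ 2 * (1 + u ^ 2)) (by positivity)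
      (fun ω => by
        rw [← ones_add_zeros ω, pow_add, hrdef, div_pow, div_pow]
        unfold gw tw bondWeight
        field_simp
        rw [div_pow, mul_pow]
        field_simp)
      (one_le_tprob_zeros rfl (by omega) hD hv hv' hvε)
      (A := {κ | 1 - ε ≤ Rord (2 * (n + 1)) (u ^ 4 * κD) κ})
      (measurableSet_le measurable_const (measurable_Rord _ _))
      (fun ω => by
        have : (ones ω : ℝ) + zeros ω = 2 * ((2 * (n + 1) : ℕ) : ℝ) ^ 2 := by
          exact_mod_cast ones_add_zeros ω
        rw [Set.mem_ofPred_eq, Rord_conduct hne, le_div_iff₀ (by positivity)]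
        constructor <;> intro h <;> linarith)
  exact tendsto_of_tendsto_of_tendsto_of_le_of_le' (tendsto_tail_bound hε hr hr1)
    tendsto_const_nhds (hb.mono fun n h => h.1) (hb.mono fun n h => h.2)

/-- first-order transition in the density of ordered bonds on the
torus.  For every `ε > 0` there is `c > 0` such that whenever `0 < κD < κO` and
`κO ≥ c κD`, there is `p_t ∈ (0,1)` so that for `p < p_t` (resp. `p > p_t`) the
`Q_L`-probability that the fraction of ordered bonds is `≤ ε` (resp. `≥ 1-ε`)
tends to `1` along even `L → ∞`. -/
theorem phase_transition_torus :
    ∀ ε : ℝ, 0 < ε → ∃ c : ℝ, 0 < c ∧ ∀ κO κD : ℝ, 0 < κD → κD < κO →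
      c * κD ≤ κO → ∃ pt : ℝ, pt ∈ Set.Ioo (0 : ℝ) 1 ∧
        ∀ p ∈ Set.Icc (0 : ℝ) 1,
          (p < pt →
            Tendsto
              (fun n : ℕ => QL (2 * (n + 1)) (rhoTwo κO κD p)
                {x | Rord (2 * (n + 1)) κO x.2 ≤ ε})
              atTop (nhds 1)) ∧
          (pt < p →
            Tendsto
              (fun n : ℕ => QL (2 * (n + 1)) (rhoTwo κO κD p)
                {x | 1 - ε ≤ Rord (2 * (n + 1)) κO x.2})
              atTop (nhds 1)) := by
  intro ε hε
  refine ⟨(4800 + 192 / ε) ^ 32, by positivity, fun κO κD hD hDO hc => ?_⟩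
  set v : ℝ := (κO / κD) ^ ((1 : ℝ) / 32) with hvdef
  have hO : 0 < κO := hD.trans hDO
  have hq : 0 < κO / κD := by positivity
  have hv0 : 0 < v := Real.rpow_pos_of_pos hq _
  have hv32 : v ^ 32 = κO / κD := by
    rw [hvdef, ← Real.rpow_natCast, ← Real.rpow_mul hq.le]; norm_num
  have hvge : 4800 + 192 / ε ≤ v := by
    refine le_of_pow_le_pow_left₀ (by norm_num : (32 : ℕ) ≠ 0) hv0.le ?_
    rwa [hv32, le_div_iff₀ hD]
  have h192 : 0 < 192 / ε := by positivity
  have hv1 : 1 < v := by linarith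
  have hv' : 400 * (12 / v) ≤ 1 := by
    rw [← mul_div_assoc, div_le_one hv0]; linarith
  have hvε : 8 * (12 / v) ≤ ε / 2 := by
    have h : 192 / ε ≤ v := by linarith
    rw [div_le_iff₀ hε] at h
    rw [← mul_div_assoc, div_le_iff₀ hv0]
    linarith
  have hκ : κO = (v ^ 8) ^ 4 * κD := by
    rw [← pow_mul, hv32]; field_simp
  refine ⟨v ^ 8 / (1 + v ^ 8), ⟨by positivity, ?_⟩, fun p hp => ⟨fun h => ?_, fun h => ?_⟩⟩
  · rw [div_lt_one (by positivity)]; linarith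
  · rw [hκ]
    exact tendsto_QL_ones hε hD hv1 hv' hvε hp h
  · rw [hκ]
    exact tendsto_QL_zeros hε hD hv1 hv' hvε hp h

end
end

section
/- Suppose κ_min := inf(supp ρ) > 0. Let Λ ⊆ T_L, let B_Λ be the set of bonds in B_L with both endpoints in Λ (assume B_Λ ≠ ∅), and define the empirical tilt U_Λ(η) := ( |B_Λ|^{-1} ∑_{horizontal b ∈ B_Λ} η_b , |B_Λ|^{-1} ∑_{vertical b ∈ B_Λ} η_b ) ∈ ℝ². Then for every δ > 0, every Λ ⊆ T_L, and every even L, P_L( |U_Λ| ≥ δ ) ≤ 4 exp( −(1/8) κ_min δ² |B_Λ| ), where |U_Λ| is the Euclidean norm of U_Λ. -/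
open MeasureTheory Real Filter
open scoped ENNReal

noncomputable section

/-- The set of bonds with both endpoints in `Λ`. -/
def bondsIn (L : ℕ) [NeZero L] (Λ : Finset (Torus L)) : Finset (Edge L) :=
  Finset.univ.filter fun e : Edge L => e.1 ∈ Λ ∧ etarget e ∈ Λ

/-- First (horizontal) component of the empirical tilt `U_Λ`. -/
def tiltHor (L : ℕ) [NeZero L] (Λ : Finset (Torus L)) (η : Edge L → ℝ) : ℝ :=
  (∑ b ∈ (bondsIn L Λ).filter fun e => e.2 = true, η b) / (bondsIn L Λ).card

/-- Second (vertical) component of the empirical tilt `U_Λ`. -/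
def tiltVert (L : ℕ) [NeZero L] (Λ : Finset (Torus L)) (η : Edge L → ℝ) : ℝ :=
  (∑ b ∈ (bondsIn L Λ).filter fun e => e.2 = false, η b) / (bondsIn L Λ).card

/-- Euclidean norm of the empirical tilt `U_Λ`. -/
def tiltNorm (L : ℕ) [NeZero L] (Λ : Finset (Torus L)) (η : Edge L → ℝ) : ℝ :=
  Real.sqrt (tiltHor L Λ η ^ 2 + tiltVert L Λ η ^ 2)

/-- Riesz representation on a subspace for a diagonal positive definite quadratic form. -/
lemma exists_mem_range_weighted_riesz {E W : Type*} [Fintype E] [AddCommGroup W] [Module ℝ W]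
    (G : W →ₗ[ℝ] (E → ℝ)) {κ : E → ℝ} (hκ : ∀ b, 0 < κ b) (ℓ : E → ℝ) :
    ∃ w₀ : W, ∀ w : W, ∑ b, κ b * G w₀ b * G w b = ∑ b, ℓ b * G w b := by
  let B : LinearMap.range G →ₗ[ℝ] Module.Dual ℝ (LinearMap.range G) :=
    LinearMap.mk₂ ℝ (fun u v => ∑ b, κ b * u.1 b * v.1 b)
      (fun u u' v => by simp [mul_add, add_mul, Finset.sum_add_distrib])
      (fun c u v => by simp only [Finset.smul_sum]; congr! 1; simp; ring)
      (fun u v v' => by simp [mul_add, Finset.sum_add_distrib])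
      (fun c u v => by simp only [Finset.smul_sum]; congr! 1; simp; ring)
  have hinj : Function.Injective B := by
    rw [← LinearMap.ker_eq_bot, LinearMap.ker_eq_bot']
    intro u hu
    have h0 : ∑ b, κ b * u.1 b * u.1 b = 0 := LinearMap.congr_fun hu u
    rw [Finset.sum_eq_zero_iff_of_nonneg
      (fun b _ => by rw [mul_assoc]; exact mul_nonneg (hκ b).le (mul_self_nonneg _))] at h0
    ext b
    have := h0 b (Finset.mem_univ b)
    simpa [(hκ b).ne'] using this
  have hsurj : Function.Surjective B :=
    (LinearMap.injective_iff_surjective_of_finrank_eq_finrank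
      (Subspace.dual_finrank_eq (K := ℝ) (V := LinearMap.range G)).symm).1 hinj
  let f : Module.Dual ℝ (LinearMap.range G) :=
    { toFun := fun v => ∑ b, ℓ b * v.1 b
      map_add' := fun u v => by simp [mul_add, Finset.sum_add_distrib]
      map_smul' := fun c v => by
        simp only [Finset.smul_sum, RingHom.id_apply]; congr! 1; simp; ring }
  obtain ⟨⟨_, w₀, rfl⟩, hw₀⟩ := hsurj f
  exact ⟨w₀, fun w => LinearMap.congr_fun hw₀ ⟨G w, w, rfl⟩⟩

/-- A linear tilt of a Gaussian weight with conductances at least `m` costs at most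
`exp (‖ℓ‖² / (2m))`. -/
lemma lintegral_exp_linear_mul_gaussian_le {E W : Type*} [Fintype E] [AddCommGroup W] [Module ℝ W]
    [MeasurableSpace W] [MeasurableAdd W] (μ : Measure W) [μ.IsAddRightInvariant]
    (G : W →ₗ[ℝ] (E → ℝ)) {κ : E → ℝ} {m : ℝ} (hm : 0 < m) (hκ : ∀ b, m ≤ κ b) (ℓ : E → ℝ) :
    ∫⁻ w, ENNReal.ofReal (exp (∑ b, ℓ b * G w b)) *
        ENNReal.ofReal (exp (-((1 / 2) * ∑ b, κ b * G w b ^ 2))) ∂μ ≤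
      ENNReal.ofReal (exp ((∑ b, ℓ b ^ 2) / (2 * m))) *
        ∫⁻ w, ENNReal.ofReal (exp (-((1 / 2) * ∑ b, κ b * G w b ^ 2))) ∂μ := by
  obtain ⟨w₀, hw₀⟩ := exists_mem_range_weighted_riesz G (fun b => hm.trans_le (hκ b)) ℓ
  rw [← lintegral_const_mul' _ _ ENNReal.ofReal_ne_top,
    ← lintegral_add_right_eq_self (μ := μ) (fun w => ENNReal.ofReal (exp (∑ b, ℓ b * G w b)) * _) w₀]
  refine lintegral_mono fun w => ?_
  rw [← ENNReal.ofReal_mul (exp_pos _).le, ← ENNReal.ofReal_mul (exp_pos _).le, ← exp_add,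
    ← exp_add]
  refine ENNReal.ofReal_le_ofReal (exp_le_exp.2 ?_)
  have key : ∑ b, ℓ b * G w₀ b - (1 / 2) * ∑ b, κ b * G w₀ b ^ 2 ≤
      (∑ b, ℓ b ^ 2) / (2 * m) := by
    rw [Finset.mul_sum, ← Finset.sum_sub_distrib, Finset.sum_div]
    refine Finset.sum_le_sum fun b _ => ?_
    rw [le_div_iff₀ (by positivity)]
    nlinarith [sq_nonneg (ℓ b - m * G w₀ b),
      mul_nonneg hm.le (mul_nonneg (sub_nonneg.2 (hκ b)) (sq_nonneg (G w₀ b)))]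
  have hexpand : ∑ b, κ b * G (w + w₀) b ^ 2 =
      ∑ b, κ b * G w b ^ 2 + 2 * ∑ b, κ b * G w₀ b * G w b + ∑ b, κ b * G w₀ b ^ 2 := by
    rw [Finset.mul_sum, ← Finset.sum_add_distrib, ← Finset.sum_add_distrib]
    refine Finset.sum_congr rfl fun b _ => ?_
    simp only [map_add, Pi.add_apply]
    ring
  have hlin : ∑ b, ℓ b * G (w + w₀) b = ∑ b, ℓ b * G w b + ∑ b, ℓ b * G w₀ b := by
    simp [mul_add, Finset.sum_add_distrib]
  rw [hexpand, hlin, hw₀]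
  linarith

/-- The gradient of a field on the torus pinned to zero at the origin. -/
def pinnedGrad (L : ℕ) : ({x : Torus L // x ≠ 0} → ℝ) →ₗ[ℝ] (Edge L → ℝ) where
  toFun ψ := grad fun x => if h : x = 0 then (0 : ℝ) else ψ ⟨x, h⟩
  map_add' ψ ψ' := by
    ext e
    simp only [grad, Pi.add_apply]
    split_ifs <;> ring
  map_smul' c ψ := by
    ext e
    simp only [grad, Pi.smul_apply, smul_eq_mul, RingHom.id_apply]
    split_ifs <;> ring

lemma nuL_eq_map_pinnedGrad (L : ℕ) [NeZero L] : nuL L = volume.map (pinnedGrad L) := by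
  have hext : Measurable fun ψ : {x : Torus L // x ≠ 0} → ℝ => fun x : Torus L =>
      if h : x = 0 then (0 : ℝ) else ψ ⟨x, h⟩ := by
    refine measurable_pi_lambda _ fun x => ?_
    split_ifs <;> fun_prop
  have hgrad : Measurable fun φ : Torus L → ℝ => grad φ := by
    unfold grad
    fun_prop
  rw [nuL, Measure.map_map hgrad hext]
  rfl

instance (L : ℕ) [NeZero L] : SFinite (nuL L) := by
  rw [nuL]
  infer_instance

instance (L : ℕ) [NeZero L] (ρ : Measure ℝ) [IsProbabilityMeasure ρ] :
    IsProbabilityMeasure (rhoL L ρ) := by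
  rw [rhoL]
  infer_instance

lemma measurable_energy (L : ℕ) [NeZero L] :
    Measurable fun x : (Edge L → ℝ) × (Edge L → ℝ) => energy L x.2 x.1 := by
  unfold energy
  fun_prop

lemma lintegral_nuL_exp_linear_le (L : ℕ) [NeZero L] {κ : Edge L → ℝ} {m : ℝ} (hm : 0 < m)
    (hκ : ∀ b, m ≤ κ b) (ℓ : Edge L → ℝ) :
    ∫⁻ η, ENNReal.ofReal (exp (∑ b, ℓ b * η b)) *
        ENNReal.ofReal (exp (-(energy L κ η))) ∂(nuL L) ≤
      ENNReal.ofReal (exp ((∑ b, ℓ b ^ 2) / (2 * m))) * ZL L κ := by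
  have hG : Measurable (pinnedGrad L) := (pinnedGrad L).continuous_of_finiteDimensional.measurable
  have hen : Measurable (energy L κ) := (measurable_energy L).comp measurable_prodMk_right
  rw [ZL, nuL_eq_map_pinnedGrad, lintegral_map (by fun_prop) hG, lintegral_map (by fun_prop) hG]
  exact lintegral_exp_linear_mul_gaussian_le volume (pinnedGrad L) hm hκ ℓ

lemma ae_sInf_measSupport_le (ρ : Measure ℝ) (hρ : ρ (Set.Iic 0) = 0) :
    ∀ᵐ x ∂ρ, sInf (measSupport ρ) ≤ x := by
  have hsupp : measSupport ρ = ρ.support := by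
    ext x
    rw [Measure.mem_support_iff_forall]
    rfl
  have hbdd : BddBelow (measSupport ρ) :=
    ⟨0, fun x hx => not_lt.1 fun h0 => (hx (Set.Iic 0) (Iic_mem_nhds h0)).ne' hρ⟩
  filter_upwards [ρ.support_mem_ae] with x hx
  exact csInf_le hbdd (hsupp ▸ hx)

/-- Chernoff bound for linear functionals of the gradient field. -/
lemma PL_le_linear_le (L : ℕ) [NeZero L] (ρ : Measure ℝ) [IsProbabilityMeasure ρ] {m : ℝ}
    (hm : 0 < m) (hρm : ∀ᵐ x ∂ρ, m ≤ x) (ℓ : Edge L → ℝ) (c : ℝ) :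
    PL L ρ {η | c ≤ ∑ b, ℓ b * η b} ≤
      ENNReal.ofReal (exp ((∑ b, ℓ b ^ 2) / (2 * m) - c)) := by
  have hmeas : Measurable fun x : (Edge L → ℝ) × (Edge L → ℝ) =>
      ENNReal.ofReal (exp (-(energy L x.2 x.1))) := (measurable_energy L).neg.exp.ennreal_ofReal
  have hS : MeasurableSet {η : Edge L → ℝ | c ≤ ∑ b, ℓ b * η b} :=
    measurableSet_le measurable_const (by fun_prop)
  have hκ : ∀ᵐ κ ∂(rhoL L ρ), ∀ b, m ≤ κ b :=
    ae_all_iff.2 fun b => (Measure.quasiMeasurePreserving_eval (fun _ : Edge L => ρ) b).ae hρm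
  have hmgf : ∫⁻ x : (Edge L → ℝ) × (Edge L → ℝ), ENNReal.ofReal (exp (∑ b, ℓ b * x.1 b)) *
        ENNReal.ofReal (exp (-(energy L x.2 x.1))) ∂((nuL L).prod (rhoL L ρ)) ≤
      ENNReal.ofReal (exp ((∑ b, ℓ b ^ 2) / (2 * m))) * ZLV L ρ := by
    have htilt : Measurable fun x : (Edge L → ℝ) × (Edge L → ℝ) =>
        ENNReal.ofReal (exp (∑ b, ℓ b * x.1 b)) *
          ENNReal.ofReal (exp (-(energy L x.2 x.1))) := Measurable.mul (by fun_prop) hmeas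
    rw [ZLV, lintegral_prod_symm _ htilt.aemeasurable,
      lintegral_prod_symm _ hmeas.aemeasurable,
      ← lintegral_const_mul' _ _ ENNReal.ofReal_ne_top]
    refine lintegral_mono_ae ?_
    filter_upwards [hκ] with κ hκ
    exact lintegral_nuL_exp_linear_le L hm hκ ℓ
  rw [PL, Measure.map_apply measurable_fst hS, QL, Measure.smul_apply,
    withDensity_apply _ (measurable_fst hS), smul_eq_mul]
  calc _ ≤ (ZLV L ρ)⁻¹ * (ENNReal.ofReal (exp (-c)) *
        ∫⁻ x : (Edge L → ℝ) × (Edge L → ℝ), ENNReal.ofReal (exp (∑ b, ℓ b * x.1 b)) *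
          ENNReal.ofReal (exp (-(energy L x.2 x.1))) ∂((nuL L).prod (rhoL L ρ))) := by
        gcongr
        rw [← lintegral_const_mul' _ _ ENNReal.ofReal_ne_top]
        refine (setLIntegral_mono' (measurable_fst hS) fun x hx => ?_).trans
          (setLIntegral_le_lintegral _ _)
        rw [← mul_assoc, ← ENNReal.ofReal_mul (exp_pos _).le, ← exp_add]
        refine le_mul_of_one_le_left zero_le ?_
        rw [ENNReal.one_le_ofReal, one_le_exp_iff]
        have : c ≤ ∑ b, ℓ b * x.1 b := hx
        linarith
    _ ≤ (ZLV L ρ)⁻¹ * (ENNReal.ofReal (exp (-c)) *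
        (ENNReal.ofReal (exp ((∑ b, ℓ b ^ 2) / (2 * m))) * ZLV L ρ)) := by gcongr
    _ = ENNReal.ofReal (exp ((∑ b, ℓ b ^ 2) / (2 * m) - c)) * ((ZLV L ρ)⁻¹ * ZLV L ρ) := by
        rw [sub_eq_neg_add, exp_add, ENNReal.ofReal_mul (exp_pos _).le]
        ring
    _ ≤ _ := mul_le_of_le_one_right zero_le (ENNReal.inv_mul_le_one _)

/-- One-sided tail bound for the sum of the gradient field over a subset `S` of `n` bonds. -/
lemma PL_le_signed_sum_le (L : ℕ) [NeZero L] (ρ : Measure ℝ) [IsProbabilityMeasure ρ] {m : ℝ}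
    (hm : 0 < m) (hρm : ∀ᵐ x ∂ρ, m ≤ x) (S : Finset (Edge L)) {n : ℕ} (hS : S.card ≤ n)
    {σ : ℝ} (hσ : σ ^ 2 = 1) {δ : ℝ} (hδ : 0 < δ) :
    PL L ρ {η | δ / 2 * n ≤ σ * ∑ b ∈ S, η b} ≤
      ENNReal.ofReal (exp (-(1 / 8) * m * δ ^ 2 * n)) := by
  set t := m * δ / 2 with ht
  have ht0 : 0 < t := by positivity
  have hsum (η : Edge L → ℝ) :
      ∑ b, (if b ∈ S then t * σ else 0) * η b = t * (σ * ∑ b ∈ S, η b) := by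
    simp [ite_mul, Finset.sum_ite_mem, ← Finset.mul_sum, mul_assoc]
  have hsq : ∑ b, (if b ∈ S then t * σ else 0) ^ 2 = S.card * t ^ 2 := by
    simp [ite_pow, Finset.sum_ite_mem, mul_pow, hσ]
  have h := PL_le_linear_le L ρ hm hρm (fun b => if b ∈ S then t * σ else 0) (t * (δ / 2 * n))
  simp only [hsum, hsq, mul_le_mul_iff_right₀ ht0] at h
  refine h.trans (ENNReal.ofReal_le_ofReal (exp_le_exp.2 ?_))
  have hn : (S.card : ℝ) * t ^ 2 / (2 * m) ≤ n * t ^ 2 / (2 * m) := by gcongr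
  have : (n : ℝ) * t ^ 2 / (2 * m) - t * (δ / 2 * n) = -(1 / 8) * m * δ ^ 2 * n := by
    rw [ht]
    field_simp
    ring
  linarith

/-- exponential tightness of the empirical tilt under `P_L`,
with `κ_min = inf (supp ρ) > 0`. -/
theorem tilt_tightness (L : ℕ) [NeZero L] (hL : Even L) (hL0 : 0 < L)
    (ρ : Measure ℝ) [IsProbabilityMeasure ρ] (hρ : ρ (Set.Iic 0) = 0)
    (κmin : ℝ) (hκmin : κmin = sInf (measSupport ρ)) (hκpos : 0 < κmin)
    (Λ : Finset (Torus L)) (hΛ : (bondsIn L Λ).Nonempty) (δ : ℝ) (hδ : 0 < δ) :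
    PL L ρ {η | δ ≤ tiltNorm L Λ η} ≤
      ENNReal.ofReal
        (4 * Real.exp (-(1 / 8) * κmin * δ ^ 2 * (bondsIn L Λ).card)) := by
  subst hκmin
  have hρm := ae_sInf_measSupport_le ρ hρ
  set B := bondsIn L Λ with hB
  have hn : (0 : ℝ) < B.card := by exact_mod_cast hΛ.card_pos
  let A (d : Bool) (σ : ℝ) : Set (Edge L → ℝ) :=
    {η | δ / 2 * B.card ≤ σ * ∑ b ∈ B.filter fun e => e.2 = d, η b}
  have hA (d : Bool) {σ : ℝ} (hσ : σ ^ 2 = 1) :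
      PL L ρ (A d σ) ≤ ENNReal.ofReal
        (exp (-(1 / 8) * sInf (measSupport ρ) * δ ^ 2 * B.card)) :=
    PL_le_signed_sum_le L ρ hκpos hρm _ (Finset.card_filter_le _ _) hσ hδ
  have hsub : {η | δ ≤ tiltNorm L Λ η} ⊆ (A true 1 ∪ A true (-1)) ∪ (A false 1 ∪ A false (-1)) := by
    intro η hη
    have h2 : δ ^ 2 ≤ tiltHor L Λ η ^ 2 + tiltVert L Λ η ^ 2 := (le_sqrt' hδ).1 hη
    have hor : δ / 2 ≤ |tiltHor L Λ η| ∨ δ / 2 ≤ |tiltVert L Λ η| := by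
      by_contra! hlt
      have h1 := pow_lt_pow_left₀ hlt.1 (abs_nonneg _) two_ne_zero
      have h3 := pow_lt_pow_left₀ hlt.2 (abs_nonneg _) two_ne_zero
      rw [sq_abs] at h1 h3
      nlinarith
    have hmem {d : Bool} (h : δ / 2 ≤ |(∑ b ∈ B.filter fun e => e.2 = d, η b) / B.card|) :
        η ∈ A d 1 ∪ A d (-1) := by
      rw [abs_div, abs_of_pos hn, le_div_iff₀ hn, le_abs] at h
      exact h.imp (fun h => h.trans_eq (one_mul _).symm) fun h => h.trans_eq (neg_one_mul _).symm
    exact hor.imp hmem hmem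
  calc PL L ρ {η | δ ≤ tiltNorm L Λ η}
      ≤ (PL L ρ (A true 1) + PL L ρ (A true (-1))) +
        (PL L ρ (A false 1) + PL L ρ (A false (-1))) :=
        (measure_mono hsub).trans <| (measure_union_le _ _).trans <|
          add_le_add (measure_union_le _ _) (measure_union_le _ _)
    _ ≤ 4 * ENNReal.ofReal (exp (-(1 / 8) * sInf (measSupport ρ) * δ ^ 2 * B.card)) := by
        refine (add_le_add (add_le_add (hA true (by norm_num)) (hA true (by norm_num)))
          (add_le_add (hA false (by norm_num)) (hA false (by norm_num)))).trans_eq ?_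
        ring
    _ = _ := by rw [ENNReal.ofReal_mul (by norm_num), ENNReal.ofReal_ofNat]

end
end
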